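/- arXiv:1405.3324 — 4 statements merged into one kernel-verified Lean document; each statement's English description precedes it below -/
import Mathlib

section
/- Let q be a prime power, d ≥ 4, F an algebraically closed field, and let Ω be the set of 2-dimensional F_q-subspaces of the vector space W = F_q^d. The natural action of SL_d(W) on Ω induces a homomorphism SL_d(q) → Sym(Ω) whose image X is isomorphic to PSL_d(q) and is contained in Alt(Ω). For every F Alt(Ω)-module V with dim_F V > 1, the restriction of V to X is a reducible F X-module. -/
open Matrix

/-- A submodule is invariant under a representation. -/
def RepInvariant {F G V : Type*} [Field F] [Monoid G] [AddCommGroup V] [Module F V]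
    (ρ : Representation F G V) (p : Submodule F V) : Prop :=
  ∀ g : G, ∀ v ∈ p, ρ g v ∈ p

/-- A representation is irreducible if the space is nonzero and the only invariant
submodules are `⊥` and `⊤`. -/
def RepIrreducible {F G V : Type*} [Field F] [Monoid G] [AddCommGroup V] [Module F V]
    (ρ : Representation F G V) : Prop :=
  Nontrivial V ∧ ∀ p : Submodule F V, RepInvariant ρ p → p = ⊥ ∨ p = ⊤

/-- The set `Ω` of 2-dimensional subspaces of `𝔽_q^d`. -/
def GrassTwo (𝔽 : Type*) [Field 𝔽] (d : ℕ) : Type _ :=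
  {U : Submodule 𝔽 (Fin d → 𝔽) // Module.finrank 𝔽 U = 2}

instance (𝔽 : Type*) [Field 𝔽] [Finite 𝔽] (d : ℕ) : Finite (GrassTwo 𝔽 d) := by
  have : Finite (Submodule 𝔽 (Fin d → 𝔽)) :=
    Finite.of_injective (fun U => (U : Set (Fin d → 𝔽))) SetLike.coe_injective
  unfold GrassTwo
  infer_instance

noncomputable instance (𝔽 : Type*) [Field 𝔽] [Finite 𝔽] (d : ℕ) : Fintype (GrassTwo 𝔽 d) :=
  Fintype.ofFinite _

noncomputable instance (𝔽 : Type*) [Field 𝔽] (d : ℕ) : DecidableEq (GrassTwo 𝔽 d) :=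
  Classical.decEq _

/-- The natural action of `SL_d(𝔽)` on the set of 2-dimensional subspaces of `𝔽^d`. -/
noncomputable instance grassTwoMulAction (𝔽 : Type*) [Field 𝔽] (d : ℕ) :
    MulAction (SpecialLinearGroup (Fin d) 𝔽) (GrassTwo 𝔽 d) where
  smul g U := ⟨U.1.map (SpecialLinearGroup.toLin' g :
      (Fin d → 𝔽) →ₗ[𝔽] Fin d → 𝔽), by
    rw [LinearEquiv.finrank_map_eq]
    exact U.2⟩
  one_smul U := by
    apply Subtype.ext
    show Submodule.map _ U.1 = U.1
    rw [_root_.map_one]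
    simp
  mul_smul g h U := by
    apply Subtype.ext
    show Submodule.map _ U.1 = Submodule.map _ (Submodule.map _ U.1)
    rw [_root_.map_mul, ← Submodule.map_comp]
    rfl

/-- The homomorphism `SL_d(𝔽) → Sym(Ω)` induced by the action on 2-dimensional
subspaces. -/
noncomputable def slToPerm (𝔽 : Type*) [Field 𝔽] (d : ℕ) :
    SpecialLinearGroup (Fin d) 𝔽 →* Equiv.Perm (GrassTwo 𝔽 d) :=
  MulAction.toPermHom _ _

namespace Matrix.SpecialLinearGroup

variable {ι K H : Type*} [Fintype ι] [DecidableEq ι]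

open scoped commutatorElement

theorem commutatorElement_transvection [CommRing K] {i j k : ι} (hij : i ≠ j) (hjk : j ≠ k)
    (hik : i ≠ k) (a b : K) :
    ⁅transvection hij a, transvection hjk b⁆ = transvection hik (a * b) := by
  rw [commutatorElement_def, transvection_inv, transvection_inv]
  apply Subtype.ext
  simp [transvection_coe, mul_add, add_mul, single_mul_single_of_ne, hij.symm, hjk.symm,
    hik.symm, ← single_neg]
  abel

theorem diag2n_eq_prod_transvection [Field K] {i j : ι} (hij : i ≠ j) (c : K) (hc : c ≠ 0) :
    diag2n hij c hc = transvection hij c * transvection hij.symm (-c⁻¹) * transvection hij c *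
      transvection hij (-1) * transvection hij.symm 1 * transvection hij (-1) := by
  apply Subtype.ext
  simp [transvection_coe, diag2n_coe, mul_add, add_mul, single_mul_single_of_ne, hij, hij.symm, hc,
    ← single_neg]
  ext k l
  simp [diagonal_apply, Matrix.one_apply, single_apply]
  grind

theorem map_eq_one_of_commGroup [Field K] [CommGroup H] (hι : 2 < Fintype.card ι)
    (ψ : SpecialLinearGroup ι K →* H) (g : SpecialLinearGroup ι K) : ψ g = 1 := by
  have : Nontrivial ι := Fintype.one_lt_card_iff_nontrivial.1 (by omega)
  have htr (i j : ι) (hij : i ≠ j) (a : K) : ψ (transvection hij a) = 1 := by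
    obtain ⟨k, hki, hkj⟩ : ∃ k, k ≠ i ∧ k ≠ j := by
      obtain ⟨k, hk⟩ : ∃ k, k ∉ ({i, j} : Finset ι) := by
        by_contra! h
        have := Finset.card_le_card (fun k _ => h k : Finset.univ ⊆ ({i, j} : Finset ι))
        have := Finset.card_le_two (a := i) (b := j)
        rw [Finset.card_univ] at *
        omega
      exact ⟨k, by simpa using hk⟩
    rw [← mul_one a, ← commutatorElement_transvection hki.symm hkj hij, map_commutatorElement,
      commutatorElement_eq_one_iff_mul_comm, mul_comm]
  refine diagonal_transvection_induction' (fun M => ψ M = 1) g (fun i j hij c hc => ?_) htr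
    fun A B hA hB => by rw [map_mul, hA, hB, one_mul]
  simp only [diag2n_eq_prod_transvection, map_mul, htr, one_mul]

end Matrix.SpecialLinearGroup

theorem slToPerm_range_le_alternatingGroup (𝔽 : Type*) [Field 𝔽] [Finite 𝔽] {d : ℕ} (hd : 2 < d) :
    (slToPerm 𝔽 d).range ≤ alternatingGroup (GrassTwo 𝔽 d) := by
  rintro _ ⟨g, rfl⟩
  exact SpecialLinearGroup.map_eq_one_of_commGroup (by simpa using hd)
    (Equiv.Perm.sign.comp (slToPerm 𝔽 d)) g

theorem finrank_span_pair {K W : Type*} [Field K] [AddCommGroup W]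
    [Module K W] {a b : W} (hab : LinearIndependent K ![a, b]) :
    Module.finrank K (Submodule.span K {a, b}) = 2 := by
  have := finrank_span_eq_card hab
  rwa [range_cons_cons_empty] at this

theorem Submodule.eq_span_pair_of_finrank_eq_two {K W : Type*} [Field K] [AddCommGroup W]
    [Module K W] {U : Submodule K W} (hU : Module.finrank K U = 2) {a b : W} (ha : a ∈ U)
    (hb : b ∈ U) (hab : LinearIndependent K ![a, b]) : U = span K {a, b} := by
  have : FiniteDimensional K U := Module.finite_of_finrank_pos (by omega)
  refine (Submodule.eq_of_le_of_finrank_eq ?_ ?_).symm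
  · rw [span_le]
    rintro _ (rfl | rfl) <;> assumption
  · rw [hU, finrank_span_pair hab]

theorem coe_slToPerm_apply {𝔽 : Type*} [Field 𝔽] {d : ℕ} (g : SpecialLinearGroup (Fin d) 𝔽)
    (U : GrassTwo 𝔽 d) :
    (slToPerm 𝔽 d g U).1 = U.1.map (SpecialLinearGroup.toLin' g).toLinearMap := rfl

theorem ker_slToPerm (𝔽 : Type*) [Field 𝔽] {d : ℕ} (hd : 2 < d) :
    (slToPerm 𝔽 d).ker = Subgroup.center _ := by
  ext g
  rw [MonoidHom.mem_ker, Matrix.SpecialLinearGroup.mem_center_iff]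
  set f : (Fin d → 𝔽) →ₗ[𝔽] Fin d → 𝔽 := (Matrix.SpecialLinearGroup.toLin' g).toLinearMap with hf
  constructor
  · intro hg
    have key (v : Fin d → 𝔽) : ¬ LinearIndependent 𝔽 ![v, f v] := by
      intro hv
      have hv0 : v ≠ 0 := hv.ne_zero 0
      obtain ⟨u, hu⟩ : ∃ u, u ∉ Submodule.span 𝔽 {v, f v} := by
        by_contra! h
        have h1 := finrank_span_pair hv
        rw [Submodule.eq_top_iff'.2 h, finrank_top, Module.finrank_fin_fun] at h1
        omega
      have hvu : LinearIndependent 𝔽 ![v, u] := by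
        rw [LinearIndependent.pair_iff' hv0]
        rintro a rfl
        exact hu (Submodule.smul_mem _ _ (Submodule.subset_span (by simp)))
      have h1 : (Submodule.span 𝔽 {v, u}).map f = Submodule.span 𝔽 {v, u} :=
        congr_arg (fun σ => (σ ⟨_, finrank_span_pair hvu⟩ : GrassTwo 𝔽 d).1) hg
      have h2 : f v ∈ Submodule.span 𝔽 {v, u} :=
        h1 ▸ Submodule.mem_map_of_mem (Submodule.subset_span (by simp))
      obtain ⟨s, t, hst⟩ := Submodule.mem_span_pair.1 h2
      have ht : t ≠ 0 := by
        rintro rfl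
        exact (LinearIndependent.pair_iff' hv0).1 hv s (by simpa using hst)
      refine hu (Submodule.mem_span_pair.2 ⟨-(t⁻¹ * s), t⁻¹, ?_⟩)
      rw [← hst]
      simp [smul_smul, ht]
    obtain ⟨a, ha⟩ := f.exists_eq_smul_id_of_forall_notLinearIndependent key
    have hscalar : g.1 = Matrix.scalar (Fin d) a := calc
      g.1 = LinearMap.toMatrix' f := by
        rw [hf, Matrix.SpecialLinearGroup.toLin'_to_linearMap, LinearMap.toMatrix'_toLin']
      _ = (algebraMap 𝔽 (Module.End 𝔽 (Fin d → 𝔽)) a).toMatrix' := congrArg LinearMap.toMatrix' ha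
      _ = Matrix.scalar (Fin d) a := LinearMap.toMatrix'_algebraMap a
    exact ⟨a, by simpa [hscalar] using g.2, hscalar.symm⟩
  · rintro ⟨r, -, hr⟩
    have hfr (v : Fin d → 𝔽) : f v = r • v := by
      change g.1 *ᵥ v = _
      simp [← hr]
    ext1 U
    apply Subtype.ext
    rw [coe_slToPerm_apply, ← hf]
    have hle : U.1.map f ≤ U.1 := by
      rintro _ ⟨v, hv, rfl⟩
      rw [hfr]
      exact U.1.smul_mem _ hv
    refine Submodule.eq_of_le_of_finrank_eq hle ?_
    rw [hf, LinearEquiv.finrank_map_eq]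
    rfl

theorem nonempty_range_slToPerm_mulEquiv (𝔽 : Type*) [Field 𝔽] {d : ℕ} (hd : 2 < d) :
    Nonempty ((slToPerm 𝔽 d).range ≃* Matrix.ProjectiveSpecialLinearGroup (Fin d) 𝔽) :=
  ⟨(QuotientGroup.quotientKerEquivRange _).symm.trans
    (QuotientGroup.quotientMulEquivOfEq (ker_slToPerm 𝔽 hd))⟩

section ThreeCycle

variable {Ω : Type*} [DecidableEq Ω]

/-- The product of transpositions `(x y)(y z)`, a 3-cycle when the points are distinct. -/
def threeCycle (x y z : Ω) : Equiv.Perm Ω := Equiv.swap x y * Equiv.swap y z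

theorem threeCycle_apply_left {x y z : Ω} (hxy : x ≠ y) (hxz : x ≠ z) : threeCycle x y z x = y := by
  simp [threeCycle, Equiv.swap_apply_of_ne_of_ne hxy hxz]

theorem threeCycle_apply_of_ne {x y z t : Ω} (hx : t ≠ x) (hy : t ≠ y) (hz : t ≠ z) :
    threeCycle x y z t = t := by
  simp [threeCycle, Equiv.swap_apply_of_ne_of_ne, hx, hy, hz]

theorem threeCycle_apply_of_notMem {x y z t : Ω} (h : t ∉ ({x, y, z} : Finset Ω)) :
    threeCycle x y z t = t := by
  simp only [Finset.mem_insert, Finset.mem_singleton, not_or] at h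
  exact threeCycle_apply_of_ne h.1 h.2.1 h.2.2

theorem image_threeCycle_of_disjoint {x y z : Ω} {T : Finset Ω}
    (hT : Disjoint T {x, y, z}) : T.image (threeCycle x y z) = T :=
  (Finset.image_congr fun _ ht => threeCycle_apply_of_notMem
    (Finset.disjoint_left.1 hT ht)).trans Finset.image_id

theorem threeCycle_mul_comm {x y z u v w : Ω}
    (h : Disjoint ({x, y, z} : Finset Ω) {u, v, w}) :
    threeCycle x y z * threeCycle u v w = threeCycle u v w * threeCycle x y z := by
  refine Equiv.Perm.Disjoint.commute fun t => ?_
  by_cases ht : t ∈ ({x, y, z} : Finset Ω)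
  · exact Or.inr (threeCycle_apply_of_notMem (Finset.disjoint_left.1 h ht))
  · exact Or.inl (threeCycle_apply_of_notMem ht)

theorem threeCycle_mem [Fintype Ω] {x y z : Ω} (hxy : x ≠ y) (hyz : y ≠ z) :
    threeCycle x y z ∈ alternatingGroup Ω := by
  simp [threeCycle, Equiv.Perm.mem_alternatingGroup, Equiv.Perm.sign_swap hxy,
    Equiv.Perm.sign_swap hyz]

end ThreeCycle

theorem exists_alternatingGroup_map_eq {Ω : Type*} [Fintype Ω] [DecidableEq Ω] {l l' : List Ω}
    (hl : l.Nodup) (hl' : l'.Nodup) (h : l.length = l'.length)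
    (hc : l.length + 2 ≤ Fintype.card Ω) :
    ∃ a : alternatingGroup Ω, l.map a.1 = l' := by
  have : Nat.card Ω = Fintype.card Ω := Nat.card_eq_fintype_card
  have := alternatingGroup.isMultiplyPretransitive Ω
  have : MulAction.IsMultiplyPretransitive (alternatingGroup Ω) Ω l.length :=
    MulAction.isMultiplyPretransitive_of_le (n := Nat.card Ω - 2) (by omega) (by omega)
  obtain ⟨a, ha⟩ := MulAction.exists_smul_eq (alternatingGroup Ω)
    (⟨l.get, List.nodup_iff_injective_get.1 hl⟩ : Fin l.length ↪ Ω)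
    ⟨fun i => l'.get (i.cast h), (List.nodup_iff_injective_get.1 hl').comp (Fin.cast_injective h)⟩
  refine ⟨a, List.ext_get (by simpa using h) fun i h1 h2 => ?_⟩
  rw [List.length_map] at h1
  simp only [List.get_eq_getElem, List.getElem_map]
  exact DFunLike.congr_fun ha ⟨i, h1⟩

/-- The mixed second difference of a function on three-element sets. -/
def secondDiff {Ω M : Type*} [DecidableEq Ω] [AddCommGroup M] (Φ : Finset Ω → M)
    (x x' y y' z : Ω) : M :=
  Φ {x, y, z} - Φ {x', y, z} - Φ {x, y', z} + Φ {x', y', z}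

theorem secondDiff_map {Ω F M A : Type*} [DecidableEq Ω] [Field F] [AddCommGroup M] [Module F M]
    [Monoid A] (σ : Representation F A M) (Φ : Finset Ω → M)
    {a : A} {e : Equiv.Perm Ω}  (hΦ : ∀ T, σ a (Φ T) = Φ (T.image e)) (x x' y y' z : Ω) :
    σ a (secondDiff Φ x x' y y' z) = secondDiff Φ (e x) (e x') (e y) (e y') (e z) := by
  simp only [secondDiff, map_sub, map_add, hΦ, Finset.image_insert, Finset.image_singleton]

/-- A weight on three-element sets, together with nine points at which it is so sparse that
invariance of a weighted sum forces the vanishing of mixed second differences. -/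
structure IsSparseWeight {Ω F : Type*} [Fintype Ω] [DecidableEq Ω] [Field F] (w : Finset Ω → F)
    (x x₁ x₂ y y₁ y₂ z z₁ z₂ : Ω) : Prop where
  nodup : [x, x₁, x₂, y, y₁, y₂, z, z₁, z₂].Nodup
  card : ∀ T, w T ≠ 0 → T.card = 3
  mem : ∀ T, w T ≠ 0 → ¬ Disjoint T {x, x₁, x₂} → ¬ Disjoint T {y, y₁, y₂} → x ∈ T ∧ y ∈ T
  notMem : ∀ v, w {x, y, v} ≠ 0 → v ∉ [x₁, x₂, y₁, y₂]
  apply_z : w {x, y, z} = 1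
  apply_z₁ : w {x, y, z₁} = 0
  apply_z₂ : w {x, y, z₂} = 0
  sum : ∑ v, w {x, y, v} = 1

set_option maxHeartbeats 1000000 in
theorem IsSparseWeight.secondDiff_eq_zero {Ω F M : Type*} [Fintype Ω] [DecidableEq Ω] [Field F]
    [AddCommGroup M] [Module F M] {w : Finset Ω → F} {x₀ x₁ x₂ y₀ y₁ y₂ z₀ z₁ z₂ : Ω}
    (hw : IsSparseWeight w x₀ x₁ x₂ y₀ y₁ y₂ z₀ z₁ z₂)
    (σ : Representation F (alternatingGroup Ω) M) (Φ : Finset Ω → M)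
    (hΦ : ∀ a T, σ a (Φ T) = Φ (T.image a.1))
    (hfix : ∀ a, σ a (∑ T, w T • Φ T) = ∑ T, w T • Φ T)
    {x x' y y' z : Ω} (hnd : [x, x', y, y', z].Nodup) : secondDiff Φ x x' y y' z = 0 := by
  classical
  have hnd₀ := hw.nodup
  have hcard : 9 ≤ Fintype.card Ω := hnd₀.length_le_card
  simp only [List.nodup_cons, List.mem_cons, List.not_mem_nil, or_false, not_or, not_false_eq_true,
    List.nodup_nil, and_true] at hnd₀
  obtain ⟨⟨_, _, _, _, _, _, _, _⟩, ⟨_, _, _, _, _, _, _⟩, ⟨_, _, _, _, _, _⟩, ⟨_, _, _, _, _⟩,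
    ⟨_, _, _, _⟩, ⟨_, _, _⟩, ⟨_, _⟩, _⟩ := hnd₀
  have hnotMem (v : Ω) (hv : w {x₀, y₀, v} ≠ 0) :
      (v ≠ x₀ ∧ v ≠ x₁ ∧ v ≠ x₂) ∧ v ≠ y₀ ∧ v ≠ y₁ ∧ v ≠ y₂ := by
    have h1 := hw.notMem v hv
    have h2 := hw.card _ hv
    have h3 : v ≠ x₀ := by
      rintro rfl
      have := Finset.card_le_two (a := v) (b := y₀)
      rw [show ({v, y₀, v} : Finset Ω) = {v, y₀} by grind] at h2
      omega
    have h4 : v ≠ y₀ := by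
      rintro rfl
      have := Finset.card_le_two (a := x₀) (b := v)
      rw [show ({x₀, v, v} : Finset Ω) = {x₀, v} by grind] at h2
      omega
    simp at h1
    grind
  let a₁ : alternatingGroup Ω := ⟨threeCycle x₀ x₁ x₂, threeCycle_mem (by grind) (by grind)⟩
  let a₂ : alternatingGroup Ω := ⟨threeCycle y₀ y₁ y₂, threeCycle_mem (by grind) (by grind)⟩
  let a₃ : alternatingGroup Ω := ⟨threeCycle z₀ z₁ z₂, threeCycle_mem (by grind) (by grind)⟩
  have h₁₂ : a₁ * a₂ = a₂ * a₁ := Subtype.ext (threeCycle_mul_comm (by simp; grind))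
  have h₁₃ : a₁ * a₃ = a₃ * a₁ := Subtype.ext (threeCycle_mul_comm (by simp; grind))
  have h₂₃ : a₂ * a₃ = a₃ * a₂ := Subtype.ext (threeCycle_mul_comm (by simp; grind))
  let P (a : alternatingGroup Ω) (m : M) : M := m - σ a m
  have hP0 (a : alternatingGroup Ω) : P a 0 = 0 := by simp [P]
  have hPsum (a : alternatingGroup Ω) (Ψ : Finset Ω → M) :
      P a (∑ T, w T • Ψ T) = ∑ T, w T • P a (Ψ T) := by
    simp [P, map_sum, smul_sub]
  have hPcomm {a b : alternatingGroup Ω} (hab : a * b = b * a) (m : M) :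
      P a (P b m) = P b (P a m) := by
    have : σ a (σ b m) = σ b (σ a m) := by
      rw [← Module.End.mul_apply, ← map_mul, hab, map_mul, Module.End.mul_apply]
    simp only [P, map_sub, this]
    abel
  have hPΦ {a b c : Ω} {h} {T : Finset Ω} (hT : Disjoint T {a, b, c}) :
      P ⟨threeCycle a b c, h⟩ (Φ T) = 0 := by
    simp only [P, hΦ, image_threeCycle_of_disjoint hT, sub_self]
  have hsum₂ : ∑ T, w T • P a₁ (P a₂ (Φ T)) = 0 := by
    rw [← hPsum, ← hPsum, show P a₂ (∑ T, w T • Φ T) = 0 by simp only [P, hfix, sub_self], hP0]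
  have hmem (T : Finset Ω) (hT : w T ≠ 0) (h : P a₁ (P a₂ (Φ T)) ≠ 0) : x₀ ∈ T ∧ y₀ ∈ T := by
    refine hw.mem T hT (fun h' => h ?_) (fun h' => h ?_)
    · rw [hPcomm h₁₂, hPΦ h', hP0]
    · rw [hPΦ h', hP0]
  have hform (T : Finset Ω) (hT : w T ≠ 0) (hxT : x₀ ∈ T) (hyT : y₀ ∈ T) :
      ∃ v, T = {x₀, y₀, v} := by
    have hxy : x₀ ≠ y₀ := by grind
    have h1 : ((T.erase x₀).erase y₀).card = 1 := by
      rw [Finset.card_erase_of_mem (by simp [hxy.symm, hyT]), Finset.card_erase_of_mem hxT,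
        hw.card T hT]
    obtain ⟨v, hv⟩ := Finset.card_eq_one.1 h1
    refine ⟨v, ?_⟩
    rw [← hv, Finset.insert_erase (by simp [hxy.symm, hyT]), Finset.insert_erase hxT]
  have hPP (v : Ω) (hv : w {x₀, y₀, v} ≠ 0) :
      P a₁ (P a₂ (Φ {x₀, y₀, v})) = secondDiff Φ x₀ x₁ y₀ y₁ v := by
    obtain ⟨⟨h1, h2, h3⟩, h4, h5, h6⟩ := hnotMem v hv
    have e1 : threeCycle x₀ x₁ x₂ x₀ = x₁ := threeCycle_apply_left (by grind) (by grind)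
    have e2 : threeCycle y₀ y₁ y₂ y₀ = y₁ := threeCycle_apply_left (by grind) (by grind)
    have e3 : threeCycle x₀ x₁ x₂ y₀ = y₀ :=
      threeCycle_apply_of_ne (by grind) (by grind) (by grind)
    have e4 : threeCycle x₀ x₁ x₂ y₁ = y₁ :=
      threeCycle_apply_of_ne (by grind) (by grind) (by grind)
    have e5 : threeCycle y₀ y₁ y₂ x₀ = x₀ :=
      threeCycle_apply_of_ne (by grind) (by grind) (by grind)
    simp only [P, map_sub, hΦ, secondDiff, Finset.image_insert, Finset.image_singleton, a₁, a₂,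
      e1, e2, e3, e4, e5, threeCycle_apply_of_ne h1 h2 h3, threeCycle_apply_of_ne h4 h5 h6]
    abel
  have hz : w {x₀, y₀, z₀} ≠ 0 := by simp [hw.apply_z]
  have hthird : secondDiff Φ x₀ x₁ y₀ y₁ z₀ = secondDiff Φ x₀ x₁ y₀ y₁ z₁ := by
    have h1 := hPsum a₃ (fun T => P a₁ (P a₂ (Φ T)))
    rw [hsum₂, hP0, Finset.sum_eq_single {x₀, y₀, z₀}, hw.apply_z, one_smul, hPP _ hz] at h1
    · have h2 := secondDiff_map σ Φ (hΦ a₃) x₀ x₁ y₀ y₁ z₀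
      have e (t : Ω) (h1 : t ≠ z₀) (h2 : t ≠ z₁) (h3 : t ≠ z₂) : a₃.1 t = t :=
        threeCycle_apply_of_ne h1 h2 h3
      rw [e x₀ (by grind) (by grind) (by grind), e x₁ (by grind) (by grind) (by grind),
        e y₀ (by grind) (by grind) (by grind), e y₁ (by grind) (by grind) (by grind),
        show a₃.1 z₀ = z₁ from threeCycle_apply_left (by grind) (by grind)] at h2
      rw [← h2]
      exact (sub_eq_zero.1 h1.symm)
    · intro T _ hT
      by_cases hwT : w T = 0
      · rw [hwT, zero_smul]
      by_cases h12 : P a₁ (P a₂ (Φ T)) = 0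
      · rw [h12, hP0, smul_zero]
      obtain ⟨v, rfl⟩ := hform T hwT (hmem T hwT h12).1 (hmem T hwT h12).2
      rw [hPcomm h₁₃.symm, hPcomm h₂₃.symm, hPΦ, hP0, hP0, smul_zero]
      have : v ≠ z₀ := by rintro rfl; exact hT rfl
      have : v ≠ z₁ := by rintro rfl; exact hwT hw.apply_z₁
      have : v ≠ z₂ := by rintro rfl; exact hwT hw.apply_z₂
      simp
      grind
    · simp
  have hindep (v : Ω) (hv : w {x₀, y₀, v} ≠ 0) :
      secondDiff Φ x₀ x₁ y₀ y₁ v = secondDiff Φ x₀ x₁ y₀ y₁ z₀ := by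
    by_cases hvz : v = z₀
    · rw [hvz]
    obtain ⟨⟨_, _, _⟩, _, _, _⟩ := hnotMem v hv
    obtain ⟨a, ha⟩ := exists_alternatingGroup_map_eq (l := [x₀, x₁, y₀, y₁, z₀, z₁])
      (l' := [x₀, x₁, y₀, y₁, v, z₀]) (by simp; grind) (by simp; grind) rfl (by simp; omega)
    simp only [List.map_cons, List.map_nil, List.cons.injEq, and_true] at ha
    obtain ⟨e1, e2, e3, e4, e5, e6⟩ := ha
    have h2 := congr_arg (σ a) hthird
    rwa [secondDiff_map σ Φ (hΦ a), secondDiff_map σ Φ (hΦ a), e1, e2, e3, e4, e5, e6] at h2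
  have hzero : secondDiff Φ x₀ x₁ y₀ y₁ z₀ = 0 := by
    rw [← one_smul F (secondDiff Φ x₀ x₁ y₀ y₁ z₀), ← hw.sum, Finset.sum_smul, ← hsum₂,
      ← Finset.sum_filter_add_sum_filter_not Finset.univ (fun v => w {x₀, y₀, v} ≠ 0),
      Finset.sum_eq_zero (s := Finset.univ.filter (fun v => ¬ w {x₀, y₀, v} ≠ 0)), add_zero]
    · refine Finset.sum_of_injOn (fun v => {x₀, y₀, v}) ?_ (fun _ _ => by simp) ?_ ?_
      · intro v hv v' hv' (h : ({x₀, y₀, v} : Finset Ω) = {x₀, y₀, v'})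
        have h1 := hnotMem v (by simpa using hv)
        have h2 : v ∈ ({x₀, y₀, v'} : Finset Ω) := h ▸ (by simp)
        simp at h2
        grind
      · intro T _ hT
        by_contra! h
        obtain ⟨hwT, h12⟩ := smul_ne_zero_iff.1 h
        obtain ⟨v, rfl⟩ := hform T hwT (hmem T hwT h12).1 (hmem T hwT h12).2
        exact hT ⟨v, by simpa using hwT, rfl⟩
      · intro v hv
        have hv : w {x₀, y₀, v} ≠ 0 := by simpa using hv
        rw [hPP v hv, hindep v hv]
    · intro v hv
      rw [show w {x₀, y₀, v} = 0 by simpa using hv, zero_smul]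
  obtain ⟨a, ha⟩ := exists_alternatingGroup_map_eq (l := [x₀, x₁, y₀, y₁, z₀])
    (l' := [x, x', y, y', z]) (by simp; grind) hnd rfl (by simp; omega)
  simp only [List.map_cons, List.map_nil, List.cons.injEq, and_true] at ha
  obtain ⟨rfl, rfl, rfl, rfl, rfl⟩ := ha
  rw [← secondDiff_map σ Φ (hΦ a), hzero, map_zero]

/-- The subspace underlying a point of the Grassmannian. -/
def GrassTwo.toSubmodule {𝔽 : Type*} [Field 𝔽] {d : ℕ} (U : GrassTwo 𝔽 d) :
    Submodule 𝔽 (Fin d → 𝔽) :=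
  Subtype.val U

theorem GrassTwo.finrank_toSubmodule {𝔽 : Type*} [Field 𝔽] {d : ℕ} (U : GrassTwo 𝔽 d) :
    Module.finrank 𝔽 U.toSubmodule = 2 :=
  Subtype.property U

theorem GrassTwo.toSubmodule_injective {𝔽 : Type*} [Field 𝔽] {d : ℕ} :
    Function.Injective (GrassTwo.toSubmodule (𝔽 := 𝔽) (d := d)) :=
  Subtype.val_injective

open Classical in
/-- The weight on triples of lines of projective space supported on triples spanning a plane: `1`
on triangles and `-(q + 1)` on concurrent triples. -/
noncomputable def planeWeight (𝔽 F : Type*) [Field 𝔽] [Field F] (d : ℕ)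
    (T : Finset (GrassTwo 𝔽 d)) : F :=
  if T.card = 3 ∧ Module.finrank 𝔽 ↥(T.sup fun U => U.toSubmodule) = 3 then
    if (T.inf fun U => U.toSubmodule) = ⊥ then 1 else -(Nat.card 𝔽 + 1)
  else 0

section PlaneWeight

variable {𝔽 F : Type*} [Field 𝔽] [Field F] {d : ℕ}

theorem planeWeight_image (g : SpecialLinearGroup (Fin d) 𝔽) (T : Finset (GrassTwo 𝔽 d)) :
    planeWeight 𝔽 F d (T.image (slToPerm 𝔽 d g)) = planeWeight 𝔽 F d T := by
  let e := Submodule.orderIsoMapComap (SpecialLinearGroup.toLin' g)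
  have hsup : ((T.image (slToPerm 𝔽 d g)).sup fun U => U.toSubmodule) =
      e (T.sup fun U => U.toSubmodule) := by
    rw [Finset.sup_image, map_finset_sup]
    rfl
  have hinf : ((T.image (slToPerm 𝔽 d g)).inf fun U => U.toSubmodule) =
      e (T.inf fun U => U.toSubmodule) := by
    rw [Finset.inf_image, map_finset_inf]
    rfl
  have hrank : Module.finrank 𝔽 ↥((T.image (slToPerm 𝔽 d g)).sup fun U => U.toSubmodule) =
      Module.finrank 𝔽 ↥(T.sup fun U => U.toSubmodule) := by
    rw [hsup]
    exact LinearEquiv.finrank_map_eq _ _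
  simp only [planeWeight, Finset.card_image_of_injective _ (Equiv.injective _), hrank, hinf,
    map_eq_bot_iff]

theorem card_eq_three_of_planeWeight_ne_zero {T : Finset (GrassTwo 𝔽 d)}
    (h : planeWeight 𝔽 F d T ≠ 0) : T.card = 3 := by
  contrapose! h
  rw [planeWeight, if_neg (fun h' => h h'.1)]

theorem not_disjoint_of_planeWeight_ne_zero {T : Finset (GrassTwo 𝔽 d)}
    (h : planeWeight 𝔽 F d T ≠ 0) {U U' : GrassTwo 𝔽 d} (hU : U ∈ T) (hU' : U' ∈ T) :
    ¬ Disjoint U.toSubmodule U'.toSubmodule := by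
  have h3 : Module.finrank 𝔽 ↥(T.sup fun U => U.toSubmodule) = 3 := by
    contrapose! h
    rw [planeWeight, if_neg (fun h' => h h'.2)]
  intro hd
  have h1 := Submodule.finrank_sup_add_finrank_inf_eq U.toSubmodule U'.toSubmodule
  rw [hd.eq_bot, finrank_bot, U.finrank_toSubmodule, U'.finrank_toSubmodule] at h1
  have h2 : U.toSubmodule ⊔ U'.toSubmodule ≤ T.sup fun U => U.toSubmodule :=
    sup_le (Finset.le_sup (f := fun U : GrassTwo 𝔽 d => U.toSubmodule) hU)
      (Finset.le_sup (f := fun U : GrassTwo 𝔽 d => U.toSubmodule) hU')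
  have := Submodule.finrank_mono h2
  omega

open Classical in
theorem planeWeight_triple {x y : GrassTwo 𝔽 d} {p : Fin d → 𝔽} (hp : p ≠ 0)
    (hxy : x.toSubmodule ⊓ y.toSubmodule = Submodule.span 𝔽 {p}) (v : GrassTwo 𝔽 d) :
    planeWeight 𝔽 F d {x, y, v} =
      if v ≠ x ∧ v ≠ y ∧ v.toSubmodule ≤ x.toSubmodule ⊔ y.toSubmodule then
      if p ∈ v.toSubmodule then -((Nat.card 𝔽 : F) + 1) else 1 else 0 := by
  have hne : x ≠ y := by
    rintro rfl
    have := x.finrank_toSubmodule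
    rw [inf_idem] at hxy
    rw [hxy, finrank_span_singleton hp] at this
    omega
  have h3 := Submodule.finrank_sup_add_finrank_inf_eq x.toSubmodule y.toSubmodule
  rw [hxy, finrank_span_singleton hp, x.finrank_toSubmodule, y.finrank_toSubmodule] at h3
  have hsup : (({x, y, v} : Finset (GrassTwo 𝔽 d)).sup fun U => U.toSubmodule) =
      x.toSubmodule ⊔ y.toSubmodule ⊔ v.toSubmodule := by
    simp [sup_assoc]
  have hinf : (({x, y, v} : Finset (GrassTwo 𝔽 d)).inf fun U => U.toSubmodule) =
      x.toSubmodule ⊓ y.toSubmodule ⊓ v.toSubmodule := by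
    simp [inf_assoc]
  have hle : Module.finrank 𝔽 ↥(x.toSubmodule ⊔ y.toSubmodule ⊔ v.toSubmodule) = 3 ↔
      v.toSubmodule ≤ x.toSubmodule ⊔ y.toSubmodule := by
    constructor
    · intro h
      have := Submodule.eq_of_le_of_finrank_eq
        (le_sup_left : x.toSubmodule ⊔ y.toSubmodule ≤
          x.toSubmodule ⊔ y.toSubmodule ⊔ v.toSubmodule)
        (by omega)
      rw [this]
      exact le_sup_right
    · intro h
      rw [sup_eq_left.2 h]
      omega
  have hcard : ({x, y, v} : Finset (GrassTwo 𝔽 d)).card = 3 ↔ v ≠ x ∧ v ≠ y := by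
    constructor
    · refine fun h => ⟨?_, ?_⟩ <;> rintro rfl
      · rw [Finset.insert_eq_of_mem (by simp)] at h
        have := Finset.card_le_two (a := y) (b := v)
        omega
      · rw [Finset.pair_eq_singleton] at h
        have := Finset.card_le_two (a := x) (b := v)
        omega
    · rintro ⟨h1, h2⟩
      exact Finset.card_eq_three.2 ⟨x, y, v, hne, h1.symm, h2.symm, rfl⟩
  have hbot : x.toSubmodule ⊓ y.toSubmodule ⊓ v.toSubmodule = ⊥ ↔ p ∉ v.toSubmodule := by
    rw [hxy, ← disjoint_iff, disjoint_comm, Submodule.disjoint_span_singleton' hp]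
  have hrank : Module.finrank 𝔽 ↥(({x, y, v} : Finset (GrassTwo 𝔽 d)).sup fun U =>
      U.toSubmodule) = 3 ↔
      v.toSubmodule ≤ x.toSubmodule ⊔ y.toSubmodule := by
    rw [hsup, hle]
  simp only [planeWeight, hcard, hrank, hinf, hbot, ite_not, and_assoc]

end PlaneWeight

section Lines

variable {𝔽 : Type*} [Field 𝔽] {d : ℕ}

theorem LinearIndependent.pair_of_forall {K W : Type*} [Field K] [AddCommGroup W] [Module K W]
    {a b : W} (h : ∀ s t : K, s • a + t • b = 0 → s = 0 ∧ t = 0) :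
    LinearIndependent K ![a, b] :=
  LinearIndependent.pair_iff.2 h

/-- The line of projective space through two independent vectors. -/
def lineThrough (a b : Fin d → 𝔽) (h : LinearIndependent 𝔽 ![a, b]) : GrassTwo 𝔽 d :=
  ⟨Submodule.span 𝔽 {a, b}, finrank_span_pair h⟩

theorem mem_lineThrough {a b c : Fin d → 𝔽} {h : LinearIndependent 𝔽 ![a, b]} :
    c ∈ (lineThrough a b h).toSubmodule ↔ ∃ s t : 𝔽, s • a + t • b = c :=
  Submodule.mem_span_pair

theorem left_mem_lineThrough {a b : Fin d → 𝔽} (h : LinearIndependent 𝔽 ![a, b]) :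
    a ∈ (lineThrough a b h).toSubmodule :=
  Submodule.subset_span (by simp)

theorem right_mem_lineThrough {a b : Fin d → 𝔽} (h : LinearIndependent 𝔽 ![a, b]) :
    b ∈ (lineThrough a b h).toSubmodule :=
  Submodule.subset_span (by simp)

theorem eq_lineThrough {a b : Fin d → 𝔽} (h : LinearIndependent 𝔽 ![a, b]) {v : GrassTwo 𝔽 d}
    (ha : a ∈ v.toSubmodule) (hb : b ∈ v.toSubmodule) : lineThrough a b h = v :=
  GrassTwo.toSubmodule_injective
    (Submodule.eq_span_pair_of_finrank_eq_two v.finrank_toSubmodule ha hb h).symm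

theorem lineThrough_le {a b : Fin d → 𝔽} {h : LinearIndependent 𝔽 ![a, b]}
    {P : Submodule 𝔽 (Fin d → 𝔽)} (ha : a ∈ P) (hb : b ∈ P) :
    (lineThrough a b h).toSubmodule ≤ P := by
  refine Submodule.span_le.2 ?_
  rintro _ (rfl | rfl) <;> assumption

theorem GrassTwo.exists_mem_of_le {P : Submodule 𝔽 (Fin d → 𝔽)} (hP : Module.finrank 𝔽 P = 3)
    {v : GrassTwo 𝔽 d} (hv : v.toSubmodule ≤ P) {a b : Fin d → 𝔽} (ha : a ∈ P) (hb : b ∈ P)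
    (h : LinearIndependent 𝔽 ![a, b]) :
    ∃ s t : 𝔽, (s ≠ 0 ∨ t ≠ 0) ∧ s • a + t • b ∈ v.toSubmodule := by
  have h1 := Submodule.finrank_sup_add_finrank_inf_eq v.toSubmodule (lineThrough a b h).toSubmodule
  have h2 := Submodule.finrank_mono (sup_le hv (lineThrough_le (h := h) ha hb))
  rw [v.finrank_toSubmodule, GrassTwo.finrank_toSubmodule] at h1
  have h3 : v.toSubmodule ⊓ (lineThrough a b h).toSubmodule ≠ ⊥ := by
    intro h3
    rw [h3, finrank_bot] at h1
    omega
  obtain ⟨c, hc, hc0⟩ := Submodule.exists_mem_ne_zero_of_ne_bot h3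
  obtain ⟨s, t, rfl⟩ := mem_lineThrough.1 hc.2
  refine ⟨s, t, ?_, hc.1⟩
  by_contra! hst
  simp [hst] at hc0

theorem Finset.sum_ite_mem_range {α β M : Type*} [Fintype α] [Fintype β] [AddCommMonoid M]
    {f : α → β} (hf : Function.Injective f) [DecidablePred (· ∈ Set.range f)] (c : M) :
    ∑ b, (if b ∈ Set.range f then c else 0) = Fintype.card α • c := by
  rw [← Finset.card_univ, ← Finset.sum_const]
  refine (Finset.sum_of_injOn f hf.injOn (fun _ _ => by simp) ?_ ?_).symm
  · intro b _ hb
    rw [if_neg]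
    simpa using hb
  · simp

set_option maxHeartbeats 1000000 in
theorem sum_planeWeight_lineThrough [Finite 𝔽] (F : Type*) [Field F] {p a b : Fin d → 𝔽}
    (h : ∀ r s t : 𝔽, r • p + s • a + t • b = 0 → r = 0 ∧ s = 0 ∧ t = 0)
    (ha : LinearIndependent 𝔽 ![p, a]) (hb : LinearIndependent 𝔽 ![p, b]) :
    (lineThrough p a ha).toSubmodule ⊓ (lineThrough p b hb).toSubmodule = Submodule.span 𝔽 {p} ∧
      ∑ v, planeWeight 𝔽 F d {lineThrough p a ha, lineThrough p b hb, v} = 1 := by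
  classical
  have := Fintype.ofFinite 𝔽
  have hp : p ≠ 0 := ha.ne_zero 0
  set x := lineThrough p a ha with hx
  set y := lineThrough p b hb with hy
  have hcoef {r s t r' s' t' : 𝔽} (he : r • p + s • a + t • b = r' • p + s' • a + t' • b) :
      r = r' ∧ s = s' ∧ t = t' := by
    have := h (r - r') (s - s') (t - t') (by
      rw [← sub_eq_zero] at he
      rw [← he]
      module)
    simpa only [sub_eq_zero] using this
  have hinf : x.toSubmodule ⊓ y.toSubmodule = Submodule.span 𝔽 {p} := by
    apply le_antisymm
    · rintro c ⟨hcx, hcy⟩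
      obtain ⟨s, t, rfl⟩ := mem_lineThrough.1 hcx
      obtain ⟨s', t', he⟩ := mem_lineThrough.1 hcy
      have := hcoef (r := s') (s := 0) (t := t') (r' := s) (s' := t) (t' := 0) (by simpa using he)
      rw [← this.2.1, zero_smul, add_zero]
      exact Submodule.smul_mem _ _ (Submodule.mem_span_singleton_self p)
    · rw [Submodule.span_singleton_le_iff_mem]
      exact ⟨left_mem_lineThrough ha, left_mem_lineThrough hb⟩
  refine ⟨hinf, ?_⟩
  have hfin : Module.finrank 𝔽 ↥(x.toSubmodule ⊔ y.toSubmodule) = 3 := by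
    have := Submodule.finrank_sup_add_finrank_inf_eq x.toSubmodule y.toSubmodule
    rw [hinf, finrank_span_singleton hp, x.finrank_toSubmodule, y.finrank_toSubmodule] at this
    omega
  have hpP : p ∈ x.toSubmodule ⊔ y.toSubmodule :=
    Submodule.mem_sup_left (left_mem_lineThrough ha)
  have haP : a ∈ x.toSubmodule ⊔ y.toSubmodule :=
    Submodule.mem_sup_left (right_mem_lineThrough ha)
  have hbP : b ∈ x.toSubmodule ⊔ y.toSubmodule :=
    Submodule.mem_sup_right (right_mem_lineThrough hb)
  have hab : LinearIndependent 𝔽 ![a, b] :=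
    LinearIndependent.pair_of_forall fun s t hst => (h 0 s t (by simpa using hst)).2
  have hfi (s t : 𝔽) : LinearIndependent 𝔽 ![s • p + a, t • p + b] :=
    LinearIndependent.pair_of_forall fun r r' hr =>
      (h (r * s + r' * t) r r' (by rw [← hr]; module)).2
  have hgi (s : 𝔽ˣ) : LinearIndependent 𝔽 ![p, a + s.1 • b] :=
    LinearIndependent.pair_of_forall fun r r' hr => by
      have := h r r' (r' * s.1) (by rw [← hr]; module)
      exact ⟨this.1, this.2.1⟩
  let f (s : 𝔽 × 𝔽) : GrassTwo 𝔽 d := lineThrough _ _ (hfi s.1 s.2)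
  let g (s : 𝔽ˣ) : GrassTwo 𝔽 d := lineThrough _ _ (hgi s)
  have hf : Function.Injective f := by
    rintro ⟨s, t⟩ ⟨s', t'⟩ (he : lineThrough _ _ (hfi s t) = lineThrough _ _ (hfi s' t'))
    have h1 := left_mem_lineThrough (hfi s t)
    have h2 := right_mem_lineThrough (hfi s t)
    rw [he, mem_lineThrough] at h1 h2
    obtain ⟨r, r', h1⟩ := h1
    obtain ⟨k, k', h2⟩ := h2
    have h1 := hcoef (r := r * s' + r' * t') (s := r) (t := r') (r' := s) (s' := 1) (t' := 0)
      (by rw [zero_smul, add_zero, one_smul, ← h1]; module)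
    have h2 := hcoef (r := k * s' + k' * t') (s := k) (t := k') (r' := t) (s' := 0) (t' := 1)
      (by rw [zero_smul, add_zero, one_smul, ← h2]; module)
    obtain ⟨h1, rfl, rfl⟩ := h1
    obtain ⟨h2, rfl, rfl⟩ := h2
    rw [one_mul, zero_mul, add_zero] at h1
    rw [one_mul, zero_mul, zero_add] at h2
    rw [h1, h2]
  have hg : Function.Injective g := by
    rintro s s' (he : lineThrough _ _ (hgi s) = lineThrough _ _ (hgi s'))
    have h1 := right_mem_lineThrough (hgi s)
    rw [he, mem_lineThrough] at h1
    obtain ⟨r, r', h1⟩ := h1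
    have h1 := hcoef (r := r) (s := r') (t := r' * s'.1) (r' := 0) (s' := 1) (t' := s.1)
      (by rw [zero_smul, zero_add, one_smul, ← h1]; module)
    obtain ⟨h1, rfl, h2⟩ := h1
    ext
    simpa using h2.symm
  have hfr (v : GrassTwo 𝔽 d) : v ∈ Set.range f ↔
      v ≠ x ∧ v ≠ y ∧ v.toSubmodule ≤ x.toSubmodule ⊔ y.toSubmodule ∧ p ∉ v.toSubmodule := by
    constructor
    · rintro ⟨⟨s, t⟩, rfl⟩
      have hpf : p ∉ (f (s, t)).toSubmodule := by
        intro hpf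
        obtain ⟨r, r', hr⟩ := mem_lineThrough.1 hpf
        have := hcoef (r := r * s + r' * t) (s := r) (t := r') (r' := 1) (s' := 0) (t' := 0)
          (by rw [zero_smul, zero_smul, add_zero, add_zero, one_smul]; refine Eq.trans ?_ hr; module)
        obtain ⟨h1, rfl, rfl⟩ := this
        simp at h1
      refine ⟨fun he => hpf (he ▸ left_mem_lineThrough ha),
        fun he => hpf (he ▸ left_mem_lineThrough hb), lineThrough_le ?_ ?_, hpf⟩
      · exact add_mem (Submodule.smul_mem _ _ hpP) haP
      · exact add_mem (Submodule.smul_mem _ _ hpP) hbP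
    · rintro ⟨-, -, hv, hpv⟩
      have key {c : Fin d → 𝔽} (hc : c ∈ x.toSubmodule ⊔ y.toSubmodule)
          (hpc : LinearIndependent 𝔽 ![p, c]) : ∃ s : 𝔽, s • p + c ∈ v.toSubmodule := by
        obtain ⟨s, t, hst, hm⟩ := GrassTwo.exists_mem_of_le hfin hv hpP hc hpc
        have ht : t ≠ 0 := by
          rintro rfl
          have hs : s ≠ 0 := by simpa using hst
          exact hpv ((Submodule.smul_mem_iff _ hs).1 (by simpa using hm))
        refine ⟨t⁻¹ * s, (Submodule.smul_mem_iff _ ht).1 ?_⟩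
        rwa [smul_add, smul_smul, mul_inv_cancel_left₀ ht]
      obtain ⟨s, hs⟩ := key haP ha
      obtain ⟨t, ht⟩ := key hbP hb
      exact ⟨(s, t), eq_lineThrough _ hs ht⟩
  have hgr (v : GrassTwo 𝔽 d) : v ∈ Set.range g ↔
      v ≠ x ∧ v ≠ y ∧ v.toSubmodule ≤ x.toSubmodule ⊔ y.toSubmodule ∧ p ∈ v.toSubmodule := by
    constructor
    · rintro ⟨s, rfl⟩
      refine ⟨fun he => ?_, fun he => ?_, lineThrough_le hpP
        (add_mem haP (Submodule.smul_mem _ _ hbP)), left_mem_lineThrough _⟩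
      · have h1 : a + s.1 • b ∈ x.toSubmodule := he ▸ right_mem_lineThrough (hgi s)
        obtain ⟨r, r', hr⟩ := mem_lineThrough.1 h1
        have := hcoef (r := r) (s := r') (t := 0) (r' := 0) (s' := 1) (t' := s.1)
          (by rw [zero_smul, zero_smul, one_smul, zero_add, ← hr, add_zero])
        exact s.ne_zero this.2.2.symm
      · have h1 : a + s.1 • b ∈ y.toSubmodule := he ▸ right_mem_lineThrough (hgi s)
        obtain ⟨r, r', hr⟩ := mem_lineThrough.1 h1
        have := hcoef (r := r) (s := 0) (t := r') (r' := 0) (s' := 1) (t' := s.1)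
          (by rw [zero_smul, zero_smul, one_smul, zero_add, ← hr, add_zero])
        exact zero_ne_one this.2.1
    · rintro ⟨hvx, hvy, hv, hpv⟩
      obtain ⟨s, t, hst, hm⟩ := GrassTwo.exists_mem_of_le hfin hv haP hbP hab
      have hs : s ≠ 0 := by
        rintro rfl
        have ht : t ≠ 0 := by simpa using hst
        exact hvy (eq_lineThrough hb hpv
          ((Submodule.smul_mem_iff _ ht).1 (by simpa using hm))).symm
      have ht : t ≠ 0 := by
        rintro rfl
        exact hvx (eq_lineThrough ha hpv
          ((Submodule.smul_mem_iff _ hs).1 (by simpa using hm))).symm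
      refine ⟨Units.mk0 (s⁻¹ * t) (by simp [hs, ht]), eq_lineThrough _ hpv
        ((Submodule.smul_mem_iff _ hs).1 ?_)⟩
      rwa [Units.val_mk0, smul_add, smul_smul, mul_inv_cancel_left₀ hs]
  have hsplit (v : GrassTwo 𝔽 d) : planeWeight 𝔽 F d {x, y, v} =
      (if v ∈ Set.range f then 1 else 0) +
        (if v ∈ Set.range g then -((Nat.card 𝔽 : F) + 1) else 0) := by
    rw [planeWeight_triple hp hinf]
    simp only [hfr, hgr]
    by_cases hpv : p ∈ v.toSubmodule <;> simp [hpv]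
  rw [Finset.sum_congr rfl fun v _ => hsplit v, Finset.sum_add_distrib,
    Finset.sum_ite_mem_range hf, Finset.sum_ite_mem_range hg, Fintype.card_prod,
    Fintype.card_units, Nat.card_eq_fintype_card, nsmul_eq_mul, nsmul_eq_mul,
    Nat.cast_sub Fintype.card_pos]
  push_cast
  ring

end Lines

section Witness

variable {𝔽 : Type*} [Field 𝔽] {d n : ℕ} {ι : (Fin n → 𝔽) →ₗ[𝔽] (Fin d → 𝔽)}

theorem linearIndependent_pair_map (hι : Function.Injective ι) {a b : Fin n → 𝔽}
    (h : ∀ s t : 𝔽, s • a + t • b = 0 → s = 0 ∧ t = 0) :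
    LinearIndependent 𝔽 ![ι a, ι b] :=
  LinearIndependent.pair_of_forall fun s t hst => h s t <| hι <| by
    simpa only [map_add, map_smul, map_zero] using hst

theorem map_mem_lineThrough (hι : Function.Injective ι) {a b c : Fin n → 𝔽}
    {h : LinearIndependent 𝔽 ![ι a, ι b]} :
    ι c ∈ (lineThrough (ι a) (ι b) h).toSubmodule ↔ ∃ s t : 𝔽, s • a + t • b = c := by
  simp only [mem_lineThrough, ← map_smul, ← map_add, hι.eq_iff]

theorem lineThrough_map_ne (hι : Function.Injective ι) {a b a' b' : Fin n → 𝔽}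
    {h : LinearIndependent 𝔽 ![ι a, ι b]} {h' : LinearIndependent 𝔽 ![ι a', ι b']}
    (hne : ∀ s t s' t' : 𝔽, s • a' + t • b' = a → s' • a' + t' • b' = b → False) :
    lineThrough (ι a) (ι b) h ≠ lineThrough (ι a') (ι b') h' := by
  intro he
  obtain ⟨s, t, h1⟩ := (map_mem_lineThrough hι).1 (he ▸ left_mem_lineThrough h)
  obtain ⟨s', t', h2⟩ := (map_mem_lineThrough hι).1 (he ▸ right_mem_lineThrough h)
  exact hne s t s' t' h1 h2

theorem disjoint_lineThrough_map (hι : Function.Injective ι) {a b a' b' : Fin n → 𝔽}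
    {h : LinearIndependent 𝔽 ![ι a, ι b]} {h' : LinearIndependent 𝔽 ![ι a', ι b']}
    (hd : ∀ s t s' t' : 𝔽, s' • a' + t' • b' = s • a + t • b → s = 0 ∧ t = 0) :
    Disjoint (lineThrough (ι a) (ι b) h).toSubmodule (lineThrough (ι a') (ι b') h').toSubmodule := by
  rw [Submodule.disjoint_def]
  intro c hc hc'
  obtain ⟨s, t, rfl⟩ := mem_lineThrough.1 hc
  rw [← map_smul, ← map_smul, ← map_add] at hc'
  obtain ⟨s', t', he⟩ := (map_mem_lineThrough hι).1 hc'
  obtain ⟨rfl, rfl⟩ := hd s t s' t' he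
  simp

set_option maxHeartbeats 4000000 in
theorem exists_isSparseWeight_planeWeight [Finite 𝔽] (F : Type*) [Field F] (hd : 4 ≤ d) :
    ∃ x x₁ x₂ y y₁ y₂ z z₁ z₂ : GrassTwo 𝔽 d,
      IsSparseWeight (planeWeight 𝔽 F d) x x₁ x₂ y y₁ y₂ z z₁ z₂ := by
  obtain ⟨ι, hι⟩ : ∃ ι : (Fin 4 → 𝔽) →ₗ[𝔽] (Fin d → 𝔽), Function.Injective ι :=
    ⟨_, LinearMap.funLeft_injective_of_surjective 𝔽 𝔽 _
      (Function.invFun_surjective (Fin.castLE_injective hd))⟩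
  have hx : LinearIndependent 𝔽 ![ι ![1, 0, 0, 0], ι ![0, 1, 0, 0]] :=
    linearIndependent_pair_map hι fun s t => by
      simp [funext_iff, Fin.forall_fin_succ]
  have hx₁ : LinearIndependent 𝔽 ![ι ![0, 1, 0, 0], ι ![1, 0, 0, 1]] :=
    linearIndependent_pair_map hι fun s t => by
      simp [funext_iff, Fin.forall_fin_succ]
  have hx₂ : LinearIndependent 𝔽 ![ι ![0, 1, 1, 0], ι ![1, 0, 0, 1]] :=
    linearIndependent_pair_map hι fun s t => by
      simp [funext_iff, Fin.forall_fin_succ]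
  have hy : LinearIndependent 𝔽 ![ι ![1, 0, 0, 0], ι ![0, 0, 1, 0]] :=
    linearIndependent_pair_map hι fun s t => by
      simp [funext_iff, Fin.forall_fin_succ]
  have hy₁ : LinearIndependent 𝔽 ![ι ![0, 0, 1, 0], ι ![0, 0, 0, 1]] :=
    linearIndependent_pair_map hι fun s t => by
      simp [funext_iff, Fin.forall_fin_succ]
  have hy₂ : LinearIndependent 𝔽 ![ι ![1, 0, 1, 0], ι ![0, 0, 0, 1]] :=
    linearIndependent_pair_map hι fun s t => by
      simp [funext_iff, Fin.forall_fin_succ]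
  have hz : LinearIndependent 𝔽 ![ι ![0, 1, 0, 0], ι ![0, 0, 1, 0]] :=
    linearIndependent_pair_map hι fun s t => by
      simp [funext_iff, Fin.forall_fin_succ]
  have hz₁ : LinearIndependent 𝔽 ![ι ![0, 1, 1, 0], ι ![0, 0, 0, 1]] :=
    linearIndependent_pair_map hι fun s t => by
      simp [funext_iff, Fin.forall_fin_succ]
  have hz₂ : LinearIndependent 𝔽 ![ι ![0, 0, 1, 0], ι ![0, 1, 0, 1]] :=
    linearIndependent_pair_map hι fun s t => by
      simp [funext_iff, Fin.forall_fin_succ]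
  obtain ⟨hxy, hsum⟩ := sum_planeWeight_lineThrough F (fun r s t h => by
    rw [← map_smul, ← map_smul, ← map_smul, ← map_add, ← map_add, map_eq_zero_iff ι hι] at h
    simp [funext_iff, Fin.forall_fin_succ] at h
    grind) hx hy
  have hdisj {T : Finset (GrassTwo 𝔽 d)} (hT : planeWeight 𝔽 F d T ≠ 0) {a b a' b' : Fin 4 → 𝔽}
      {h : LinearIndependent 𝔽 ![ι a, ι b]} {h' : LinearIndependent 𝔽 ![ι a', ι b']}
      (hl : lineThrough _ _ h ∈ T) (hl' : lineThrough _ _ h' ∈ T)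
      (hd : ∀ s t s' t' : 𝔽, s' • a' + t' • b' = s • a + t • b → s = 0 ∧ t = 0) : False :=
    not_disjoint_of_planeWeight_ne_zero hT hl hl' (disjoint_lineThrough_map hι hd)
  refine ⟨lineThrough _ _ hx, lineThrough _ _ hx₁, lineThrough _ _ hx₂, lineThrough _ _ hy,
    lineThrough _ _ hy₁, lineThrough _ _ hy₂, lineThrough _ _ hz, lineThrough _ _ hz₁,
    lineThrough _ _ hz₂, ⟨?_, fun T => card_eq_three_of_planeWeight_ne_zero, ?_, ?_, ?_, ?_, ?_,
    hsum⟩⟩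
  · simp only [List.nodup_cons, List.mem_cons, List.not_mem_nil, or_false, not_or,
      not_false_eq_true, List.nodup_nil, and_true]
    refine ⟨⟨?_, ?_, ?_, ?_, ?_, ?_, ?_, ?_⟩, ⟨?_, ?_, ?_, ?_, ?_, ?_, ?_⟩, ⟨?_, ?_, ?_, ?_, ?_, ?_⟩,
      ⟨?_, ?_, ?_, ?_, ?_⟩, ⟨?_, ?_, ?_, ?_⟩, ⟨?_, ?_, ?_⟩, ⟨?_, ?_⟩, ?_⟩ <;>
    · refine lineThrough_map_ne hι fun s t s' t' h1 h2 => ?_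
      simp [funext_iff, Fin.forall_fin_succ] at h1 h2 <;> grind
  · intro T hT h h'
    rw [Finset.not_disjoint_iff] at h h'
    obtain ⟨u, hu, hu'⟩ := h
    obtain ⟨v, hv, hv'⟩ := h'
    simp only [Finset.mem_insert, Finset.mem_singleton] at hu' hv'
    obtain rfl | rfl | rfl := hu' <;> obtain rfl | rfl | rfl := hv'
    · exact ⟨hu, hv⟩
    all_goals
      exfalso
      refine hdisj hT hu hv fun s t s' t' he => ?_
      simp [funext_iff, Fin.forall_fin_succ] at he
      grind
  · intro v hT hv
    simp only [List.mem_cons, List.not_mem_nil, or_false] at hv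
    obtain rfl | rfl | rfl | rfl := hv
    · refine hdisj hT (h := hx₁) (h' := hy) (by simp) (by simp) fun s t s' t' he => ?_
      simp [funext_iff, Fin.forall_fin_succ] at he
      grind
    · refine hdisj hT (h := hx₂) (h' := hy) (by simp) (by simp) fun s t s' t' he => ?_
      simp [funext_iff, Fin.forall_fin_succ] at he
      grind
    · refine hdisj hT (h := hx) (h' := hy₁) (by simp) (by simp) fun s t s' t' he => ?_
      simp [funext_iff, Fin.forall_fin_succ] at he
      grind
    · refine hdisj hT (h := hx) (h' := hy₂) (by simp) (by simp) fun s t s' t' he => ?_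
      simp [funext_iff, Fin.forall_fin_succ] at he
      grind
  · have he₀ : ι ![1, 0, 0, 0] ≠ 0 := hx.ne_zero 0
    rw [planeWeight_triple he₀ hxy, if_pos, if_neg]
    · rw [map_mem_lineThrough hι]
      rintro ⟨s, t, he⟩
      simp [funext_iff, Fin.forall_fin_succ] at he
    · refine ⟨?_, ?_, lineThrough_le (Submodule.mem_sup_left (right_mem_lineThrough hx))
        (Submodule.mem_sup_right (right_mem_lineThrough hy))⟩ <;>
      · refine lineThrough_map_ne hι fun s t s' t' h1 h2 => ?_
        simp [funext_iff, Fin.forall_fin_succ] at h1 h2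
  · by_contra hT
    refine hdisj hT (h := hx) (h' := hz₁) (by simp) (by simp) fun s t s' t' he => ?_
    simp [funext_iff, Fin.forall_fin_succ] at he
    grind
  · by_contra hT
    refine hdisj hT (h := hx) (h' := hz₂) (by simp) (by simp) fun s t s' t' he => ?_
    simp [funext_iff, Fin.forall_fin_succ] at he
    grind

end Witness

section AltCycle

variable {Ω : Type*} [Fintype Ω] [DecidableEq Ω]

/-- The 3-cycle `(x y z)` as an element of the alternating group; by convention it is `1` when the
points are not distinct. -/
def altCycle (x y z : Ω) : alternatingGroup Ω :=
  if h : [x, y, z].Nodup then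
    ⟨threeCycle x y z, threeCycle_mem (by grind) (by grind)⟩
  else 1

theorem coe_altCycle {x y z : Ω} (h : [x, y, z].Nodup) : (altCycle x y z).1 = threeCycle x y z := by
  rw [altCycle, dif_pos h]

theorem altCycle_of_not_nodup {x y z : Ω} (h : ¬ [x, y, z].Nodup) : altCycle x y z = 1 :=
  dif_neg h

theorem altCycle_rotate (x y z : Ω) : altCycle x y z = altCycle y z x := by
  by_cases h : [x, y, z].Nodup
  · have h' : [y, z, x].Nodup := by grind
    ext t
    rw [coe_altCycle h, coe_altCycle h']
    simp only [threeCycle, Equiv.Perm.mul_apply, Equiv.swap_apply_def]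
    grind
  · rw [altCycle_of_not_nodup h, altCycle_of_not_nodup (by grind)]

theorem altCycle_inv (x y z : Ω) : (altCycle x y z)⁻¹ = altCycle x z y := by
  by_cases h : [x, y, z].Nodup
  · have h' : [x, z, y].Nodup := by grind
    rw [inv_eq_iff_mul_eq_one]
    ext t
    rw [Subgroup.coe_mul, coe_altCycle h, coe_altCycle h']
    simp only [threeCycle, Equiv.Perm.mul_apply, Equiv.swap_apply_def, Subgroup.coe_one,
      Equiv.Perm.one_apply]
    grind
  · rw [altCycle_of_not_nodup h, altCycle_of_not_nodup (by grind), inv_one]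

theorem altCycle_conj (a : alternatingGroup Ω) (x y z : Ω) :
    a * altCycle x y z * a⁻¹ = altCycle (a.1 x) (a.1 y) (a.1 z) := by
  have hnd : [x, y, z].Nodup ↔ [a.1 x, a.1 y, a.1 z].Nodup :=
    (List.nodup_map_iff (l := [x, y, z]) (Equiv.injective a.1)).symm
  by_cases h : [x, y, z].Nodup
  · apply Subtype.ext
    rw [Subgroup.coe_mul, Subgroup.coe_mul, coe_altCycle h, coe_altCycle (hnd.1 h), threeCycle,
      threeCycle, Subgroup.coe_inv, Equiv.swap_apply_apply, Equiv.swap_apply_apply]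
    group
  · rw [altCycle_of_not_nodup h, altCycle_of_not_nodup (hnd.not.1 h)]
    group

theorem altCycle_pow_three (x y z : Ω) : altCycle x y z ^ 3 = 1 := by
  by_cases h : [x, y, z].Nodup
  · ext t
    simp only [pow_succ, pow_zero, one_mul, Subgroup.coe_mul, coe_altCycle h, threeCycle,
      Equiv.Perm.mul_apply, Equiv.swap_apply_def, Subgroup.coe_one, Equiv.Perm.one_apply]
    grind
  · rw [altCycle_of_not_nodup h, one_pow]

theorem altCycle_inv_mul_sq {x x' y z : Ω} (h : [x, x', y, z].Nodup) :
    ((altCycle x y z)⁻¹ * altCycle x' z y) ^ 2 = 1 := by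
  have h1 : [x, z, y].Nodup := by grind
  have h2 : [x', z, y].Nodup := by grind
  ext t
  simp only [altCycle_inv, pow_succ, pow_zero, one_mul, Subgroup.coe_mul, coe_altCycle h1,
    coe_altCycle h2, threeCycle, Equiv.Perm.mul_apply, Equiv.swap_apply_def, Subgroup.coe_one,
    Equiv.Perm.one_apply]
  grind

theorem coe_altCycle_mul_mul {x x' y z : Ω} (h : [x, x', y, z].Nodup) :
    (altCycle x y z * altCycle x' z y * altCycle x y z).1 = Equiv.swap x x' * Equiv.swap y z := by
  have h1 : [x, y, z].Nodup := by grind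
  have h2 : [x', z, y].Nodup := by grind
  ext t
  simp only [Subgroup.coe_mul, coe_altCycle h1,
    coe_altCycle h2, threeCycle, Equiv.Perm.mul_apply, Equiv.swap_apply_def]
  grind

theorem altCycle_mul_mul_mul {x x' y y' z : Ω} (h : [x, x', y, y', z].Nodup) :
    altCycle x y z * altCycle x' z y * altCycle x y z *
      (altCycle x y' z * altCycle x' z y' * altCycle x y' z) = altCycle y' y z := by
  apply Subtype.ext
  rw [Subgroup.coe_mul, coe_altCycle_mul_mul (by grind), coe_altCycle_mul_mul (by grind),
    coe_altCycle (by grind)]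
  ext t
  simp only [threeCycle, Equiv.Perm.mul_apply, Equiv.swap_apply_def]
  grind

theorem altCycle_mul_comm {x y z u v w : Ω} (h : [x, y, z, u, v, w].Nodup) :
    Commute (altCycle x y z) (altCycle u v w) := by
  apply Subtype.ext
  rw [Subgroup.coe_mul, Subgroup.coe_mul, coe_altCycle (by grind), coe_altCycle (by grind)]
  exact threeCycle_mul_comm (by simp; grind)

theorem altCycle_apply_left {x y z : Ω} (h : [x, y, z].Nodup) : (altCycle x y z).1 x = y := by
  rw [coe_altCycle h]
  exact threeCycle_apply_left (by grind) (by grind)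

theorem altCycle_apply_middle {x y z : Ω} (h : [x, y, z].Nodup) : (altCycle x y z).1 y = z := by
  rw [altCycle_rotate, altCycle_apply_left (by grind)]

theorem altCycle_apply_right {x y z : Ω} (h : [x, y, z].Nodup) : (altCycle x y z).1 z = x := by
  rw [altCycle_rotate, altCycle_apply_middle (by grind)]

theorem altCycle_apply_of_ne {x y z t : Ω} (hx : t ≠ x) (hy : t ≠ y) (hz : t ≠ z) :
    (altCycle x y z).1 t = t := by
  by_cases h : [x, y, z].Nodup
  · rw [coe_altCycle h]
    exact threeCycle_apply_of_ne hx hy hz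
  · rw [altCycle_of_not_nodup h]
    rfl

theorem support_altCycle {x y z : Ω} (h : [x, y, z].Nodup) :
    (altCycle x y z).1.support = {x, y, z} := by
  ext t
  simp only [Equiv.Perm.mem_support, Finset.mem_insert, Finset.mem_singleton]
  constructor
  · contrapose!
    exact fun ht => altCycle_apply_of_ne ht.1 ht.2.1 ht.2.2
  · rintro (rfl | rfl | rfl)
    · rw [altCycle_apply_left h]
      grind
    · rw [altCycle_apply_middle h]
      grind
    · rw [altCycle_apply_right h]
      grind

theorem support_eq_triple_iff {x y z : Ω} (h : [x, y, z].Nodup) {a : alternatingGroup Ω} :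
    a.1.support = {x, y, z} ↔ a = altCycle x y z ∨ a = altCycle x z y := by
  constructor
  · intro ha
    have hm (t : Ω) : a.1 t ≠ t ↔ t = x ∨ t = y ∨ t = z := by
      rw [← Equiv.Perm.mem_support, ha]
      simp
    have hx := (hm x).2 (by simp)
    have hy := (hm y).2 (by simp)
    have hz := (hm z).2 (by simp)
    have hx' := (hm (a.1 x)).1 (by simpa using hx)
    have hy' := (hm (a.1 y)).1 (by simpa using hy)
    have hz' := (hm (a.1 z)).1 (by simpa using hz)
    have hxy : a.1 x ≠ a.1 y := by simp; grind
    have hxz : a.1 x ≠ a.1 z := by simp; grind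
    have hyz : a.1 y ≠ a.1 z := by simp; grind
    have h' : [x, z, y].Nodup := by grind
    have key : (a.1 x = y ∧ a.1 y = z ∧ a.1 z = x) ∨ (a.1 x = z ∧ a.1 z = y ∧ a.1 y = x) := by
      grind
    refine key.imp (fun k => ?_) (fun k => ?_) <;>
    · ext t
      by_cases ht : t = x ∨ t = y ∨ t = z
      · obtain rfl | rfl | rfl := ht <;>
        simp only [k, altCycle_apply_left, altCycle_apply_middle, altCycle_apply_right, h, h']
      · rw [altCycle_apply_of_ne (by grind) (by grind) (by grind)]
        exact not_not.1 ((hm t).not.2 ht)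
  · rintro (rfl | rfl)
    · exact support_altCycle h
    · rw [support_altCycle (by grind)]
      grind

theorem altCycle_ne {x y z : Ω} (h : [x, y, z].Nodup) : altCycle x y z ≠ altCycle x z y := by
  intro he
  have := congrArg (fun a : alternatingGroup Ω => a.1 x) he
  simp only [altCycle_apply_left h] at this
  rw [altCycle_apply_left (by grind)] at this
  grind

theorem altCycle_ne_one {x y z : Ω} (h : [x, y, z].Nodup) : altCycle x y z ≠ 1 := by
  intro he
  apply altCycle_ne h
  rw [← altCycle_inv x y z, he, inv_one]

theorem MonoidHom.eq_one_of_altCycle {R : Type*} [Monoid R] (ρ : alternatingGroup Ω →* R)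
    (hc : 5 ≤ Fintype.card Ω) {x y z : Ω} (h : [x, y, z].Nodup) (h1 : ρ (altCycle x y z) = 1) :
    ρ = 1 := by
  have := alternatingGroup.isSimpleGroup (α := Ω) (by simpa [Nat.card_eq_fintype_card] using hc)
  obtain hk | hk := (MonoidHom.normal_ker ρ).eq_bot_or_eq_top
  · have : altCycle x y z ∈ ρ.ker := h1
    rw [hk, Subgroup.mem_bot] at this
    exact absurd this (altCycle_ne_one h)
  · exact MonoidHom.ker_eq_top_iff.1 hk

end AltCycle

section Lie

theorem exists_notMem_of_length_lt {Ω : Type*} [Fintype Ω] (l : List Ω)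
    (h : l.length < Fintype.card Ω) : ∃ p, p ∉ l := by
  classical
  by_contra! hl
  have h1 : l.toFinset = Finset.univ := by ext; simp [hl]
  have h2 := l.toFinset_card_le
  rw [h1, Finset.card_univ] at h2
  omega

variable {Ω L : Type*} [Fintype Ω] [LieRing L] {K : Ω → Ω → Ω → L}

theorem sub_eq_sub_of_secondDiff (hcard : 9 ≤ Fintype.card Ω)
    (hswap : ∀ x y z, K x y z = K x z y)
    (hdiff : ∀ x x' y y' z, [x, x', y, y', z].Nodup →
      K x y z - K x' y z - K x y' z + K x' y' z = 0)
    {x x' y z u v : Ω} (h : [x, x', y, z].Nodup) (h' : [x, x', u, v].Nodup) :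
    K x y z - K x' y z = K x u v - K x' u v := by
  obtain ⟨p, hp⟩ := exists_notMem_of_length_lt [x, x', y, z, u, v] (by simp; omega)
  obtain ⟨q, hq⟩ := exists_notMem_of_length_lt [x, x', y, z, u, v, p] (by simp; omega)
  have step {a b c : Ω} (hn : [x, x', a, b, c].Nodup) :
      K x a c - K x' a c = K x b c - K x' b c := by
    rw [← sub_eq_zero, ← hdiff x x' a b c hn]
    abel
  have step' {a b c : Ω} (hn : [x, x', a, b, c].Nodup) :
      K x c a - K x' c a = K x c b - K x' c b := by
    rw [hswap x c a, hswap x' c a, hswap x c b, hswap x' c b, step hn]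
  rw [step (b := p) (by clear * - h h' hp hq; simp at *; grind),
    step' (b := q) (by clear * - h h' hp hq; simp at *; grind),
    step (b := u) (by clear * - h h' hp hq; simp at *; grind),
    step' (b := v) (by clear * - h h' hp hq; simp at *; grind)]

set_option maxHeartbeats 1000000 in
theorem lie_eq_zero_of_secondDiff (hcard : 9 ≤ Fintype.card Ω)
    (hrot : ∀ x y z, K x y z = K y z x) (hswap : ∀ x y z, K x y z = K x z y)
    (hdiff : ∀ x x' y y' z, [x, x', y, y', z].Nodup →
      K x y z - K x' y z - K x y' z + K x' y' z = 0)
    (hdisj : ∀ x y z u v w, [x, y, z, u, v, w].Nodup → ⁅K x y z, K u v w⁆ = 0)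
    (hface : ∀ x x' y z, [x, x', y, z].Nodup →
      ⁅K x y z, K x' y z + K x' z x + K x' x y⁆ = 0)
    {x x' y z : Ω} (h : [x, x', y, z].Nodup) : ⁅K x y z, K x' y z⁆ = 0 := by
  have hg (x x' : Ω) : ∃ m, ∀ y z, [x, x', y, z].Nodup → K x y z = m + K x' y z := by
    by_cases hx : ∃ y z, [x, x', y, z].Nodup
    · obtain ⟨y, z, hx⟩ := hx
      refine ⟨K x y z - K x' y z, fun u v h' => ?_⟩
      rw [sub_eq_sub_of_secondDiff hcard hswap hdiff hx h', sub_add_cancel]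
    · exact ⟨0, fun y z h => absurd ⟨y, z, h⟩ hx⟩
  choose g hg using hg
  have fresh (l : List Ω) (hl : l.length < 9) : ∃ p, p ∉ l :=
    exists_notMem_of_length_lt l (by omega)
  have hgK {x x' u y z : Ω} (hn : [x, x', u, y, z].Nodup) : ⁅g x x', K u y z⁆ = 0 := by
    obtain ⟨p, hp⟩ := fresh [x, x', u, y, z] (by simp)
    obtain ⟨q, hq⟩ := fresh [x, x', u, y, z, p] (by simp)
    rw [← add_sub_cancel_right (g x x') (K x' p q), ← hg x x' p q
        (by clear * - hn hp hq; simp at *; grind),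
      sub_lie,
      hdisj _ _ _ _ _ _ (by clear * - hn hp hq; simp at *; grind),
      hdisj _ _ _ _ _ _ (by clear * - hn hp hq; simp at *; grind), sub_zero]
  have hgg {x x' u u' : Ω} (hn : [x, x', u, u'].Nodup) : ⁅g x x', g u u'⁆ = 0 := by
    obtain ⟨p, hp⟩ := fresh [x, x', u, u'] (by simp)
    obtain ⟨q, hq⟩ := fresh [x, x', u, u', p] (by simp)
    rw [← add_sub_cancel_right (g u u') (K u' p q), ← hg u u' p q
        (by clear * - hn hp hq; simp at *; grind),
      lie_sub,
      hgK (by clear * - hn hp hq; simp at *; grind), hgK (by clear * - hn hp hq; simp at *; grind),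
      sub_zero]
  have hadd {x a b : Ω} (hn : [x, a, b].Nodup) : g x b = g x a + g a b := by
    obtain ⟨p, hp⟩ := fresh [x, a, b] (by simp)
    obtain ⟨q, hq⟩ := fresh [x, a, b, p] (by simp)
    have h1 := hg x a p q (by clear * - hn hp hq; simp at *; grind)
    rw [hg x b p q (by clear * - hn hp hq; simp at *; grind),
      hg a b p q (by clear * - hn hp hq; simp at *; grind), ← add_assoc] at h1
    exact add_right_cancel h1
  have hneg {x a : Ω} (hn : x ≠ a) : g a x = - g x a := by
    obtain ⟨p, hp⟩ := fresh [x, a] (by simp)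
    obtain ⟨q, hq⟩ := fresh [x, a, p] (by simp)
    have h1 := hg x a p q (by clear * - hn hp hq; simp at *; grind)
    rw [hg a x p q (by clear * - hn hp hq; simp at *; grind), ← add_assoc] at h1
    have h2 : g x a + g a x = 0 := by simpa using h1.symm
    exact eq_neg_of_add_eq_zero_right h2
  have hβ {x a b c : Ω} (hn : [x, a, b, c].Nodup) : ⁅g x a, g x b⁆ = ⁅g x a, g x c⁆ := by
    rw [hadd (x := x) (a := b) (b := c) (by clear * - hn; simp at *; grind),
      lie_add, hgg (u := b) (by clear * - hn; simp at *; grind), add_zero]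
  have hβ' {x a b : Ω} (hn : [x, a, b].Nodup) : ⁅g x a, g x b⁆ = ⁅g x b, g x a⁆ := by
    obtain ⟨c, hc⟩ := fresh [x, a, b] (by simp)
    rw [hβ (x := x) (a := a) (b := b) (c := c) (by clear * - hn hc; simp at *; grind),
      ← lie_skew, hβ (c := b) (by clear * - hn hc; simp at *; grind),
      lie_skew, hβ (c := a) (by clear * - hn hc; simp at *; grind)]
  have hK {x x' y z u : Ω} (hn : [x, x', y, z, u].Nodup) :
      ⁅K x y z, K x' y z⁆ = ⁅g x x', g x u⁆ := by
    have h1 := hg x x' y z (by clear * - hn; simp at *; grind)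
    rw [← sub_eq_iff_eq_add'] at h1
    rw [← h1, lie_sub, lie_self, zero_sub, hg x u y z (by clear * - hn; simp at *; grind),
      add_lie, ← lie_skew (K u y z),
      hgK (by clear * - hn; simp at *; grind), neg_zero, add_zero, lie_skew]
  have htwo {x x' y z : Ω} (hn : [x, x', y, z].Nodup) :
      ⁅K x y z, K x' y z⁆ = - ⁅K x y z, K x' y z⁆ := by
    obtain ⟨u, hu⟩ := fresh [x, x', y, z] (by simp)
    rw [hK (u := u) (by clear * - hn hu; simp at *; grind)]
    conv_lhs => rw [hβ' (by clear * - hn hu; simp at *; grind)]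
    rw [lie_skew]
  have hbase {x x' u : Ω} (hn : [x, x', u].Nodup) : ⁅g x x', g x u⁆ = ⁅g x' x, g x' u⁆ := by
    obtain ⟨p, hp⟩ := fresh [x, x', u] (by simp)
    obtain ⟨q, hq⟩ := fresh [x, x', u, p] (by simp)
    rw [← hK (y := p) (z := q) (by clear * - hn hp hq; simp at *; grind),
      ← hK (y := p) (z := q) (by clear * - hn hp hq; simp at *; grind),
      htwo (by clear * - hn hp hq; simp at *; grind),
      lie_skew]
  have hmove {x x' y u : Ω} (hn : [x, x', y, u].Nodup) : ⁅g x x', g x u⁆ = ⁅g y x', g y u⁆ := by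
    rw [hbase (x := x) (by clear * - hn; simp at *; grind),
      hbase (x := y) (by clear * - hn; simp at *; grind), hβ' (by clear * - hn; simp at *; grind),
      hβ (x := x') (a := u) (b := x) (c := y) (by clear * - hn; simp at *; grind),
      hβ' (by clear * - hn; simp at *; grind)]
  obtain ⟨u, hu⟩ := fresh [x, x', y, z] (by simp)
  have h1 : ⁅K x y z, K x' z x⁆ = ⁅K x y z, K x' y z⁆ := by
    rw [hrot x y z, hK (u := u) (by clear * - h hu; simp at *; grind),
      ← hrot x y z, hK (u := u) (by clear * - h hu; simp at *; grind),
      hmove (y := x) (by clear * - h hu; simp at *; grind)]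
  have h2 : ⁅K x y z, K x' x y⁆ = ⁅K x y z, K x' y z⁆ := by
    rw [← hrot z x y, hK (u := u) (by clear * - h hu; simp at *; grind),
      hrot z x y, hK (u := u) (by clear * - h hu; simp at *; grind),
      hmove (y := x) (by clear * - h hu; simp at *; grind)]
  have h3 := hface x x' y z h
  rw [lie_add, lie_add, h1, h2] at h3
  have h4 := htwo h
  rwa [eq_neg_iff_add_eq_zero.1 h4, zero_add] at h3

end Lie

section Tetrahedral

/-- In a ring generated by a quotient of the tetrahedral group, with `i`, `j`, `k` the involutions
and `a` an element of order three permuting them cyclically, the sums `a + a⁻¹` and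
`a * i + (a * i)⁻¹` commute only if the following relations hold. -/
theorem tetrahedral_relations {R : Type*} [Ring R] {a a' i j k : R} (haa' : a * a' = 1)
    (hinv_a : a' * a = 1) (haa : a * a = a') (hsq_a' : a' * a' = a) (hai : a * i = j * a)
    (haj : a * j = k * a) (hak : a * k = i * a) (hjj : j * j = 1) (hji : j * i = k)
    (hjk : j * k = i) (hcomm : (a + a') * (a * i + i * a') = (a * i + i * a') * (a + a')) :
    i + j = 1 + k ∧ j + k = 1 + i ∧ k + i = 1 + j ∧
      (i - k) * a' = k - j ∧ (j - i) * a' = i - k ∧ (k - j) * a' = j - i := by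
  have ha'i : a' * i = k * a' := by
    rw [← mul_one i, ← haa', ← mul_assoc i, ← hak, ← mul_assoc, ← mul_assoc, hinv_a, one_mul]
  have h1 : (k - j) * a' = (i - k) * a := by
    have e1 : (a + a') * (a * i + i * a') = k * a' + j + i + k * a := by
      calc _ = (a * a) * i + (a * i) * a' + (a' * a) * i + (a' * i) * a' := by noncomm_ring
        _ = k * a' + j * (a * a') + i + k * (a' * a') := by
          rw [haa, ha'i, hai, hinv_a]; noncomm_ring
        _ = _ := by rw [haa', hsq_a']; noncomm_ring
    have e2 : (a * i + i * a') * (a + a') = j * a' + j + i + i * a := by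
      calc _ = (a * i) * a + (a * i) * a' + i * (a' * a) + i * (a' * a') := by noncomm_ring
        _ = j * (a * a) + j * (a * a') + i * (a' * a) + i * (a' * a') := by
          rw [hai]; noncomm_ring
        _ = _ := by rw [haa', hsq_a', haa, hinv_a]; noncomm_ring
    rw [e1, e2] at hcomm
    rw [sub_mul, sub_mul, sub_eq_sub_iff_add_eq_add]
    calc k * a' + k * a = k * a' + j + i + k * a - j - i := by abel
      _ = j * a' + j + i + i * a - j - i := by rw [hcomm]
      _ = i * a + j * a' := by abel
  have h2 : (i - k) * a' = k - j := by
    rw [← haa, ← mul_assoc, ← h1, mul_assoc, hinv_a, mul_one]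
  have conj {u v : R} (h : u = v) : a * u * a' = a * v * a' := by rw [h]
  have ci : a * i * a' = j := by rw [hai, mul_assoc, haa', mul_one]
  have cj : a * j * a' = k := by rw [haj, mul_assoc, haa', mul_one]
  have ck : a * k * a' = i := by rw [hak, mul_assoc, haa', mul_one]
  have c1 : a * 1 * a' = 1 := by rw [mul_one, haa']
  have cm (u : R) : a * (u * a') * a' = a * u * a' * a' := by noncomm_ring
  have csub (u v : R) : a * (u - v) * a' = a * u * a' - a * v * a' := by noncomm_ring
  have cadd (u v : R) : a * (u + v) * a' = a * u * a' + a * v * a' := by noncomm_ring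
  have h3 : (j - i) * a' = i - k := by
    have := conj h2
    rwa [cm, csub, csub, ci, cj, ck] at this
  have h4 : (k - j) * a' = j - i := by
    have := conj h3
    rwa [cm, csub, csub, ci, cj, ck] at this
  have h5 : k + i = 1 + j := by
    have h : (1 + j) * ((i - k) * a') = (1 + j) * (k - j) := by rw [h2]
    have e1 : (1 + j) * ((i - k) * a') = 0 := by
      calc _ = (i - k + j * i - j * k) * a' := by noncomm_ring
        _ = 0 := by rw [hji, hjk]; noncomm_ring
    have e2 : (1 + j) * (k - j) = k - j + j * k - j * j := by noncomm_ring
    rw [e1, e2, hjk, hjj] at h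
    rw [← sub_eq_zero, h]
    abel
  have h6 : i + j = 1 + k := by
    have := conj h5
    rwa [cadd, cadd, ck, ci, cj, c1] at this
  have h7 : j + k = 1 + i := by
    have := conj h6
    rwa [cadd, cadd, ck, ci, cj, c1] at this
  exact ⟨h6, h7, h5, h2, h3, h4⟩

variable {G R : Type*} [Group G] [Ring R] {a b : G}

theorem MonoidHom.tetrahedral_relations (ρ : G →* R) (ha : a ^ 3 = 1) (hb : b ^ 3 = 1)
    (hab : (a⁻¹ * b) ^ 2 = 1) (hcomm : Commute (ρ a + ρ a⁻¹) (ρ b + ρ b⁻¹)) :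
    ((∀ r : R, r + r = 0 → r = 0) → ρ a = ρ b) ∧
      ((∀ r : R, r + r = 0) → ρ a + ρ b = 1 + ρ (a * b * a) ∧
        ρ a⁻¹ + ρ b⁻¹ = 1 + ρ (a * b * a)) := by
  have haa : a * a = a⁻¹ := by
    rw [eq_inv_iff_mul_eq_one, ← ha, pow_succ, sq]
  have hbb : b * b = b⁻¹ := by
    rw [eq_inv_iff_mul_eq_one, ← hb, pow_succ, sq]
  have hb' : a⁻¹ * b * a⁻¹ = b⁻¹ := by
    rw [eq_inv_iff_mul_eq_one, ← hab, sq, mul_assoc (a⁻¹ * b)]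
  have hm {u v u' v' : G} (h : u * v = u' * v') : ρ u * ρ v = ρ u' * ρ v' := by
    rw [← map_mul, ← map_mul, h]
  have hm' {u v w : G} (h : u * v = w) : ρ u * ρ v = ρ w := by
    rw [← map_mul, h]
  have hm1 {u v : G} (h : u * v = 1) : ρ u * ρ v = 1 := by
    rw [← map_mul, h, map_one]
  have hji : b * a⁻¹ * (a⁻¹ * b) = a * b * a := by
    calc b * a⁻¹ * (a⁻¹ * b) = b * (a * a)⁻¹ * b := by group
      _ = (b * b) * b⁻¹ * a * b := by rw [haa]; group
      _ = b⁻¹ * (a⁻¹ * b * a⁻¹) * a * b := by rw [hbb, hb']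
      _ = b⁻¹ * a⁻¹ * (b * b) := by group
      _ = (a⁻¹ * b * a⁻¹) * a⁻¹ * (a⁻¹ * b * a⁻¹) := by rw [hbb, hb']
      _ = a⁻¹ * b * (a ^ 3)⁻¹ * b * a⁻¹ := by group
      _ = a⁻¹ * (b * b) * a⁻¹ := by rw [ha]; group
      _ = (a * a)⁻¹ * b * (a * a)⁻¹ := by rw [hbb, ← hb']; group
      _ = a * b * a := by rw [haa, inv_inv]
  obtain ⟨h1, h2, h3, h4, h5, h6⟩ := _root_.tetrahedral_relations (a := ρ a) (a' := ρ a⁻¹)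
    (i := ρ (a⁻¹ * b)) (j := ρ (b * a⁻¹)) (k := ρ (a * b * a)) (hm1 (by group)) (hm1 (by group))
    (hm' haa) (hm' (by rw [← _root_.mul_inv_rev, haa, inv_inv])) (hm (by group))
    (hm (by rw [mul_assoc _ a a, haa]; group))
    (hm (by rw [← mul_assoc, ← mul_assoc, haa]))
    (hm1 (by rw [← mul_assoc, mul_assoc b, mul_assoc b, hb', mul_inv_cancel]))
    (hm' hji)
    (hm' (by
      calc b * a⁻¹ * (a * b * a) = (b * b) * a := by group
        _ = (a⁻¹ * b * a⁻¹) * a := by rw [hbb, hb']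
        _ = a⁻¹ * b := by group))
    (by
      rw [hm' (show a * (a⁻¹ * b) = b by group), hm' hb']
      exact hcomm)
  have hi : ρ a * ρ (a⁻¹ * b) = ρ b := hm' (by group)
  refine ⟨fun hR => ?_, fun hR => ?_⟩
  · have hik : ρ (a⁻¹ * b) = ρ (a * b * a) := by
      rw [← sub_eq_zero]
      apply hR
      calc _ = (ρ (a⁻¹ * b) + ρ (b * a⁻¹)) - (ρ (b * a⁻¹) + ρ (a * b * a)) +
            (ρ (a⁻¹ * b) - ρ (a * b * a)) := by abel
        _ = 0 := by rw [h1, h2]; abel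
    rw [hik, sub_self, zero_mul] at h4
    rw [hik, ← sub_eq_zero.1 h4.symm, add_right_cancel_iff] at h1
    rw [← hi, hik, h1, mul_one]
  · have hsub (u v : R) : u - v = u + v := by
      rw [sub_eq_iff_eq_add, add_assoc, hR, add_zero]
    have hja : ρ a * ρ (a⁻¹ * b) = ρ (b * a⁻¹) * ρ a := hm (by group)
    have hia : ρ (a⁻¹ * b) * ρ a⁻¹ = ρ b⁻¹ := hm' hb'
    have haa' : ρ a⁻¹ * ρ a⁻¹ = ρ a := hm' (by rw [← _root_.mul_inv_rev, haa, inv_inv])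
    rw [hsub, hsub, add_comm (ρ (b * a⁻¹)), h1] at h6
    constructor
    · calc ρ a + ρ b = (1 + ρ (b * a⁻¹)) * ρ a := by rw [← hi, hja]; noncomm_ring
        _ = (ρ (a⁻¹ * b) - ρ (a * b * a)) * ρ a⁻¹ * ρ a⁻¹ := by
          rw [← h3, hsub, mul_assoc _ (ρ a⁻¹) (ρ a⁻¹), haa', add_comm (ρ (a * b * a))]
        _ = 1 + ρ (a * b * a) := by rw [h4, hsub, h6]
    · calc ρ a⁻¹ + ρ b⁻¹ = (1 + ρ (a⁻¹ * b)) * ρ a⁻¹ := by rw [← hia]; noncomm_ring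
        _ = (ρ (a * b * a) + ρ (b * a⁻¹)) * ρ a⁻¹ := by rw [← h2, add_comm (ρ (a * b * a))]
        _ = 1 + ρ (a * b * a) := h6

end Tetrahedral

section Conjugation

variable {Ω F A R M : Type*} [Field F] [Ring R] [Algebra F R] [Group A]

/-- The conjugation action on an algebra by the image of a group. -/
def conjRep (F : Type*) [Field F] [Algebra F R] (ρ : A →* R) : Representation F A R where
  toFun a := LinearMap.mulLeft F (ρ a) ∘ₗ LinearMap.mulRight F (ρ a⁻¹)
  map_one' := by ext; simp
  map_mul' a b := by ext; simp [mul_assoc]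

theorem conjRep_apply (ρ : A →* R) (a : A) (r : R) : conjRep F ρ a r = ρ a * (r * ρ a⁻¹) := rfl

theorem conjRep_apply_map (ρ : A →* R) (a b : A) : conjRep F ρ a (ρ b) = ρ (a * b * a⁻¹) := by
  rw [conjRep_apply, ← map_mul, ← map_mul, mul_assoc]

theorem conjRep_apply_eq_self_iff {ρ : A →* R} {a : A} {r : R} :
    conjRep F ρ a r = r ↔ Commute (ρ a) r := by
  have h : ρ a⁻¹ * ρ a = 1 := by rw [← map_mul, inv_mul_cancel, map_one]
  have h' : ρ a * ρ a⁻¹ = 1 := by rw [← map_mul, mul_inv_cancel, map_one]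
  rw [conjRep_apply]
  constructor
  · intro hr
    calc ρ a * r = ρ a * (r * (ρ a⁻¹ * ρ a)) := by rw [h, mul_one]
      _ = ρ a * (r * ρ a⁻¹) * ρ a := by noncomm_ring
      _ = r * ρ a := by rw [hr]
  · intro hr
    rw [← mul_assoc, hr.eq, mul_assoc, h', mul_one]

theorem conjRep_apply_algebraMap (ρ : A →* R) (a : A) (c : F) :
    conjRep F ρ a (algebraMap F R c) = algebraMap F R c :=
  conjRep_apply_eq_self_iff.2 (Algebra.commutes c _).symm

/-- The inner derivations of an algebra. -/
def adMap (F R : Type*) [Field F] [Ring R] [Algebra F R] : R →ₗ[F] R →ₗ[F] R :=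
  LinearMap.mul F R - (LinearMap.mul F R).flip

theorem adMap_apply (r s : R) : adMap F R r s = r * s - s * r := rfl

theorem adMap_algebraMap (c : F) : adMap F R (algebraMap F R c) = 0 := by
  ext s
  rw [adMap_apply, Algebra.commutes, sub_self, LinearMap.zero_apply]

theorem commute_of_adMap_eq_zero {r : R} (h : adMap F R r = 0) (s : R) : Commute r s :=
  sub_eq_zero.1 (LinearMap.congr_fun h s)

theorem linHom_conjRep_adMap (ρ : A →* R) (a : A) (r : R) :
    Representation.linHom (conjRep F ρ) (conjRep F ρ) a (adMap F R r) =
      adMap F R (conjRep F ρ a r) := by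
  have h : ρ a * ρ a⁻¹ = 1 := by rw [← map_mul, mul_inv_cancel, map_one]
  have h' : ρ a⁻¹ * ρ a = 1 := by rw [← map_mul, inv_mul_cancel, map_one]
  ext s
  simp only [Representation.linHom_apply, LinearMap.comp_apply, adMap_apply, conjRep_apply, inv_inv]
  calc _ = ρ a * (r * (ρ a⁻¹ * (s * (ρ a * ρ a⁻¹)))) - (ρ a * ρ a⁻¹) * s * ρ a * r * ρ a⁻¹ := by
        noncomm_ring
    _ = _ := by rw [h]; noncomm_ring

end Conjugation

section WeightedSum

variable {Ω F M : Type*} [Fintype Ω] [DecidableEq Ω] [Field F] [AddCommGroup M] [Module F M]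

theorem map_sum_smul_of_invariant {w : Finset Ω → F} {f : M →ₗ[F] M} {Φ : Finset Ω → M}
    {e : Equiv.Perm Ω} (hw : ∀ T, w (T.image e) = w T) (hΦ : ∀ T, f (Φ T) = Φ (T.image e)) :
    f (∑ T, w T • Φ T) = ∑ T, w T • Φ T := by
  rw [map_sum]
  refine Fintype.sum_equiv e.finsetCongr _ _ fun T => ?_
  have : e.finsetCongr T = T.image e := by
    rw [Equiv.finsetCongr_apply, Finset.map_eq_image]
    rfl
  rw [map_smul, hΦ, this, hw]

end WeightedSum

section Triple

variable {Ω : Type*} [DecidableEq Ω]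

theorem card_image_perm (e : Equiv.Perm Ω) (T : Finset Ω) : (T.image e).card = T.card :=
  Finset.card_image_of_injective _ e.injective

theorem card_triple {x y z : Ω} (h : [x, y, z].Nodup) : ({x, y, z} : Finset Ω).card = 3 :=
  Finset.card_eq_three.2 ⟨x, y, z, by grind, by grind, by grind, rfl⟩

theorem exists_nodup_eq_triple {T : Finset Ω} (hT : T.card = 3) :
    ∃ x y z, [x, y, z].Nodup ∧ T = {x, y, z} := by
  obtain ⟨x, y, z, h1, h2, h3, rfl⟩ := Finset.card_eq_three.1 hT
  exact ⟨x, y, z, by grind, rfl⟩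

end Triple

section Scalar

variable {Ω F R G : Type*} [Fintype Ω] [DecidableEq Ω] [Field F] [Ring R] [Algebra F R] [Group G]

theorem MonoidHom.eq_one_of_altCycle_swap (ρ : alternatingGroup Ω →* R)
    (hc : 5 ≤ Fintype.card Ω) {x y z : Ω} (h : [x, y, z].Nodup)
    (he : ρ (altCycle x y z) = ρ (altCycle x z y)) : ρ = 1 := by
  refine ρ.eq_one_of_altCycle hc h ?_
  have h1 : ρ (altCycle x y z) * ρ (altCycle x y z) = 1 := by
    nth_rw 2 [he]
    rw [← altCycle_inv x y z, ← map_mul, mul_inv_cancel, map_one]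
  calc ρ (altCycle x y z) = ρ (altCycle x y z) * ρ (altCycle x y z) * ρ (altCycle x y z) := by
        rw [h1, one_mul]
    _ = 1 := by rw [← map_mul, ← map_mul, ← sq, ← pow_succ, altCycle_pow_three, map_one]

theorem MonoidHom.eq_one_of_forall_altCycle_eq (ρ : alternatingGroup Ω →* R)
    (hc : 9 ≤ Fintype.card Ω)
    (he : ∀ x x' y z, [x, x', y, z].Nodup → ρ (altCycle x y z) = ρ (altCycle x' z y)) :
    ρ = 1 := by
  obtain ⟨x, -⟩ := exists_notMem_of_length_lt ([] : List Ω) (by simp; omega)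
  obtain ⟨y, hy⟩ := exists_notMem_of_length_lt [x] (by simp; omega)
  obtain ⟨z, hz⟩ := exists_notMem_of_length_lt [x, y] (by simp; omega)
  obtain ⟨u, hu⟩ := exists_notMem_of_length_lt [x, y, z] (by simp; omega)
  obtain ⟨v, hv⟩ := exists_notMem_of_length_lt [x, y, z, u] (by simp; omega)
  have h : [x, y, z, u, v].Nodup := by clear * - hy hz hu hv; simp at *; grind
  refine ρ.eq_one_of_altCycle_swap (by omega) (x := x) (y := y) (z := z)
    (by clear * - h; grind) ?_
  rw [he x u y z (by clear * - h; grind), he u v z y (by clear * - h; grind),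
    he v x y z (by clear * - h; grind)]

/-- The sum of the images of the 3-cycles with support `T`. -/
def threeCycleSum (ρ : alternatingGroup Ω →* R) (T : Finset Ω) : R :=
  ∑ a : alternatingGroup Ω with a.1.support = T ∧ T.card = 3, ρ a

theorem support_conj (a b : alternatingGroup Ω) :
    (a * b * a⁻¹).1.support = b.1.support.image a.1 := by
  ext t
  simp only [Equiv.Perm.mem_support, Subgroup.coe_mul, Subgroup.coe_inv, Equiv.Perm.mul_apply,
    Finset.mem_image, ne_eq, ← Equiv.Perm.eq_inv_iff_eq (f := a.1)]
  constructor
  · intro h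
    exact ⟨a.1⁻¹ t, h, by simp⟩
  · rintro ⟨s, hs, rfl⟩
    simpa using hs

theorem conjRep_threeCycleSum (ρ : alternatingGroup Ω →* R) (a : alternatingGroup Ω)
    (T : Finset Ω) :
    conjRep F ρ a (threeCycleSum ρ T) = threeCycleSum ρ (T.image a.1) := by
  simp only [threeCycleSum, map_sum, conjRep_apply_map]
  refine Finset.sum_equiv (MulAut.conj a).toEquiv (fun b => ?_) (fun b _ => rfl)
  simp only [Finset.mem_filter, Finset.mem_univ, true_and, card_image_perm]
  refine and_congr_left fun _ => ?_
  show _ ↔ (a * b * a⁻¹).1.support = _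
  rw [support_conj, (Finset.image_injective a.1.injective).eq_iff]

theorem threeCycleSum_triple (ρ : alternatingGroup Ω →* R) {x y z : Ω} (h : [x, y, z].Nodup) :
    threeCycleSum ρ {x, y, z} = ρ (altCycle x y z) + ρ (altCycle x z y) := by
  rw [threeCycleSum, ← Finset.sum_pair (altCycle_ne h)]
  refine Finset.sum_congr ?_ fun _ _ => rfl
  ext a
  simp [support_eq_triple_iff h, card_triple h]

variable {ρ : alternatingGroup Ω →* R} {θ : G →* alternatingGroup Ω} {w : Finset Ω → F}
  {x₀ x₁ x₂ y₀ y₁ y₂ z₀ z₁ z₂ : Ω}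

theorem IsSparseWeight.secondDiff_threeCycleSum
    (hw : IsSparseWeight w x₀ x₁ x₂ y₀ y₁ y₂ z₀ z₁ z₂)
    (hinv : ∀ g T, w (T.image (θ g).1) = w T)
    (hscalar : ∀ r : R, (∀ g, Commute (ρ (θ g)) r) → ∃ c : F, algebraMap F R c = r)
    {x x' y y' z : Ω} (hnd : [x, x', y, y', z].Nodup) :
    secondDiff (threeCycleSum ρ) x x' y y' z = 0 := by
  refine hw.secondDiff_eq_zero (conjRep F ρ) _ (conjRep_threeCycleSum ρ) (fun a => ?_) hnd
  obtain ⟨c, hc⟩ := hscalar (∑ T, w T • threeCycleSum ρ T) fun g =>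
    conjRep_apply_eq_self_iff.1 (map_sum_smul_of_invariant (hinv g) (conjRep_threeCycleSum ρ (θ g)))
  rw [← hc, conjRep_apply_algebraMap]

theorem commute_of_conj_permute {A : Type*} [Group A] {ρ : A →* R} {a : A} {u v w : R}
    (huv : ρ a * u = v * ρ a) (hvw : ρ a * v = w * ρ a) (hwu : ρ a * w = u * ρ a) :
    Commute (ρ a) (u + v + w) := by
  rw [commute_iff_eq, mul_add, mul_add, huv, hvw, hwu]
  noncomm_ring

theorem map_mul_altCycle (ρ : alternatingGroup Ω →* R) (a : alternatingGroup Ω) (x y z : Ω) :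
    ρ a * ρ (altCycle x y z) = ρ (altCycle (a.1 x) (a.1 y) (a.1 z)) * ρ a := by
  rw [← altCycle_conj, ← map_mul, ← map_mul, inv_mul_cancel_right]

theorem commute_threeCycles_of_secondDiff (hc : 9 ≤ Fintype.card Ω)
    (hdiff : ∀ x x' y y' z, [x, x', y, y', z].Nodup →
      secondDiff (threeCycleSum ρ) x x' y y' z = 0)
    {x x' y z : Ω} (h : [x, x', y, z].Nodup) :
    Commute (ρ (altCycle x y z) + ρ (altCycle x z y))
      (ρ (altCycle x' y z) + ρ (altCycle x' z y)) := by
  let : LieRing R := LieRing.ofAssociativeRing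
  rw [commute_iff_lie_eq]
  refine lie_eq_zero_of_secondDiff
    (K := fun x y z => ρ (altCycle x y z) + ρ (altCycle x z y)) hc ?_ ?_ ?_ ?_ ?_ h
  · intro x y z
    rw [altCycle_rotate x y z, altCycle_rotate x z y, altCycle_rotate z y x]
  · intro x y z
    exact add_comm _ _
  · intro x x' y y' z hn
    have := hdiff x x' y y' z hn
    rwa [secondDiff, threeCycleSum_triple ρ (by grind), threeCycleSum_triple ρ (by grind),
      threeCycleSum_triple ρ (by grind), threeCycleSum_triple ρ (by grind)] at this
  · intro x y z u v w hn
    have key {x y z u v w : Ω} (h : [x, y, z, u, v, w].Nodup) :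
        Commute (ρ (altCycle x y z)) (ρ (altCycle u v w)) := (altCycle_mul_comm h).map ρ
    exact commute_iff_lie_eq.1 (((key hn).add_right (key (by grind))).add_left
      ((key (by grind)).add_right (key (by grind))))
  · intro x x' y z hn
    have key {x x' y z : Ω} (hn : [x, x', y, z].Nodup) : Commute (ρ (altCycle x y z))
        ((ρ (altCycle x' y z) + ρ (altCycle x' z y)) + (ρ (altCycle x' z x) + ρ (altCycle x' x z)) +
          (ρ (altCycle x' x y) + ρ (altCycle x' y x))) := by
      have h1 : [x, y, z].Nodup := by grind
      obtain ⟨e1, e2, e3⟩ := And.intro (altCycle_apply_left h1)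
        (And.intro (altCycle_apply_middle h1) (altCycle_apply_right h1))
      have e4 : (altCycle x y z).1 x' = x' :=
        altCycle_apply_of_ne (by grind) (by grind) (by grind)
      generalize altCycle x y z = a at *
      apply commute_of_conj_permute <;>
      · rw [mul_add, map_mul_altCycle, map_mul_altCycle, ← add_mul]
        simp only [e1, e2, e3, e4]
    refine commute_iff_lie_eq.1 ((key hn).add_left ?_)
    convert key (x := x) (x' := x') (y := z) (z := y) (by grind) using 1
    abel

theorem tetrahedral_relations_of_secondDiff (hc : 9 ≤ Fintype.card Ω)
    (hdiff : ∀ x x' y y' z, [x, x', y, y', z].Nodup →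
      secondDiff (threeCycleSum ρ) x x' y y' z = 0)
    {x x' y z : Ω} (h : [x, x', y, z].Nodup) :
    ((∀ r : R, r + r = 0 → r = 0) → ρ (altCycle x y z) = ρ (altCycle x' z y)) ∧
      ((∀ r : R, r + r = 0) →
        ρ (altCycle x y z) + ρ (altCycle x' z y) =
          1 + ρ (altCycle x y z * altCycle x' z y * altCycle x y z) ∧
        ρ (altCycle x z y) + ρ (altCycle x' y z) =
          1 + ρ (altCycle x y z * altCycle x' z y * altCycle x y z)) := by
  have h1 := commute_threeCycles_of_secondDiff hc hdiff h
  rw [add_comm (ρ (altCycle x' y z))] at h1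
  rw [← altCycle_inv x y z, ← altCycle_inv x' z y] at *
  exact ρ.tetrahedral_relations (altCycle_pow_three x y z) (altCycle_pow_three x' z y)
    (altCycle_inv_mul_sq h) h1

end Scalar

section Orientation

variable {Ω F R G : Type*} [Fintype Ω] [DecidableEq Ω] [Field F] [Ring R] [Algebra F R] [Group G]

open Classical in
/-- A choice of one of the two 3-cycles with support `T`. -/
noncomputable def orientation (T : Finset Ω) : alternatingGroup Ω :=
  if h : T.card = 3 ∧ ∃ a : alternatingGroup Ω, a.1.support = T then h.2.choose else 1

theorem support_orientation {T : Finset Ω} (hT : T.card = 3) : (orientation T).1.support = T := by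
  obtain ⟨x, y, z, h, rfl⟩ := exists_nodup_eq_triple hT
  have h' : ({x, y, z} : Finset Ω).card = 3 ∧ ∃ a : alternatingGroup Ω, a.1.support = {x, y, z} :=
    ⟨hT, _, support_altCycle h⟩
  rw [orientation, dif_pos h']
  exact h'.2.choose_spec

theorem orientation_of_card_ne {T : Finset Ω} (hT : T.card ≠ 3) : orientation T = 1 :=
  dif_neg fun h => hT h.1

theorem eq_or_eq_inv_of_support_eq {a b : alternatingGroup Ω} (h : a.1.support = b.1.support)
    (hb : b.1.support.card = 3) : a = b ∨ a = b⁻¹ := by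
  obtain ⟨x, y, z, hn, hT⟩ := exists_nodup_eq_triple hb
  rw [hT] at h
  rw [support_eq_triple_iff hn] at h hT
  obtain rfl | rfl := h <;> obtain rfl | rfl := hT <;> simp [altCycle_inv]

variable {ρ : alternatingGroup Ω →* R} {θ : G →* alternatingGroup Ω} {w : Finset Ω → F}
  {x₀ x₁ x₂ y₀ y₁ y₂ z₀ z₁ z₂ : Ω}

theorem exists_conjRep_orientation_eq (h2 : ∀ r : R, r + r = 0)
    (hone : ∀ a : alternatingGroup Ω, a.1.support.card = 3 → ρ a + ρ a⁻¹ = 1)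
    (a : alternatingGroup Ω) (T : Finset Ω) :
    ∃ c : F, conjRep F ρ a (ρ (orientation T)) =
      ρ (orientation (T.image a.1)) + algebraMap F R c := by
  rw [conjRep_apply_map]
  by_cases hT : T.card = 3
  · have hT' : (T.image a.1).card = 3 := by rw [card_image_perm, hT]
    obtain h | h := eq_or_eq_inv_of_support_eq (a := a * orientation T * a⁻¹)
      (b := orientation (T.image a.1))
      (by rw [support_conj, support_orientation hT, support_orientation hT'])
      (by rwa [support_orientation hT'])
    · exact ⟨0, by rw [h, map_zero, add_zero]⟩
    · refine ⟨1, ?_⟩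
      rw [h, map_one, ← hone (orientation (T.image a.1)) (by rwa [support_orientation hT']),
        ← add_assoc, h2, zero_add]
  · refine ⟨0, ?_⟩
    rw [orientation_of_card_ne hT, orientation_of_card_ne (by rwa [card_image_perm]), mul_one,
      mul_inv_cancel, map_zero, add_zero]

theorem IsSparseWeight.secondDiff_adMap [Nontrivial R]
    (hw : IsSparseWeight w x₀ x₁ x₂ y₀ y₁ y₂ z₀ z₁ z₂)
    (hinv : ∀ g T, w (T.image (θ g).1) = w T)
    (hscalar : ∀ r : R, (∀ g, Commute (ρ (θ g)) r) → ∃ c : F, algebraMap F R c = r)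
    (hperf : ∀ (ψ : G →* Multiplicative F) (g : G), ψ g = 1)
    (h2 : ∀ r : R, r + r = 0)
    (hone : ∀ a : alternatingGroup Ω, a.1.support.card = 3 → ρ a + ρ a⁻¹ = 1)
    {x x' y y' z : Ω} (hnd : [x, x', y, y', z].Nodup) :
    secondDiff (fun T => adMap F R (ρ (orientation T))) x x' y y' z = 0 := by
  have hinj : Function.Injective (algebraMap F R) := (algebraMap F R).injective
  set Y : R := ∑ T, w T • ρ (orientation T) with hY
  have hm (g : G) : ∃ c : F, conjRep F ρ (θ g) Y = Y + algebraMap F R c := by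
    choose c hc using exists_conjRep_orientation_eq (F := F) h2 hone (θ g)
    refine ⟨∑ T, w T * c T, ?_⟩
    have h1 : Y = ∑ T, w T • ρ (orientation (T.image (θ g).1)) := by
      refine (Fintype.sum_equiv (θ g).1.finsetCongr _ _ fun T => ?_).symm
      have : (θ g).1.finsetCongr T = T.image (θ g).1 := by
        rw [Equiv.finsetCongr_apply, Finset.map_eq_image]
        rfl
      rw [this, hinv]
    rw [map_sum (algebraMap F R)]
    nth_rw 2 [h1]
    rw [hY, map_sum, ← Finset.sum_add_distrib]
    refine Finset.sum_congr rfl fun T _ => ?_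
    rw [map_smul, hc, smul_add, map_mul, ← Algebra.smul_def]
  choose m hm using hm
  let ψ : G →* Multiplicative F := MonoidHom.mk' (fun g => Multiplicative.ofAdd (m g)) fun g g' => by
    rw [← ofAdd_add]
    congr 1
    apply hinj
    rw [← add_right_inj Y, ← hm, map_mul, map_mul, Module.End.mul_apply, hm, map_add, hm,
      conjRep_apply_algebraMap, map_add, add_assoc]
  have hm0 (g : G) : m g = 0 := hperf ψ g
  obtain ⟨c, hc⟩ := hscalar Y fun g => conjRep_apply_eq_self_iff.1 (by
    rw [hm, hm0, map_zero, add_zero] : conjRep F ρ (θ g) Y = Y)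
  refine hw.secondDiff_eq_zero (Representation.linHom (conjRep F ρ) (conjRep F ρ)) _
    (fun a T => ?_) (fun a => ?_) hnd
  · obtain ⟨c, hc⟩ := exists_conjRep_orientation_eq (F := F) h2 hone a T
    rw [linHom_conjRep_adMap, hc, map_add, adMap_algebraMap, add_zero]
  · have : ∑ T, w T • adMap F R (ρ (orientation T)) = 0 := by
      simp only [← map_smul, ← map_sum, ← hY, ← hc, adMap_algebraMap]
    rw [this, map_zero]

theorem adMap_orientation (h2 : ∀ r : R, r + r = 0)
    (hone : ∀ a : alternatingGroup Ω, a.1.support.card = 3 → ρ a + ρ a⁻¹ = 1)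
    {a : alternatingGroup Ω} (ha : a.1.support.card = 3) :
    adMap F R (ρ (orientation a.1.support)) = adMap F R (ρ a) := by
  obtain h | h := eq_or_eq_inv_of_support_eq (support_orientation ha) ha
  · rw [h]
  · rw [h]
    have : ρ a⁻¹ = ρ a + algebraMap F R 1 := by
      rw [map_one, ← hone a ha, ← add_assoc, h2, zero_add]
    rw [this, map_add, adMap_algebraMap, add_zero]

theorem altCycle_mul_mul_mul_self {x x' y z : Ω} (h : [x, x', y, z].Nodup) :
    altCycle x y z * altCycle x' z y * altCycle x y z *
      (altCycle x y z * altCycle x' z y * altCycle x y z) = 1 := by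
  apply Subtype.ext
  rw [Subgroup.coe_mul, coe_altCycle_mul_mul h]
  ext t
  simp only [Equiv.Perm.mul_apply, Equiv.swap_apply_def, Subgroup.coe_one, Equiv.Perm.one_apply]
  grind

theorem MonoidHom.map_eq_of_commute {A : Type*} [Group A] (ρ : A →* R) {a b : A}
    (ha : a ^ 3 = 1) (hb : b ^ 3 = 1) (hk : a * b * a * (a * b * a) = 1)
    (hc : ∀ r, Commute (ρ (a * b * a)) r) : ρ a = ρ b := by
  have haa : a * a = a⁻¹ := by
    rw [eq_inv_iff_mul_eq_one, ← ha, pow_succ, sq]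
  have hbb : b * b = b⁻¹ := by
    rw [eq_inv_iff_mul_eq_one, ← hb, pow_succ, sq]
  have hconj (g : A) : ρ (g * (a * b * a) * g⁻¹) = ρ (a * b * a) := by
    rw [map_mul, map_mul, ← (hc _).eq, mul_assoc, ← map_mul, mul_inv_cancel, map_one, mul_one]
  have h1 : ρ (a⁻¹ * b) = ρ (a * b * a) := by
    rw [← hconj a, show a * (a * b * a) * a⁻¹ = a * a * b by group, haa]
  have h2 : ρ (b * a⁻¹) = ρ (a * b * a) := by
    rw [← hconj a⁻¹, show a⁻¹ * (a * b * a) * a⁻¹⁻¹ = b * (a * a) by group, haa]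
  have h3 : ρ (a * b * a)⁻¹ = 1 := by
    calc ρ (a * b * a)⁻¹ = ρ (a⁻¹ * b⁻¹ * a⁻¹) := by
          congr 1
          group
      _ = ρ (a⁻¹ * b * (b * a⁻¹)) := by
          rw [← hbb]
          congr 1
          group
      _ = 1 := by rw [map_mul, h1, h2, ← map_mul, hk, map_one]
  rw [inv_eq_of_mul_eq_one_left hk] at h3
  rw [h3] at h1
  rw [← mul_one (ρ a), ← h1, ← map_mul, mul_inv_cancel_left]

theorem commute_of_secondDiff_adMap (hc : 9 ≤ Fintype.card Ω)
    (hdiff : ∀ x x' y y' z, [x, x', y, y', z].Nodup →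
      secondDiff (threeCycleSum ρ) x x' y y' z = 0)
    (h2 : ∀ r : R, r + r = 0)
    (hone : ∀ a : alternatingGroup Ω, a.1.support.card = 3 → ρ a + ρ a⁻¹ = 1)
    (hdiff' : ∀ x x' y y' z, [x, x', y, y', z].Nodup →
      secondDiff (fun T => adMap F R (ρ (orientation T))) x x' y y' z = 0)
    {x x' y' z : Ω} (h : [x, x', y', z].Nodup) (r : R) :
    Commute (ρ (altCycle x y' z * altCycle x' z y' * altCycle x y' z)) r := by
  obtain ⟨y, hy⟩ := exists_notMem_of_length_lt [x, x', y', z] (by simp; omega)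
  have hn : [x, x', y, y', z].Nodup := by clear * - h hy; simp at *; grind
  have had {x y z : Ω} (h : [x, y, z].Nodup) :
      adMap F R (ρ (orientation {x, y, z})) = adMap F R (ρ (altCycle x y z)) := by
    rw [← support_altCycle h]
    exact adMap_orientation h2 hone (by rw [support_altCycle h, card_triple h])
  have had' {x y z : Ω} (h : [x, y, z].Nodup) :
      adMap F R (ρ (altCycle x z y)) = adMap F R (ρ (altCycle x y z)) := by
    rw [← had h, ← had (by clear * - h; grind)]
    congr 4
    clear * - h
    grind
  have hrel {x x' y z : Ω} (h : [x, x', y, z].Nodup) :=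
    ((tetrahedral_relations_of_secondDiff hc hdiff h).2 h2).1
  have h0 := hdiff' x x' y y' z hn
  have hneg (f : R →ₗ[F] R) : -f = f := by
    ext s
    exact neg_eq_of_add_eq_zero_left (h2 (f s))
  rw [secondDiff, had (by clear * - hn; grind), had (by clear * - hn; grind),
    had (by clear * - hn; grind), had (by clear * - hn; grind),
    ← had' (x := x') (y := y) (by clear * - hn; grind),
    ← had' (x := x') (y := y') (by clear * - hn; grind), sub_eq_add_neg, sub_eq_add_neg,
    hneg, hneg, ← map_add (adMap F R), add_assoc, ← map_add (adMap F R), hrel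
        (by clear * - hn; grind),
    hrel (by clear * - hn; grind),
    ← map_add (adMap F R)] at h0
  have hk := altCycle_mul_mul_mul_self (show [x, x', y, z].Nodup by clear * - hn; grind)
  have hk' := altCycle_mul_mul_mul_self h
  have hkk := altCycle_mul_mul_mul hn
  generalize altCycle x y z * altCycle x' z y * altCycle x y z = k at *
  generalize altCycle x y' z * altCycle x' z y' * altCycle x y' z = k' at *
  have hs := hone (k * k') (by rw [hkk, support_altCycle (by clear * - hn; grind),
    card_triple (by clear * - hn; grind)])
  have e : 1 + ρ k + (1 + ρ k') = ρ (k * k' * k) := by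
    calc _ = (1 + 1) + ρ k + ρ k' := by abel
      _ = ρ k * (1 + ρ (k * k')) := by
        rw [h2, mul_add, mul_one, ← map_mul, ← mul_assoc, hk, one_mul, zero_add]
      _ = ρ k * ρ (k * k')⁻¹ := by rw [← hs, add_right_comm, h2, zero_add]
      _ = ρ (k * k' * k) := by
        rw [← map_mul, _root_.mul_inv_rev, inv_eq_of_mul_eq_one_left hk,
          inv_eq_of_mul_eq_one_left hk', mul_assoc]
  rw [e] at h0
  have e' : ρ k' = ρ (k * k' * k) := by
    have := (commute_of_adMap_eq_zero h0 (ρ k)).eq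
    rw [← map_mul, ← map_mul, mul_assoc _ k k, hk, mul_one, ← mul_assoc, ← mul_assoc, hk,
      one_mul] at this
    have h3 := congr_arg (· * ρ k) this
    simp only [← map_mul] at h3
    rw [mul_assoc k' k k, hk, mul_one] at h3
    exact h3.symm
  rw [e']
  exact commute_of_adMap_eq_zero h0 r

theorem IsSparseWeight.eq_one_of_add_inv_eq_one [Nontrivial R]
    (hw : IsSparseWeight w x₀ x₁ x₂ y₀ y₁ y₂ z₀ z₁ z₂)
    (hinv : ∀ g T, w (T.image (θ g).1) = w T)
    (hscalar : ∀ r : R, (∀ g, Commute (ρ (θ g)) r) → ∃ c : F, algebraMap F R c = r)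
    (hperf : ∀ (ψ : G →* Multiplicative F) (g : G), ψ g = 1)
    (h2 : ∀ r : R, r + r = 0)
    (hone : ∀ a : alternatingGroup Ω, a.1.support.card = 3 → ρ a + ρ a⁻¹ = 1) : ρ = 1 := by
  have hc : 9 ≤ Fintype.card Ω := hw.nodup.length_le_card
  refine ρ.eq_one_of_forall_altCycle_eq hc fun x x' y z h => ?_
  exact ρ.map_eq_of_commute (altCycle_pow_three _ _ _) (altCycle_pow_three _ _ _)
    (altCycle_mul_mul_mul_self h) (commute_of_secondDiff_adMap (F := F) hc
      (fun _ _ _ _ _ => hw.secondDiff_threeCycleSum hinv hscalar) h2 hone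
      (fun _ _ _ _ _ => hw.secondDiff_adMap hinv hscalar hperf h2 hone) h)

theorem IsSparseWeight.eq_one
    (hw : IsSparseWeight w x₀ x₁ x₂ y₀ y₁ y₂ z₀ z₁ z₂)
    (hinv : ∀ g T, w (T.image (θ g).1) = w T)
    (hscalar : ∀ r : R, (∀ g, Commute (ρ (θ g)) r) → ∃ c : F, algebraMap F R c = r)
    (hperf : ∀ (ψ : G →* Multiplicative F) (g : G), ψ g = 1) : ρ = 1 := by
  cases subsingleton_or_nontrivial R
  · exact MonoidHom.ext fun _ => Subsingleton.elim _ _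
  have hc : 9 ≤ Fintype.card Ω := hw.nodup.length_le_card
  have hrel {x x' y z : Ω} (h : [x, x', y, z].Nodup) :=
    tetrahedral_relations_of_secondDiff (ρ := ρ) hc
      (fun _ _ _ _ _ => hw.secondDiff_threeCycleSum hinv hscalar) h
  by_cases hF : (1 + 1 : F) = 0
  swap
  · refine ρ.eq_one_of_forall_altCycle_eq hc fun x x' y z h => (hrel h).1 fun r hr => ?_
    have : (1 + 1 : F) • r = 0 := by rw [add_smul, one_smul, hr]
    exact (smul_eq_zero.1 this).resolve_left hF
  have h2 (r : R) : r + r = 0 := by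
    rw [← one_smul F r, ← add_smul, hF, zero_smul]
  have hK {x x' y z : Ω} (h : [x, x', y, z].Nodup) :
      ρ (altCycle x y z) + ρ (altCycle x z y) = ρ (altCycle x' y z) + ρ (altCycle x' z y) := by
    obtain ⟨h1, h3⟩ := (hrel h).2 h2
    rw [← h3, ← sub_eq_zero, sub_eq_add_neg, neg_eq_of_add_eq_zero_left (h2 _)] at h1
    rw [← sub_eq_zero, sub_eq_add_neg, neg_eq_of_add_eq_zero_left (h2 _), ← h1]
    abel
  have hn : [x₀, y₀, z₀].Nodup := by
    have := hw.nodup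
    grind
  set κ := ρ (altCycle x₀ y₀ z₀) + ρ (altCycle x₀ z₀ y₀) with hκ
  have hconst {x y z : Ω} (h : [x, y, z].Nodup) :
      ρ (altCycle x y z) + ρ (altCycle x z y) = κ := by
    obtain ⟨u, hu⟩ := exists_notMem_of_length_lt [x, y, z, x₀, y₀, z₀] (by simp; omega)
    obtain ⟨v, hv⟩ := exists_notMem_of_length_lt [x, y, z, x₀, y₀, z₀, u] (by simp; omega)
    obtain ⟨t, ht⟩ := exists_notMem_of_length_lt [x, y, z, x₀, y₀, z₀, u, v] (by simp; omega)
    have key {x y z : Ω} (h : [x, y, z, u, v, t].Nodup) :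
        ρ (altCycle x y z) + ρ (altCycle x z y) = ρ (altCycle u v t) + ρ (altCycle u t v) := by
      rw [hK (x' := u) (show [x, u, y, z].Nodup by clear * - h; grind), altCycle_rotate u y z,
        altCycle_rotate u z y, altCycle_rotate z y u, add_comm,
        hK (x' := v) (show [y, v, u, z].Nodup by clear * - h; grind), altCycle_rotate v u z,
        altCycle_rotate u z v, altCycle_rotate v z u, add_comm,
        hK (x' := t) (show [z, t, u, v].Nodup by clear * - h; grind), altCycle_rotate t u v,
        ← altCycle_rotate u t v]
    exact (key (by clear * - h hu hv ht; simp at *; grind)).trans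
      (key (by clear * - hn hu hv ht; simp at *; grind)).symm
  have hκ' (a : alternatingGroup Ω) : Commute (ρ a) κ := by
    rw [commute_iff_eq, hκ, mul_add, map_mul_altCycle, map_mul_altCycle, ← add_mul, hconst]
    exact (List.nodup_map_iff (l := [x₀, y₀, z₀]) a.1.injective).2 hn
  obtain ⟨c, hc'⟩ := hscalar κ fun g => hκ' _
  have hsq : κ * κ = κ := by
    have h3 := altCycle_inv x₀ y₀ z₀
    have h4 : altCycle x₀ y₀ z₀ * altCycle x₀ y₀ z₀ = altCycle x₀ z₀ y₀ := by
      rw [← h3, eq_inv_iff_mul_eq_one, ← altCycle_pow_three x₀ y₀ z₀, pow_succ, sq]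
    have h5 : altCycle x₀ z₀ y₀ * altCycle x₀ z₀ y₀ = altCycle x₀ y₀ z₀ := by
      rw [← _root_.inv_inj, _root_.mul_inv_rev, altCycle_inv, altCycle_inv, h4]
    have h6 : altCycle x₀ y₀ z₀ * altCycle x₀ z₀ y₀ = 1 := by rw [← h3, mul_inv_cancel]
    have h7 : altCycle x₀ z₀ y₀ * altCycle x₀ y₀ z₀ = 1 := by rw [← h3, inv_mul_cancel]
    calc κ * κ = ρ (altCycle x₀ y₀ z₀) * ρ (altCycle x₀ y₀ z₀) +
          ρ (altCycle x₀ z₀ y₀) * ρ (altCycle x₀ z₀ y₀) +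
          (ρ (altCycle x₀ y₀ z₀) * ρ (altCycle x₀ z₀ y₀) +
            ρ (altCycle x₀ z₀ y₀) * ρ (altCycle x₀ y₀ z₀)) := by rw [hκ]; noncomm_ring
      _ = κ := by
        rw [← map_mul, ← map_mul, ← map_mul, ← map_mul, h4, h5, h6, h7, h2, add_zero, add_comm]
  rw [← hc', ← map_mul, (algebraMap F R).injective.eq_iff] at hsq
  obtain rfl | h1 := eq_zero_or_one_of_sq_eq_self ((sq c).trans hsq)
  · refine ρ.eq_one_of_altCycle_swap (by omega) hn ?_
    rw [map_zero] at hc'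
    rw [← sub_eq_zero, sub_eq_add_neg, neg_eq_of_add_eq_zero_left (h2 _), ← hκ, hc']
  · subst h1
    refine hw.eq_one_of_add_inv_eq_one hinv hscalar hperf h2 fun a ha => ?_
    obtain ⟨x, y, z, h, hT⟩ := exists_nodup_eq_triple ha
    rw [map_one] at hc'
    obtain rfl | rfl := (support_eq_triple_iff h).1 hT
    · rw [altCycle_inv, hconst h, hc']
    · rw [altCycle_inv, hconst (by clear * - h; grind), hc']

end Orientation

section Irreducible

variable {F G V : Type*} [Field F] [AddCommGroup V] [Module F V]

theorem RepIrreducible.finiteDimensional [Group G] [Finite G] {ρ : Representation F G V}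
    (h : RepIrreducible ρ) : FiniteDimensional F V := by
  have := h.1
  obtain ⟨v, hv⟩ := exists_ne (0 : V)
  have hfin : (Set.range fun g => ρ g v).Finite := Set.finite_range _
  have htop : Submodule.span F (Set.range fun g => ρ g v) = ⊤ := by
    refine (h.2 _ fun g u hu => ?_).resolve_left fun hbot => hv ?_
    · have hle : Submodule.span F (Set.range fun g => ρ g v) ≤
          (Submodule.span F (Set.range fun g => ρ g v)).comap (ρ g) := by
        rw [Submodule.span_le]
        rintro _ ⟨g', rfl⟩
        refine Submodule.subset_span ⟨g * g', ?_⟩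
        simp only [map_mul, Module.End.mul_apply]
      exact hle hu
    · rw [← Submodule.mem_bot F, ← hbot]
      exact Submodule.subset_span ⟨1, by simp⟩
  exact ⟨⟨hfin.toFinset, by rw [hfin.coe_toFinset, htop]⟩⟩

theorem RepIrreducible.exists_algebraMap_eq [IsAlgClosed F] [Group G] [Finite G]
    {ρ : Representation F G V} (h : RepIrreducible ρ) {f : Module.End F V}
    (hf : ∀ g, Commute (ρ g) f) : ∃ c : F, algebraMap F (Module.End F V) c = f := by
  have := h.1
  have := h.finiteDimensional
  obtain ⟨c, hc⟩ := Module.End.exists_eigenvalue f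
  refine ⟨c, ?_⟩
  have htop : f.eigenspace c = ⊤ := by
    refine (h.2 _ fun g u hu => ?_).resolve_left hc
    rw [Module.End.mem_eigenspace_iff] at hu ⊢
    rw [← Module.End.mul_apply, ← (hf g).eq, Module.End.mul_apply, hu, map_smul]
  ext v
  have hv : v ∈ f.eigenspace c := htop ▸ Submodule.mem_top
  rw [Module.End.mem_eigenspace_iff] at hv
  rw [hv, Module.algebraMap_end_apply]

theorem RepIrreducible.rank_le_one [Monoid G] {ρ : Representation F G V} (h : RepIrreducible ρ)
    (hρ : ∀ g, ρ g = 1) : Module.rank F V ≤ 1 := by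
  have := h.1
  obtain ⟨v, hv⟩ := exists_ne (0 : V)
  refine rank_le_one_iff.2 ⟨v, fun u => ?_⟩
  rw [← Submodule.mem_span_singleton]
  have htop : Submodule.span F {v} = ⊤ := by
    refine (h.2 _ fun g u hu => ?_).resolve_left fun hbot => hv ?_
    · rwa [hρ]
    · rwa [Submodule.span_singleton_eq_bot] at hbot
  rw [htop]
  exact Submodule.mem_top

end Irreducible

/-- let `q` be a prime power (equivalently, `𝔽` a finite field), `d ≥ 4`,
and `Ω` the set of 2-dimensional subspaces of `𝔽^d`. The image `X` of the induced
homomorphism `SL_d(q) → Sym(Ω)` is isomorphic to `PSL_d(q)`, is contained in `Alt(Ω)`,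
and for `F` algebraically closed, every `F Alt(Ω)`-module `V` with `dim V > 1` is
reducible as an `F X`-module. -/
theorem stmt1 (𝔽 : Type*) [Field 𝔽] [Finite 𝔽] (d : ℕ) (hd : 4 ≤ d)
    (F : Type*) [Field F] [IsAlgClosed F] :
    Nonempty (↥(slToPerm 𝔽 d).range ≃* Matrix.ProjectiveSpecialLinearGroup (Fin d) 𝔽) ∧
    ∃ hX : (slToPerm 𝔽 d).range ≤ alternatingGroup (GrassTwo 𝔽 d),
      ∀ (V : Type u) [AddCommGroup V] [Module F V]
        (ρ : Representation F (alternatingGroup (GrassTwo 𝔽 d)) V),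
        1 < Module.rank F V →
        ¬ RepIrreducible (ρ.comp (Subgroup.inclusion hX)) := by
  have hX := slToPerm_range_le_alternatingGroup 𝔽 (show 2 < d by omega)
  refine ⟨nonempty_range_slToPerm_mulEquiv 𝔽 (by omega), hX, fun V _ _ ρ hV hirr => ?_⟩
  obtain ⟨x, x₁, x₂, y, y₁, y₂, z, z₁, z₂, hw⟩ := exists_isSparseWeight_planeWeight (𝔽 := 𝔽) F hd
  have hρ : (ρ : alternatingGroup (GrassTwo 𝔽 d) →* Module.End F V) = 1 := by
    refine hw.eq_one (θ := (Subgroup.inclusion hX).comp (slToPerm 𝔽 d).rangeRestrict)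
      (fun g T => planeWeight_image g T)
      (fun r hr => hirr.exists_algebraMap_eq ?_)
      (SpecialLinearGroup.map_eq_one_of_commGroup (by simp; omega))
    rintro ⟨_, g, rfl⟩
    exact hr g
  refine hV.not_ge (hirr.rank_le_one fun g => ?_)
  exact DFunLike.congr_fun hρ _
end

section
/- Let F be an algebraically closed field of characteristic 2, n ≥ 5, and let V be an irreducible F A_n-module. Suppose that V does not extend to S_n, i.e. there is no F S_n-module W whose restriction to A_n is isomorphic to V. Then dim_F V ≥ 2^{(n−6)/4}. -/
theorem CharTwo.module_add_self (F : Type*) {W : Type*} [Field F] [CharP F 2] [AddCommGroup W]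
    [Module F W] (w : W) : w + w = 0 := by
  rw [← two_smul F w, CharTwo.two_eq_zero, zero_smul]

/-- If a product of `r` pairwise commuting square-zero operators does not vanish on an invariant
subspace, then this subspace has dimension at least `2 ^ r`. -/
theorem two_pow_length_le_finrank_of_prod_ne_zero {F W : Type*} [Field F]
    [AddCommGroup W] [Module F W] [FiniteDimensional F W] (l : List (Module.End F W))
    (hsq : ∀ T ∈ l, T * T = 0) (hcomm : ∀ T ∈ l, ∀ T' ∈ l, Commute T T') (X : Submodule F W)
    (hX : ∀ T ∈ l, ∀ x ∈ X, T x ∈ X) (h : ∃ x ∈ X, l.prod x ≠ 0) :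
    2 ^ l.length ≤ Module.finrank F X := by
  induction l generalizing X with
  | nil =>
    obtain ⟨x, hx, hx0⟩ := h
    have : Nontrivial X := ⟨⟨x, hx⟩, 0, fun h0 => hx0 (by simpa using congrArg Subtype.val h0)⟩
    simpa using Nat.succ_le_of_lt (Module.finrank_pos (R := F) (M := X))
  | cons T l ih =>
    obtain ⟨x, hx, hx0⟩ := h
    have hTl : Commute T l.prod := Commute.list_prod_right _ _ fun T' hT' =>
      hcomm T (by simp) T' (by simp [hT'])
    have hY : 2 ^ l.length ≤ Module.finrank F (X.map T) := by
      refine ih (fun T' hT' => hsq T' (by simp [hT']))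
        (fun T₁ h₁ T₂ h₂ => hcomm T₁ (by simp [h₁]) T₂ (by simp [h₂])) _ ?_
        ⟨T x, Submodule.mem_map_of_mem hx, ?_⟩
      · rintro T' hT' _ ⟨y, hy, rfl⟩
        have := congrArg (· y) (hcomm T' (by simp [hT']) T (by simp)).eq
        simp only [Module.End.mul_apply] at this
        rw [this]
        exact Submodule.mem_map_of_mem (hX T' (by simp [hT']) y hy)
      · rwa [List.prod_cons, hTl.eq] at hx0
    have hrn := LinearMap.finrank_range_add_finrank_ker (T.domRestrict X)
    rw [LinearMap.range_domRestrict] at hrn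
    have hle : Module.finrank F (X.map T) ≤ Module.finrank F (LinearMap.ker (T.domRestrict X)) := by
      rw [← Submodule.finrank_map_subtype_eq X]
      apply Submodule.finrank_mono
      rintro _ ⟨y, hy, rfl⟩
      have hTT := congrArg (· y) (hsq T (by simp))
      exact ⟨⟨T y, hX T (by simp) y hy⟩, by simpa using hTT, rfl⟩
    rw [List.length_cons, pow_succ]
    omega

section SwapProducts

variable {F W α : Type*} [Field F] [AddCommGroup W] [Module F W]

/-- The points moved by a list of transpositions, each given by a pair of points. -/
def pairSupport (l : List (α × α)) : List α := l.flatMap fun p => [p.1, p.2]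

@[simp]
theorem pairSupport_cons (p : α × α) (l : List (α × α)) :
    pairSupport (p :: l) = p.1 :: p.2 :: pairSupport l := rfl

theorem length_pairSupport (l : List (α × α)) : (pairSupport l).length = 2 * l.length := by
  induction l with
  | nil => rfl
  | cons p l ih => simp [ih]; ring

theorem mem_pairSupport {l : List (α × α)} {p : α × α} (hp : p ∈ l) :
    p.1 ∈ pairSupport l ∧ p.2 ∈ pairSupport l := by
  constructor <;> exact List.mem_flatMap.2 ⟨p, hp, by simp⟩

variable [DecidableEq α]

/-- The operator `1 + (a b)` attached to a pair `(a, b)`. -/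
def onePlusSwap (σ : Representation F (Equiv.Perm α) W) (p : α × α) : Module.End F W :=
  1 + σ (Equiv.swap p.1 p.2)

theorem onePlusSwap_mul_self [CharP F 2] (σ : Representation F (Equiv.Perm α) W)
    (p : α × α) :
    onePlusSwap σ p * onePlusSwap σ p = 0 := by
  have h : σ (Equiv.swap p.1 p.2) * σ (Equiv.swap p.1 p.2) = 1 := by
    rw [← map_mul, Equiv.swap_mul_self, map_one]
  rw [onePlusSwap, mul_add, mul_one, add_mul, one_mul, h, add_comm (σ _) 1]
  ext w
  exact CharTwo.module_add_self F _

theorem commute_onePlusSwap (σ : Representation F (Equiv.Perm α) W) {p q : α × α}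
    (h₁ : p.1 ≠ q.1) (h₂ : p.1 ≠ q.2) (h₃ : p.2 ≠ q.1) (h₄ : p.2 ≠ q.2) :
    Commute (onePlusSwap σ p) (onePlusSwap σ q) := by
  have h : Commute (Equiv.swap p.1 p.2) (Equiv.swap q.1 q.2) := by
    apply Equiv.Perm.Disjoint.commute
    intro x
    by_cases hx : x = p.1 ∨ x = p.2
    · right
      rcases hx with rfl | rfl <;> exact Equiv.swap_apply_of_ne_of_ne ‹_› ‹_›
    · left
      exact Equiv.swap_apply_of_ne_of_ne (fun h => hx (.inl h)) (fun h => hx (.inr h))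
  have hσ : Commute (σ (Equiv.swap p.1 p.2)) (σ (Equiv.swap q.1 q.2)) := h.map σ
  exact ((Commute.one_left _).add_left
    ((Commute.one_right _).add_right hσ))

theorem commute_onePlusSwap_of_mem (σ : Representation F (Equiv.Perm α) W) {l : List (α × α)}
    (hl : (pairSupport l).Nodup) {p q : α × α} (hp : p ∈ l) (hq : q ∈ l) :
    Commute (onePlusSwap σ p) (onePlusSwap σ q) := by
  induction l with
  | nil => simp at hp
  | cons r l ih =>
    simp only [pairSupport_cons, List.nodup_cons, List.mem_cons, not_or] at hl
    have key : ∀ q ∈ l, Commute (onePlusSwap σ r) (onePlusSwap σ q) := fun q hq => by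
      obtain ⟨h₁, h₂⟩ := mem_pairSupport hq
      apply commute_onePlusSwap <;> rintro h <;> simp_all
    rcases List.mem_cons.1 hp with hpr | hp <;> rcases List.mem_cons.1 hq with hqr | hq
    · rw [hpr, hqr]
    · exact hpr ▸ key q hq
    · exact hqr ▸ (key p hp).symm
    · exact ih hl.2.2 hp hq

/-- The product of the operators `1 + (a b)` over a list of pairs `(a, b)`. -/
def swapProd (σ : Representation F (Equiv.Perm α) W) (l : List (α × α)) : Module.End F W :=
  (l.map (onePlusSwap σ)).prod

theorem swapProd_cons (σ : Representation F (Equiv.Perm α) W) (p : α × α) (l : List (α × α)) :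
    swapProd σ (p :: l) = onePlusSwap σ p * swapProd σ l := by
  simp [swapProd]

theorem swapProd_cons' (σ : Representation F (Equiv.Perm α) W) {p : α × α} {l : List (α × α)}
    (hl : (pairSupport (p :: l)).Nodup) :
    swapProd σ (p :: l) = swapProd σ l * onePlusSwap σ p := by
  rw [swapProd_cons]
  refine (Commute.list_prod_right _ _ fun T hT => ?_).eq
  obtain ⟨q, hq, rfl⟩ := List.mem_map.1 hT
  exact commute_onePlusSwap_of_mem σ hl (by simp) (by simp [hq])

theorem two_pow_length_le_finrank_of_swapProd_ne_zero [CharP F 2]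
    [FiniteDimensional F W] (σ : Representation F (Equiv.Perm α) W) {l : List (α × α)}
    (hl : (pairSupport l).Nodup) (h : swapProd σ l ≠ 0) : 2 ^ l.length ≤ Module.finrank F W := by
  obtain ⟨w, hw⟩ : ∃ w, swapProd σ l w ≠ 0 := by
    by_contra! hc
    exact h (LinearMap.ext hc)
  have := two_pow_length_le_finrank_of_prod_ne_zero (l.map (onePlusSwap σ)) ?_ ?_ ⊤
    (by simp) ⟨w, trivial, hw⟩
  · simpa using this
  · simp only [List.mem_map]
    rintro _ ⟨p, -, rfl⟩
    exact onePlusSwap_mul_self σ p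
  · simp only [List.mem_map]
    rintro _ ⟨p, hp, rfl⟩ _ ⟨q, hq, rfl⟩
    exact commute_onePlusSwap_of_mem σ hl hp hq

/-- An irreducible representation of a symmetric group in characteristic `2` on whose space every
vector fixed by a transposition `s` lies in the image of `1 + s` has exponentially large
dimension. -/
theorem exists_two_pow_le_finrank_of_fixed_mem_range [CharP F 2] [Fintype α]
    [FiniteDimensional F W] (σ : Representation F (Equiv.Perm α) W) (hσ : RepIrreducible σ)
    (hfix : ∀ a b : α, a ≠ b → ∀ w : W, σ (Equiv.swap a b) w = w →
      ∃ v, v + σ (Equiv.swap a b) v = w) :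
    ∃ r : ℕ, Fintype.card α ≤ 4 * r + 1 ∧ 2 ^ r ≤ Module.finrank F W := by
  let P : ℕ → Prop := fun r =>
    ∃ l : List (α × α), l.length = r ∧ (pairSupport l).Nodup ∧ swapProd σ l ≠ 0
  have hPbound : ∀ r, P r → r ≤ Fintype.card α := by
    rintro _ ⟨l, rfl, hl, -⟩
    have := hl.length_le_card
    rw [length_pairSupport] at this
    omega
  have hP0 : P 0 := by
    have := hσ.1
    exact ⟨[], rfl, List.nodup_nil, by simp [swapProd]⟩
  classical
  obtain ⟨l, hlr, hl, hl0⟩ := Nat.findGreatest_spec (P := P) (Nat.zero_le (Fintype.card α)) hP0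
  have hmax : ∀ p : α × α, (pairSupport (p :: l)).Nodup → swapProd σ (p :: l) = 0 := by
    intro p hp
    by_contra h0
    have hP : P (l.length + 1) := ⟨p :: l, rfl, hp, h0⟩
    have := Nat.le_findGreatest (hPbound _ hP) hP
    omega
  refine ⟨l.length, ?_, two_pow_length_le_finrank_of_swapProd_ne_zero σ hl hl0⟩
  by_contra! hcard
  obtain ⟨g, w, hgw⟩ : ∃ (g : Equiv.Perm α) (w : W), swapProd σ l (σ g (swapProd σ l w)) ≠ 0 := by
    by_contra! hc
    let X : Submodule F W := Submodule.span F {x | ∃ g w, x = σ g (swapProd σ l w)}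
    have hX : RepInvariant σ X := by
      intro g v hv
      induction hv using Submodule.span_induction with
      | mem x hx =>
        obtain ⟨g', w, rfl⟩ := hx
        exact Submodule.subset_span ⟨g * g', w, by simp⟩
      | zero => simp
      | add x y _ _ hx hy => rw [map_add]; exact X.add_mem hx hy
      | smul c x _ hx => rw [map_smul]; exact X.smul_mem c hx
    rcases hσ.2 X hX with h | h
    · refine hl0 (LinearMap.ext fun w => ?_)
      have : swapProd σ l w ∈ X := Submodule.subset_span ⟨1, w, by simp⟩
      simpa [h] using this
    · have hker : X ≤ LinearMap.ker (swapProd σ l) := by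
        rw [Submodule.span_le]
        rintro _ ⟨g, w, rfl⟩
        exact hc g w
      exact hl0 (LinearMap.ext fun w => hker (h ▸ Submodule.mem_top))
  obtain ⟨a, b, hab, ha, hb, hga, hgb⟩ : ∃ a b, a ≠ b ∧ a ∉ pairSupport l ∧ b ∉ pairSupport l ∧
      g⁻¹ a ∉ pairSupport l ∧ g⁻¹ b ∉ pairSupport l := by
    let S : Finset α := (pairSupport l).toFinset ∪ ((pairSupport l).map g).toFinset
    have hS : S.card ≤ 4 * l.length := by
      have h₁ := List.toFinset_card_le (pairSupport l)
      have h₂ := List.toFinset_card_le ((pairSupport l).map g)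
      have h₃ := Finset.card_union_le (pairSupport l).toFinset ((pairSupport l).map g).toFinset
      rw [List.length_map] at h₂
      rw [length_pairSupport] at h₁ h₂
      change Finset.card (_ ∪ _) ≤ _
      omega
    have hSc : 1 < Sᶜ.card := by
      rw [Finset.card_compl]
      omega
    have hmem : ∀ x, x ∈ Sᶜ → x ∉ pairSupport l ∧ g⁻¹ x ∉ pairSupport l := by
      intro x hx
      simp only [S, Finset.mem_compl, Finset.mem_union, List.mem_toFinset, List.mem_map,
        not_or, not_exists, not_and] at hx
      exact ⟨hx.1, fun h => hx.2 _ h (by simp)⟩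
    obtain ⟨a, ha, b, hb, hab⟩ := Finset.one_lt_card.1 hSc
    exact ⟨a, b, hab, (hmem a ha).1, (hmem b hb).1, (hmem a ha).2, (hmem b hb).2⟩
  have hfixed : σ (Equiv.swap a b) (σ g (swapProd σ l w)) = σ g (swapProd σ l w) := by
    have h0 := congrArg (· w) (hmax (g⁻¹ a, g⁻¹ b) 
      (by simp only [pairSupport_cons, List.nodup_cons, List.mem_cons, not_or, hl, hga, hgb,
            EmbeddingLike.apply_eq_iff_eq, hab, not_false_eq_true, and_self]))
    simp only [swapProd_cons, onePlusSwap, Module.End.mul_apply, LinearMap.add_apply,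
      Module.End.one_apply, LinearMap.zero_apply] at h0
    have h1 : σ (Equiv.swap (g⁻¹ a) (g⁻¹ b)) (swapProd σ l w) = swapProd σ l w := by
      rw [← sub_eq_zero, ← h0, sub_eq_iff_eq_add, add_comm, ← add_assoc,
        CharTwo.module_add_self F, zero_add]
    have h2 : Equiv.swap a b * g = g * Equiv.swap (g⁻¹ a) (g⁻¹ b) := by
      rw [Equiv.mul_swap_eq_swap_mul]
      simp
    rw [← Module.End.mul_apply, ← map_mul, h2, map_mul, Module.End.mul_apply, h1]
  obtain ⟨v, hv⟩ := hfix a b hab _ hfixed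
  have hab0 := hmax (a, b) (by simp [hab, ha, hb, hl])
  rw [swapProd_cons' σ (by simp [hab, ha, hb, hl])] at hab0
  apply hgw
  rw [← hv]
  simpa [onePlusSwap] using congrArg (· v) hab0

end SwapProducts

section Coinduced

variable {F G V : Type*} [Field F] [Group G] {H : Subgroup G} [AddCommGroup V] [Module F V]
  (ρ : Representation F H V)

open Representation

theorem coindV_apply_mul {f : G → V} (hf : f ∈ coindV H.subtype ρ) {h : G} (hh : h ∈ H) (x : G) :
    f (h * x) = ρ ⟨h, hh⟩ (f x) :=
  hf ⟨h, hh⟩ x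

theorem nontrivial_coindV [Nontrivial V] : Nontrivial (coindV H.subtype ρ) := by
  classical
  obtain ⟨v, hv⟩ := exists_ne (0 : V)
  refine ⟨⟨fun x => if hx : x ∈ H then ρ ⟨x, hx⟩ v else 0, fun h x => ?_⟩, 0, fun h0 => hv ?_⟩
  · by_cases hx : x ∈ H
    · have hhx : (h : G) * x ∈ H := mul_mem h.2 hx
      change (if hx : (h : G) * x ∈ H then ρ ⟨_, hx⟩ v else 0) =
        ρ h (if hx : x ∈ H then ρ ⟨x, hx⟩ v else 0)
      rw [dif_pos hhx, dif_pos hx, ← Module.End.mul_apply, ← map_mul]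
      rfl
    · have hhx : (h : G) * x ∉ H := by rwa [Subgroup.mul_mem_cancel_left H h.2]
      simp [hx, hhx]
  · have h1 : (if hx : 1 ∈ H then ρ ⟨1, hx⟩ v else 0) = 0 := congrFun (congrArg Subtype.val h0) 1
    rw [dif_pos (one_mem H)] at h1
    have h2 : ρ 1 v = 0 := h1
    rwa [map_one] at h2

theorem coindV_eq_zero_of_index_two (hH : H.index = 2) {t : G} (ht : t ∉ H)
    {f : coindV H.subtype ρ} (h1 : f.1 1 = 0) (h2 : f.1 t = 0) : f = 0 := by
  ext x
  by_cases hx : x ∈ H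
  · have := coindV_apply_mul ρ f.2 hx 1
    rw [mul_one, h1, map_zero] at this
    exact this
  · have hxt : x * t⁻¹ ∈ H := by
      rw [Subgroup.mul_mem_iff_of_index_two hH]
      simp [hx, ht]
    have := coindV_apply_mul ρ f.2 hxt t
    rw [inv_mul_cancel_right, h2, map_zero] at this
    exact this

theorem finrank_coindV_le_of_index_two [FiniteDimensional F V] (hH : H.index = 2) :
    FiniteDimensional F (coindV H.subtype ρ) ∧
      Module.finrank F (coindV H.subtype ρ) ≤ 2 * Module.finrank F V := by
  obtain ⟨t, ht⟩ : ∃ t, t ∉ H := by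
    by_contra! h
    rw [(Subgroup.eq_top_iff' H).2 h, Subgroup.index_top] at hH
    omega
  let φ : coindV H.subtype ρ →ₗ[F] V × V :=
    ((LinearMap.proj 1).prod (LinearMap.proj t)) ∘ₗ (coindV H.subtype ρ).subtype
  have hφ : Function.Injective φ := by
    rw [injective_iff_map_eq_zero]
    intro f hf
    exact coindV_eq_zero_of_index_two ρ hH ht (congrArg Prod.fst hf) (congrArg Prod.snd hf)
  refine ⟨Module.Finite.of_injective φ hφ, ?_⟩
  have := LinearMap.finrank_le_finrank_of_injective hφ
  rw [Module.finrank_prod] at this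
  omega

theorem coind_exists_add_eq_of_fixed (hH : H.index = 2) {s : G} (hs : s ∉ H)
    (w : coindV H.subtype ρ) (hw : coind H.subtype ρ s w = w) :
    ∃ v, v + coind H.subtype ρ s v = w := by
  classical
  refine ⟨⟨fun x => if x ∈ H then w.1 x else 0, fun h x => ?_⟩, ?_⟩
  · by_cases hx : x ∈ H
    · simp only [Subgroup.subtype_apply, Subgroup.mul_mem_cancel_left H h.2, hx, if_true]
      exact w.2 h x
    · simp [Subgroup.mul_mem_cancel_left H h.2, hx]
  · ext x
    have hwx : w.1 (x * s) = w.1 x := congrFun (congrArg Subtype.val hw) x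
    change (if x ∈ H then w.1 x else 0) + (if x * s ∈ H then w.1 (x * s) else 0) = w.1 x
    rw [Subgroup.mul_mem_iff_of_index_two hH, hwx]
    by_cases hx : x ∈ H <;> simp [hx, hs]

end Coinduced

/-- If an irreducible representation of a subgroup of index two does not extend to the whole group,
then its coinduced representation is irreducible. -/
theorem coind_irreducible_of_not_extends {F : Type*} {G : Type} {V : Type u} [Field F] [Group G]
    {H : Subgroup G} (hH : H.index = 2) [AddCommGroup V] [Module F V] (ρ : Representation F H V)
    (hirr : RepIrreducible ρ)
    (hnotext : ∀ (W : Type u) [AddCommGroup W] [Module F W] (σ : Representation F G W),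
      ¬ ∃ e : V ≃ₗ[F] W, ∀ (g : H) (v : V), e (ρ g v) = σ (g : G) (e v)) :
    RepIrreducible (Representation.coind H.subtype ρ) := by
  have hnormal : H.Normal := Subgroup.normal_of_index_eq_two hH
  obtain ⟨t, ht⟩ : ∃ t, t ∉ H := by
    by_contra! h
    rw [(Subgroup.eq_top_iff' H).2 h, Subgroup.index_top] at hH
    omega
  have := hirr.1
  refine ⟨nontrivial_coindV ρ, fun X hX => ?_⟩
  let ev : G → Representation.coindV H.subtype ρ →ₗ[F] V := fun x =>
    LinearMap.proj x ∘ₗ (Representation.coindV H.subtype ρ).subtype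
  have hev : ∀ g x f, ev x (Representation.coind H.subtype ρ g f) = ev (x * g) f :=
    fun _ _ _ => rfl
  have hevH : ∀ (h : H) x f, ev (h * x) f = ρ h (ev x f) := fun h x f => f.2 h x
  have hinv : RepInvariant ρ ((X ⊓ LinearMap.ker (ev 1)).map (ev t)) := by
    rintro h _ ⟨f, ⟨hfX, hf1⟩, rfl⟩
    have hth : t⁻¹ * h * t ∈ H := by simpa using hnormal.conj_mem h h.2 t⁻¹
    refine ⟨Representation.coind H.subtype ρ (t⁻¹ * h * t) f, ⟨hX _ _ hfX, ?_⟩, ?_⟩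
    · have := hevH ⟨_, hth⟩ 1 f
      rw [mul_one, LinearMap.mem_ker.1 hf1, map_zero] at this
      rw [SetLike.mem_coe, LinearMap.mem_ker, hev, one_mul]
      exact this
    · rw [hev, ← hevH]
      congr 2
      group
  rcases hirr.2 _ hinv with h | h
  · by_cases hX0 : X = ⊥
    · exact .inl hX0
    exfalso
    have hinj : Function.Injective ((ev 1).domRestrict X) := by
      rw [injective_iff_map_eq_zero]
      rintro ⟨f, hfX⟩ hf
      have hft : ev t f ∈ (X ⊓ LinearMap.ker (ev 1)).map (ev t) := ⟨f, ⟨hfX, hf⟩, rfl⟩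
      rw [h, Submodule.mem_bot] at hft
      exact Subtype.ext (coindV_eq_zero_of_index_two ρ hH ht hf hft)
    have hsurj : Function.Surjective ((ev 1).domRestrict X) := by
      rw [← LinearMap.range_eq_top]
      refine (hirr.2 _ ?_).resolve_left fun h0 => hX0 ?_
      · rintro g _ ⟨⟨f, hf⟩, rfl⟩
        refine ⟨⟨Representation.coind H.subtype ρ g f, hX _ _ hf⟩, ?_⟩
        have := hevH g 1 f
        rw [mul_one, ← one_mul (g : G), ← hev] at this
        exact this
      · rw [eq_bot_iff]
        intro f hf
        have : (ev 1).domRestrict X ⟨f, hf⟩ = 0 := by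
          rw [← Submodule.mem_bot F, ← h0]
          exact LinearMap.mem_range_self _ _
        have := hinj (this.trans (map_zero _).symm)
        exact congrArg Subtype.val this
    let σ : Representation F G X :=
      { toFun := fun g => (Representation.coind H.subtype ρ g).restrict (hX g)
        map_one' := by simp only [map_one]; rfl
        map_mul' := fun _ _ => by simp only [map_mul]; rfl }
    let e := LinearEquiv.ofBijective _ ⟨hinj, hsurj⟩
    refine hnotext X σ ⟨e.symm, fun g v => ?_⟩
    rw [LinearEquiv.symm_apply_eq]
    obtain ⟨x, rfl⟩ := e.surjective v
    rw [e.symm_apply_apply]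
    have := hevH g 1 x.1
    rw [mul_one, ← one_mul (g : G), ← hev] at this
    exact this.symm
  · right
    have key : ∀ f, ev 1 f = 0 → f ∈ X := by
      intro f hf
      obtain ⟨k, ⟨hkX, hk1⟩, hk⟩ : ev t f ∈ (X ⊓ LinearMap.ker (ev 1)).map (ev t) :=
        h ▸ Submodule.mem_top
      have : f - k = 0 := by
        refine coindV_eq_zero_of_index_two ρ hH ht ?_ ?_
        · change ev 1 (f - k) = 0
          rw [map_sub, hf, LinearMap.mem_ker.1 hk1, sub_zero]
        · change ev t (f - k) = 0
          rw [map_sub, hk, sub_self]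
      rwa [sub_eq_zero.1 this]
    rw [eq_top_iff]
    intro f _
    obtain ⟨k, ⟨hkX, hk1⟩, hk⟩ : ev t f ∈ (X ⊓ LinearMap.ker (ev 1)).map (ev t) :=
      h ▸ Submodule.mem_top
    have hfk : Representation.coind H.subtype ρ t (f - k) ∈ X :=
      key _ (by rw [hev, one_mul, map_sub, hk, sub_self])
    have := hX t⁻¹ _ hfk
    rw [← Module.End.mul_apply, ← map_mul, inv_mul_cancel, map_one, Module.End.one_apply] at this
    simpa using X.add_mem this hkX

/-- let `F` be algebraically closed of characteristic 2, `n ≥ 5`, and `V`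
an irreducible `F Aₙ`-module which does not extend to `Sₙ` (there is no `F Sₙ`-module
whose restriction to `Aₙ` is isomorphic to `V`). Then `dim V ≥ 2^((n-6)/4)`. -/
theorem stmt4 {F : Type*} [Field F] [IsAlgClosed F] [CharP F 2]
    {n : ℕ} (hn : 5 ≤ n)
    (V : Type u) [AddCommGroup V] [Module F V] [FiniteDimensional F V]
    (ρ : Representation F (alternatingGroup (Fin n)) V)
    (hirr : RepIrreducible ρ)
    (hnotext : ∀ (W : Type u) [AddCommGroup W] [Module F W]
      (σ : Representation F (Equiv.Perm (Fin n)) W),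
      ¬ ∃ e : V ≃ₗ[F] W, ∀ (g : alternatingGroup (Fin n)) (v : V),
          e (ρ g v) = σ (g : Equiv.Perm (Fin n)) (e v)) :
    (2 : ℝ) ^ (((n : ℝ) - 6) / 4) ≤ (Module.finrank F V : ℝ) := by
  have : Nontrivial (Fin n) := Fin.nontrivial_iff_two_le.2 (by omega)
  have hH : (alternatingGroup (Fin n)).index = 2 := alternatingGroup.index_eq_two
  obtain ⟨hfin, hdim⟩ := finrank_coindV_le_of_index_two ρ hH
  obtain ⟨r, hr, hr2⟩ := exists_two_pow_le_finrank_of_fixed_mem_range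
    (Representation.coind (alternatingGroup (Fin n)).subtype ρ)
    (coind_irreducible_of_not_extends hH ρ hirr hnotext)
    (fun a b hab w hw => coind_exists_add_eq_of_fixed ρ hH
      (by simp [Equiv.Perm.mem_alternatingGroup, Equiv.Perm.sign_swap hab]) w hw)
  rw [Fintype.card_fin] at hr
  have hr' : (2 : ℝ) ^ r ≤ 2 * (Module.finrank F V : ℝ) := by exact_mod_cast hr2.trans hdim
  have hn' : (n : ℝ) ≤ 4 * r + 1 := by exact_mod_cast hr
  calc (2 : ℝ) ^ (((n : ℝ) - 6) / 4) ≤ 2 ^ ((r : ℝ) - 1) :=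
        Real.rpow_le_rpow_of_exponent_le (by norm_num) (by linarith)
    _ = 2 ^ r / 2 := by rw [Real.rpow_sub (by norm_num), Real.rpow_natCast, Real.rpow_one]
    _ ≤ Module.finrank F V := by linarith
end

section
/- Let F be an algebraically closed field of characteristic p ≠ 2 (p a prime or 0), n ≥ 5, and let V be an irreducible F A_n-module. Suppose that V does not extend to S_n, i.e. there is no F S_n-module W whose restriction to A_n is isomorphic to V. Then dim_F V ≥ 2^{(n−p−5)/4}. -/
section SignSpaces

variable {F U ι : Type*} [Field F] [AddCommGroup U] [Module F U]

/-- The joint eigenspace of the family `t` on which `t i` acts by `-1` for `i ∈ T` and by `1`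
otherwise. -/
def signSpace (t : ι → Module.End F U) (T : Finset ι) : Submodule F U where
  carrier := {v | ∀ i, (i ∈ T → t i v = -v) ∧ (i ∉ T → t i v = v)}
  add_mem' {a b} ha hb i := by
    refine ⟨fun h => ?_, fun h => ?_⟩
    · rw [map_add, (ha i).1 h, (hb i).1 h, neg_add]
    · rw [map_add, (ha i).2 h, (hb i).2 h]
  zero_mem' i := by simp
  smul_mem' c a ha i := by
    refine ⟨fun h => ?_, fun h => ?_⟩
    · rw [map_smul, (ha i).1 h, smul_neg]
    · rw [map_smul, (ha i).2 h]

/-- For commuting involutions, a vector that is a joint eigenvector for the indices outside `D`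
lies in the sum of the joint eigenspaces with the same signs outside `D`. -/
lemma mem_of_signSpace_le [DecidableEq ι] (h2 : (2 : F) ≠ 0) {t : ι → Module.End F U}
    (hsq : ∀ i v, t i (t i v) = v) (hcomm : ∀ i j v, t i (t j v) = t j (t i v))
    (P : Submodule F U) (D : Finset ι) (T : Finset ι) (v : U)
    (hv : ∀ i ∉ D, (i ∈ T → t i v = -v) ∧ (i ∉ T → t i v = v))
    (hP : ∀ T' : Finset ι, (∀ i ∉ D, i ∈ T' ↔ i ∈ T) → signSpace t T' ≤ P) : v ∈ P := by
  induction D using Finset.induction_on generalizing T v with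
  | empty => exact hP T (fun _ _ => Iff.rfl) fun i => hv i (by simp)
  | insert j D hj ih =>
    have h1 : v + t j v ∈ P := by
      refine ih (T.erase j) _ (fun i hi => ?_) fun T' hT' => hP T' fun i hi => ?_
      · by_cases hij : i = j
        · subst hij
          simp [hsq, add_comm]
        · have := hv i (by simp [hij, hi])
          refine ⟨fun h => ?_, fun h => ?_⟩
          · rw [map_add, hcomm, this.1 (Finset.mem_of_mem_erase h), map_neg, neg_add]
          · rw [map_add, hcomm, this.2 (fun h' => h (Finset.mem_erase.2 ⟨hij, h'⟩))]
      · simp only [Finset.mem_insert, not_or] at hi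
        simp [hT' i hi.2, hi.1]
    have h2' : v - t j v ∈ P := by
      refine ih (insert j T) _ (fun i hi => ?_) fun T' hT' => hP T' fun i hi => ?_
      · by_cases hij : i = j
        · subst hij
          simp [hsq]
        · have := hv i (by simp [hij, hi])
          refine ⟨fun h => ?_, fun h => ?_⟩
          · rw [map_sub, hcomm, this.1 ((Finset.mem_insert.1 h).resolve_left hij), map_neg]
            abel
          · rw [map_sub, hcomm, this.2 (fun h' => h (Finset.mem_insert_of_mem h'))]
      · simp only [Finset.mem_insert, not_or] at hi
        simp [hT' i hi.2, hi.1]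
    have h3 : v = (2 : F)⁻¹ • ((v + t j v) + (v - t j v)) := by
      rw [add_add_sub_cancel, ← two_smul F v, smul_smul, inv_mul_cancel₀ h2, one_smul]
    rw [h3]
    exact P.smul_mem _ (P.add_mem h1 h2')

lemma iSupIndep_signSpace (h2 : (2 : F) ≠ 0) {t : ι → Module.End F U}
    (hcomm : ∀ i j v, t i (t j v) = t j (t i v)) : iSupIndep (signSpace t) := by
  classical
  let χ : Finset ι → ι → F := fun T i => if i ∈ T then -1 else 1
  have hχ : Function.Injective χ := by
    intro T T' h
    ext i
    have h1 : (-1 : F) ≠ 1 := by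
      intro h1
      apply h2
      linear_combination -h1
    have hi : (if i ∈ T then (-1 : F) else 1) = if i ∈ T' then -1 else 1 := congrFun h i
    by_cases ha : i ∈ T <;> by_cases hb : i ∈ T'
    · simp only [ha, hb]
    · exact absurd (by simpa only [if_pos ha, if_neg hb] using hi) h1
    · exact absurd (by simpa only [if_neg ha, if_pos hb] using hi.symm) h1
    · simp only [ha, hb]
  have key := Module.End.independent_iInf_maxGenEigenspace_of_forall_mapsTo t
    (fun i j φ => Module.End.mapsTo_maxGenEigenspace_of_comm
      (LinearMap.ext fun v => hcomm j i v) φ)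
  refine (key.comp hχ).mono fun T v hv => ?_
  simp only [Function.comp, Submodule.mem_iInf]
  intro i
  refine Module.End.eigenspace_le_maxGenEigenspace ?_
  rw [Module.End.mem_eigenspace_iff]
  by_cases h : i ∈ T
  · simp [χ, h, (hv i).1 h]
  · simp [χ, h, (hv i).2 h]

end SignSpaces

section Matching

open Equiv

variable {F U : Type*} [Field F] [AddCommGroup U] [Module F U] {n k : ℕ}

/-- The operators of the pairwise disjoint transpositions given by a partial matching. -/
def matchingOp (R : Representation F (Perm (Fin n)) U) (e : Fin k × Bool ↪ Fin n) (i : Fin k) :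
    Module.End F U :=
  R (swap (e (i, false)) (e (i, true)))

variable {R : Representation F (Perm (Fin n)) U} {e : Fin k × Bool ↪ Fin n}

lemma matchingOp_sq (i : Fin k) (v : U) : matchingOp R e i (matchingOp R e i v) = v := by
  rw [matchingOp, ← Module.End.mul_apply, ← map_mul, swap_mul_self, map_one, Module.End.one_apply]

/-- Moving a permutation past a transposition operator. -/
lemma apply_matchingOp (g : Perm (Fin n)) (i : Fin k) (v : U) :
    R g (matchingOp R e i v) = R (swap (g (e (i, false))) (g (e (i, true)))) (R g v) := by
  rw [matchingOp, ← Module.End.mul_apply, ← Module.End.mul_apply, ← map_mul, ← map_mul,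
    mul_swap_eq_swap_mul]

lemma matchingOp_comm (i j : Fin k) (v : U) :
    matchingOp R e i (matchingOp R e j v) = matchingOp R e j (matchingOp R e i v) := by
  by_cases hij : i = j
  · rw [hij]
  · conv_lhs => rw [matchingOp]
    rw [apply_matchingOp, swap_apply_of_ne_of_ne, swap_apply_of_ne_of_ne]
    · rfl
    all_goals simp [Ne.symm hij]

/-- Joint eigenspaces for sign patterns of the same size are conjugate. -/
lemma signSpace_ne_bot_of_card_eq {T T' : Finset (Fin k)} (hT : T.card = T'.card)
    (h : signSpace (matchingOp R e) T ≠ ⊥) : signSpace (matchingOp R e) T' ≠ ⊥ := by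
  obtain ⟨v, hv, hv0⟩ := (Submodule.ne_bot_iff _).1 h
  let π : Perm (Fin k) := (Finset.equivOfCardEq hT).extendSubtype
  have hπ : ∀ i, π i ∈ T' ↔ i ∈ T := fun i => by
    refine ⟨fun h => ?_, fun h => Equiv.extendSubtype_mem _ i h⟩
    by_contra h'
    exact Equiv.extendSubtype_not_mem (Finset.equivOfCardEq hT) i h' h
  let g : Perm (Fin n) := Perm.viaEmbedding (prodCongr π (Equiv.refl Bool)) e
  have hg : ∀ i b, g (e (i, b)) = e (π i, b) := fun i b => by
    simp [g, Perm.viaEmbedding_apply]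
  have hop : ∀ i w, R g (matchingOp R e i w) = matchingOp R e (π i) (R g w) := fun i w => by
    rw [apply_matchingOp, hg, hg, matchingOp]
  refine (Submodule.ne_bot_iff _).2 ⟨R g v, fun j => ?_, fun h0 => hv0 ?_⟩
  · obtain ⟨i, rfl⟩ := π.surjective j
    rw [hπ, ← hop]
    refine ⟨fun h => ?_, fun h => ?_⟩
    · rw [(hv i).1 h, map_neg]
    · rw [(hv i).2 h]
  · rw [← Module.End.one_apply (R := F) v, ← map_one R, ← inv_mul_cancel g, map_mul,
      Module.End.mul_apply, h0, map_zero]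

/-- A representation of small dimension has no joint eigenvector of a given pattern size. -/
lemma signSpace_eq_bot_of_finrank_lt [FiniteDimensional F U] (h2 : (2 : F) ≠ 0)
    {T : Finset (Fin k)} (h : Module.finrank F U < k.choose T.card) :
    signSpace (matchingOp R e) T = ⊥ := by
  classical
  by_contra hT
  have hle := (iSupIndep_signSpace h2
    (t := matchingOp R e) matchingOp_comm).subtype_ne_bot_le_finrank
  have hcard : k.choose T.card ≤ Fintype.card
      {T' : Finset (Fin k) // signSpace (matchingOp R e) T' ≠ ⊥} := by
    rw [Fintype.card_subtype]
    calc k.choose T.card = (Finset.powersetCard T.card (Finset.univ : Finset (Fin k))).card := by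
          simp
      _ ≤ _ := Finset.card_le_card fun T' hT' => by
          simp only [Finset.mem_filter, Finset.mem_univ, true_and]
          exact signSpace_ne_bot_of_card_eq (Finset.mem_powersetCard.1 hT').2.symm hT
  omega

/-- The edges of a matching that meet a given vertex: at most one. -/
lemma card_edges_at_le_one (a : Fin n) :
    (Finset.univ.filter fun i => ∃ b, e (i, b) = a).card ≤ 1 := by
  rw [Finset.card_le_one]
  simp only [Finset.mem_filter, Finset.mem_univ, true_and]
  rintro i ⟨b, hb⟩ j ⟨c, hc⟩
  exact (Prod.ext_iff.1 (e.injective (hb.trans hc.symm))).1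

/-- If no pattern of size `m` or `m + 1` occurs, the sum of the joint eigenspaces for patterns
of size less than `m` is stable under the symmetric group. -/
lemma iSup_signSpace_stable (h2 : (2 : F) ≠ 0) {m : ℕ}
    (hmid : ∀ T : Finset (Fin k), T.card = m ∨ T.card = m + 1 →
      signSpace (matchingOp R e) T = ⊥)
    (g : Perm (Fin n)) :
    ∀ v ∈ ⨆ T ∈ {T : Finset (Fin k) | T.card < m}, signSpace (matchingOp R e) T,
      R g v ∈ ⨆ T ∈ {T : Finset (Fin k) | T.card < m}, signSpace (matchingOp R e) T := by
  classical
  set L := ⨆ T ∈ {T : Finset (Fin k) | T.card < m}, signSpace (matchingOp R e) T with hL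
  induction g using Perm.swap_induction_on with
  | one => simp
  | swap_mul f x y _ ih =>
    intro v hv
    rw [map_mul, Module.End.mul_apply]
    suffices h : L ≤ L.comap (R (swap x y)) from h (ih v hv)
    conv_lhs => rw [hL]
    refine iSup₂_le fun T hT w hw => ?_
    set D : Finset (Fin k) := (Finset.univ.filter fun i => ∃ b, e (i, b) = x) ∪
      Finset.univ.filter fun i => ∃ b, e (i, b) = y with hD
    have hDcard : D.card ≤ 2 := (Finset.card_union_le _ _).trans
      (add_le_add (card_edges_at_le_one x) (card_edges_at_le_one y))
    refine mem_of_signSpace_le h2 (t := matchingOp R e) matchingOp_sq matchingOp_comm L D T _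
      (fun i hi => ?_) fun T' hT' => ?_
    · have hi' : (∀ b, e (i, b) ≠ x) ∧ ∀ b, e (i, b) ≠ y := by
        simpa [hD, not_or] using hi
      have hop : matchingOp R e i (R (swap x y) w) = R (swap x y) (matchingOp R e i w) := by
        rw [apply_matchingOp, swap_apply_of_ne_of_ne (hi'.1 _) (hi'.2 _),
          swap_apply_of_ne_of_ne (hi'.1 _) (hi'.2 _), matchingOp]
      rw [hop]
      refine ⟨fun h => ?_, fun h => ?_⟩
      · rw [(hw i).1 h, map_neg]
      · rw [(hw i).2 h]
    · have hsub : T' ⊆ T ∪ D := fun i hi => by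
        by_cases h : i ∈ D
        · exact Finset.mem_union_right _ h
        · exact Finset.mem_union_left _ ((hT' i h).1 hi)
      have hcard := (Finset.card_le_card hsub).trans (Finset.card_union_le _ _)
      have hT : T.card < m := hT
      by_cases h : T'.card < m
      · exact le_iSup₂_of_le T' h le_rfl
      · rw [hmid T' (by omega)]
        exact bot_le

end Matching

section Coinduced

open Equiv Representation

variable {F V : Type*} [Field F] [AddCommGroup V] [Module F V] {n : ℕ}
  (ρ : Representation F (alternatingGroup (Fin n)) V)

/-- Multiplication by the sign character on the coinduced module. -/
def signTwist : Module.End F (coindV (alternatingGroup (Fin n)).subtype ρ) where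
  toFun f := ⟨fun x => (Perm.sign x : ℤ) • f.1 x, fun h x => by
    have hh : Perm.sign (h : Perm (Fin n)) = 1 := Perm.mem_alternatingGroup.1 h.2
    have := f.2 h x
    simp only [Subgroup.subtype_apply] at this ⊢
    rw [this, Perm.sign_mul, hh, one_mul, map_zsmul]⟩
  map_add' f g := Subtype.ext <| funext fun x => smul_add _ (f.1 x) (g.1 x)
  map_smul' c f := Subtype.ext <| funext fun x => smul_comm _ c (f.1 x)

lemma signTwist_apply (f : coindV (alternatingGroup (Fin n)).subtype ρ) (x : Perm (Fin n)) :
    (signTwist ρ f).1 x = (Perm.sign x : ℤ) • f.1 x := rfl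

lemma coind_apply_apply (g : Perm (Fin n)) (f : coindV (alternatingGroup (Fin n)).subtype ρ)
    (x : Perm (Fin n)) :
    (coind (alternatingGroup (Fin n)).subtype ρ g f).1 x = f.1 (x * g) := rfl

lemma coindV_apply_mul_s5 (f : coindV (alternatingGroup (Fin n)).subtype ρ)
    (h : alternatingGroup (Fin n)) (x : Perm (Fin n)) : f.1 (h * x) = ρ h (f.1 x) := f.2 h x

lemma coind_signTwist_of_odd {g : Perm (Fin n)} (hg : Perm.sign g = -1)
    (f : coindV (alternatingGroup (Fin n)).subtype ρ) :
    coind (alternatingGroup (Fin n)).subtype ρ g (signTwist ρ f) =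
      -signTwist ρ (coind (alternatingGroup (Fin n)).subtype ρ g f) := by
  ext x
  rw [coind_apply_apply, signTwist_apply, Submodule.coe_neg, Pi.neg_apply, signTwist_apply,
    coind_apply_apply, Perm.sign_mul, hg]
  simp

/-- The coinduced module has at most twice the original dimension. -/
lemma finrank_coindV_le [FiniteDimensional F V] {s : Perm (Fin n)} (hs : Perm.sign s = -1) :
    FiniteDimensional F (coindV (alternatingGroup (Fin n)).subtype ρ) ∧
    Module.finrank F (coindV (alternatingGroup (Fin n)).subtype ρ) ≤ 2 * Module.finrank F V := by
  let E : coindV (alternatingGroup (Fin n)).subtype ρ →ₗ[F] V × V :=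
    ((LinearMap.proj 1).prod (LinearMap.proj s)).comp (Submodule.subtype _)
  have hE : Function.Injective E := by
    rw [← LinearMap.ker_eq_bot, LinearMap.ker_eq_bot']
    intro f hf
    have h1 : f.1 1 = 0 := congrArg Prod.fst hf
    have h2 : f.1 s = 0 := congrArg Prod.snd hf
    ext x
    rcases Int.units_eq_one_or (Perm.sign x) with hx | hx
    · have := coindV_apply_mul_s5 ρ f ⟨x, Perm.mem_alternatingGroup.2 hx⟩ 1
      rwa [h1, map_zero, mul_one] at this
    · have := coindV_apply_mul_s5 ρ f
        ⟨x * s⁻¹, Perm.mem_alternatingGroup.2 (by rw [Perm.sign_mul, Perm.sign_inv, hx, hs]; rfl)⟩ s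
      rwa [h2, map_zero, inv_mul_cancel_right] at this
  refine ⟨FiniteDimensional.of_injective E hE, ?_⟩
  have := LinearMap.finrank_le_finrank_of_injective hE
  rwa [Module.finrank_prod, ← two_mul] at this

/-- Every vector of `V` is the value at `1` of an element of the coinduced module. -/
lemma exists_coindV_apply_one (v : V) :
    ∃ f : coindV (alternatingGroup (Fin n)).subtype ρ, f.1 1 = v := by
  classical
  refine ⟨⟨fun x => if hx : x ∈ alternatingGroup (Fin n) then ρ ⟨x, hx⟩ v else 0,
    fun h x => ?_⟩, ?_⟩
  · have hiff : (h : Perm (Fin n)) * x ∈ alternatingGroup (Fin n) ↔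
        x ∈ alternatingGroup (Fin n) := Subgroup.mul_mem_cancel_left _ h.2
    by_cases hx : x ∈ alternatingGroup (Fin n)
    · refine (dif_pos (hiff.2 hx)).trans ?_
      refine Eq.trans ?_ (congrArg (ρ h) (dif_pos hx)).symm
      exact congrFun (congrArg DFunLike.coe (map_mul ρ h ⟨x, hx⟩)) v
    · refine (dif_neg (mt hiff.1 hx)).trans ?_
      exact ((congrArg (ρ h) (dif_neg hx)).trans (map_zero _)).symm
  · simp only [dif_pos (one_mem (alternatingGroup (Fin n)))]
    exact congrFun (congrArg DFunLike.coe (map_one ρ)) v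

/-- An irreducible module of the alternating group whose dimension is small compared with a
central binomial coefficient extends to the symmetric group: the extension is the part of the
coinduced module on which few of the transpositions in a matching act by `-1`. -/
lemma exists_extension_of_finrank_lt [FiniteDimensional F V] (h2 : (2 : F) ≠ 0)
    (hirr : RepIrreducible ρ) {m : ℕ} (hn : 2 * (2 * m + 1) ≤ n)
    (hdim : 2 * Module.finrank F V < (2 * m + 1).choose m) :
    ∃ (W : Submodule F (coindV (alternatingGroup (Fin n)).subtype ρ))
      (σ : Representation F (Perm (Fin n)) W) (e : V ≃ₗ[F] W),
      ∀ (g : alternatingGroup (Fin n)) (v : V), e (ρ g v) = σ (g : Perm (Fin n)) (e v) := by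
  classical
  obtain ⟨e⟩ : Nonempty (Fin (2 * m + 1) × Bool ↪ Fin n) :=
    Function.Embedding.nonempty_of_card_le (by simpa [mul_comm] using hn)
  set R := coind (alternatingGroup (Fin n)).subtype ρ
  have hodd : ∀ i, Perm.sign (swap (e (i, false)) (e (i, true))) = -1 := fun i =>
    Perm.sign_swap (by simp)
  obtain ⟨hfd, hfr⟩ := finrank_coindV_le ρ (hodd 0)
  have hmid : ∀ T : Finset (Fin (2 * m + 1)), T.card = m ∨ T.card = m + 1 →
      signSpace (matchingOp R e) T = ⊥ := by
    intro T hT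
    refine signSpace_eq_bot_of_finrank_lt h2 (hfr.trans_lt ?_)
    rcases hT with hT | hT <;> rw [hT]
    · exact hdim
    · rwa [← Nat.choose_symm_half] at hdim
  let small : Set (Finset (Fin (2 * m + 1))) := {T | T.card < m}
  let large : Set (Finset (Fin (2 * m + 1))) := {T | m + 1 < T.card}
  let L := ⨆ T ∈ small, signSpace (matchingOp R e) T
  let L' := ⨆ T ∈ large, signSpace (matchingOp R e) T
  have hdisj : Disjoint L L' := by
    refine (iSupIndep_signSpace h2 matchingOp_comm).disjoint_biSup_biSup ?_
    rw [Set.disjoint_left]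
    intro T hT hT'
    have h1 : T.card < m := hT
    have h2 : m + 1 < T.card := hT'
    omega
  have htwist : ∀ T, ∀ f ∈ signSpace (matchingOp R e) T,
      signTwist ρ f ∈ signSpace (matchingOp R e) Tᶜ := by
    intro T f hf i
    have : matchingOp R e i (signTwist ρ f) = -signTwist ρ (matchingOp R e i f) :=
      coind_signTwist_of_odd ρ (hodd i) f
    rw [this, Finset.mem_compl, not_not]
    refine ⟨fun h => ?_, fun h => ?_⟩
    · rw [(hf i).2 h]
    · rw [(hf i).1 h, map_neg, neg_neg]
  have hcompl : ∀ T : Finset (Fin (2 * m + 1)), Tᶜ.card + T.card = 2 * m + 1 := fun T => by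
    rw [Finset.card_compl_add_card, Fintype.card_fin]
  have htwistL : L ≤ L'.comap (signTwist ρ) := iSup₂_le fun T hT f hf => by
    have hT : T.card < m := hT
    have := hcompl T
    exact (le_iSup₂_of_le (f := fun T (_ : T ∈ large) => signSpace (matchingOp R e) T) Tᶜ
      (show m + 1 < Tᶜ.card by omega) le_rfl) (htwist T f hf)
  let σ : Representation F (Perm (Fin n)) L :=
    (Subrepresentation.mk (ρ := R) L (iSup_signSpace_stable h2 hmid)).toRepresentation
  let ev : coindV (alternatingGroup (Fin n)).subtype ρ →ₗ[F] V :=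
    (LinearMap.proj 1).comp (Submodule.subtype _)
  have hev : ∀ (g : alternatingGroup (Fin n)) f, ev (R g f) = ρ g (ev f) := fun g f => by
    have := coindV_apply_mul_s5 ρ f g 1
    change f.1 (1 * g) = ρ g (f.1 1)
    rwa [one_mul, ← mul_one (g : Perm (Fin n))]
  have hinj : Function.Injective (ev.comp L.subtype) := by
    refine (injective_iff_map_eq_zero _).2 ?_
    rintro ⟨f, hf⟩ hf0
    have hf0 : f.1 1 = 0 := hf0
    have hneg : signTwist ρ f = -f := by
      ext x
      rw [signTwist_apply]
      rcases Int.units_eq_one_or (Perm.sign x) with hx | hx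
      · have := coindV_apply_mul_s5 ρ f ⟨x, Perm.mem_alternatingGroup.2 hx⟩ 1
        rw [hf0, map_zero, mul_one] at this
        have this : f.1 x = 0 := this
        simp [this]
      · simp [hx]
    have hf' : f ∈ L' := by
      have := htwistL hf
      rw [Submodule.mem_comap, hneg] at this
      exact (Submodule.neg_mem_iff _).1 this
    exact Subtype.ext (Submodule.disjoint_def.1 hdisj f hf hf')
  have hsurj : Function.Surjective (ev.comp L.subtype) := by
    rw [← LinearMap.range_eq_top]
    refine (hirr.2 _ ?_).resolve_left fun hbot => ?_
    · rintro g _ ⟨f, rfl⟩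
      exact ⟨σ g f, hev g f⟩
    · have hL0 : ∀ f ∈ L, ev f = 0 := fun f hf => by
        have : ev f ∈ LinearMap.range (ev.comp L.subtype) := ⟨⟨f, hf⟩, rfl⟩
        rwa [hbot] at this
      obtain ⟨v, hv⟩ := @exists_ne V hirr.1 0
      obtain ⟨f, rfl⟩ := exists_coindV_apply_one ρ v
      refine hv ?_
      have hf : f ∈ LinearMap.ker ev := by
        refine mem_of_signSpace_le h2 (t := matchingOp R e) matchingOp_sq matchingOp_comm
          _ Finset.univ ∅ f (by simp) fun T _ w hw => ?_
        rw [LinearMap.mem_ker]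
        by_cases h : T.card < m
        · exact hL0 w ((le_iSup₂_of_le (f := fun T (_ : T ∈ small) =>
            signSpace (matchingOp R e) T) T h le_rfl) hw)
        · by_cases h' : m + 1 < T.card
          · have hc := hcompl T
            have := hL0 _ ((le_iSup₂_of_le (f := fun T (_ : T ∈ small) =>
              signSpace (matchingOp R e) T) Tᶜ (show Tᶜ.card < m by omega) le_rfl)
              (htwist T w hw))
            have this : (Perm.sign (1 : Perm (Fin n)) : ℤ) • w.1 1 = 0 := this
            rwa [Perm.sign_one, Units.val_one, one_smul] at this
          · rw [hmid T (by omega)] at hw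
            rw [(Submodule.mem_bot F).1 hw, map_zero]
      exact hf
  let E := LinearEquiv.ofBijective (ev.comp L.subtype) ⟨hinj, hsurj⟩
  refine ⟨L, σ, E.symm, fun g v => ?_⟩
  rw [LinearEquiv.symm_apply_eq]
  have h1 : E (σ g (E.symm v)) = ρ g (E (E.symm v)) := hev g _
  rw [h1, LinearEquiv.apply_symm_apply]

end Coinduced

lemma two_pow_le_choose_half (m : ℕ) : 2 ^ (m + 1) ≤ (2 * m + 1).choose m + 1 := by
  induction m with
  | zero => simp
  | succ m ih =>
    have h1 : (2 * (m + 1) + 1).choose (m + 1) =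
        (2 * m + 2).choose m + (2 * m + 2).choose (m + 1) := Nat.choose_succ_succ _ _
    have h2 : (2 * m + 2).choose (m + 1) = (2 * m + 1).choose m + (2 * m + 1).choose (m + 1) :=
      Nat.choose_succ_succ _ _
    have h3 : (2 * m + 1).choose (m + 1) = (2 * m + 1).choose m := Nat.choose_symm_half m
    have h4 : 0 < (2 * m + 2).choose m := Nat.choose_pos (by omega)
    rw [pow_succ]
    omega

/-- let `F` be algebraically closed of characteristic `p ≠ 2` (`p` a prime
or `0`), `n ≥ 5`, and `V` an irreducible `F Aₙ`-module which does not extend to `Sₙ`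
(there is no `F Sₙ`-module whose restriction to `Aₙ` is isomorphic to `V`). Then
`dim V ≥ 2^((n-p-5)/4)`. -/
theorem stmt5 {F : Type*} [Field F] [IsAlgClosed F] {p : ℕ} [CharP F p]
    (hp : p = 0 ∨ p.Prime) (hp2 : p ≠ 2)
    {n : ℕ} (hn : 5 ≤ n)
    (V : Type u) [AddCommGroup V] [Module F V] [FiniteDimensional F V]
    (ρ : Representation F (alternatingGroup (Fin n)) V)
    (hirr : RepIrreducible ρ)
    (hnotext : ∀ (W : Type u) [AddCommGroup W] [Module F W]
      (σ : Representation F (Equiv.Perm (Fin n)) W),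
      ¬ ∃ e : V ≃ₗ[F] W, ∀ (g : alternatingGroup (Fin n)) (v : V),
          e (ρ g v) = σ (g : Equiv.Perm (Fin n)) (e v)) :
    (2 : ℝ) ^ (((n : ℝ) - p - 5) / 4) ≤ (Module.finrank F V : ℝ) := by
  have h2 : (2 : F) ≠ 0 := by
    intro h
    have hdvd : p ∣ 2 := (CharP.cast_eq_zero_iff F p 2).1 (by exact_mod_cast h)
    rcases hp with rfl | hp
    · simp at hdvd
    · exact hp2 ((Nat.prime_dvd_prime_iff_eq hp Nat.prime_two).1 hdvd)
  obtain ⟨m, hm, hm'⟩ : ∃ m, 4 * m + 2 ≤ n ∧ n ≤ 4 * m + 5 := ⟨(n - 2) / 4, by omega, by omega⟩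
  have hV : 2 ^ m ≤ Module.finrank F V := by
    by_contra! hlt
    have hchoose := two_pow_le_choose_half m
    rw [pow_succ] at hchoose
    obtain ⟨W, σ, e, he⟩ := exists_extension_of_finrank_lt ρ h2 hirr (m := m)
      (by omega) (by omega)
    exact hnotext W σ ⟨e, he⟩
  calc (2 : ℝ) ^ (((n : ℝ) - p - 5) / 4) ≤ (2 : ℝ) ^ (m : ℝ) := by
        refine Real.rpow_le_rpow_of_exponent_le one_le_two ?_
        have h1 : (n : ℝ) ≤ 4 * m + 5 := by exact_mod_cast hm'
        have h3 : (0 : ℝ) ≤ p := Nat.cast_nonneg p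
        linarith
    _ = ((2 ^ m : ℕ) : ℝ) := by rw [Real.rpow_natCast]; push_cast; rfl
    _ ≤ _ := by exact_mod_cast hV
end

section
/- Let m ≥ 6 and 2 ≤ k < m/2, and let X = A_m act naturally on the set Ω of k-element subsets of Δ = {1,…,m}. Let f_2 and f_3 denote the number of X-orbits on 2-element subsets and on 3-element subsets of Ω, respectively, and set e_3 := f_3 − f_2. Then either e_3 ≥ 4, or k = 2 and e_3 = 3. -/
open scoped Pointwise

/-- `P` is a `j`-element set of `k`-element subsets of `{1, ..., m}`, i.e. a `j`-element
subset of `Ω`, where `Ω` is the set of `k`-element subsets of `{1, ..., m}`. -/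
def IsSubsetTuple (m k j : ℕ) (P : Finset (Finset (Fin m))) : Prop :=
  P.card = j ∧ ∀ A ∈ P, A.card = k

/-- Two `j`-element subsets of `Ω` are in the same orbit of the natural action of the
alternating group `A_m` (where `Ω` is the set of `k`-element subsets of `{1, ..., m}`). -/
def subsetTupleRel (m k j : ℕ)
    (P Q : {P : Finset (Finset (Fin m)) // IsSubsetTuple m k j P}) : Prop :=
  ∃ g : alternatingGroup (Fin m), (g : Equiv.Perm (Fin m)) • P.1 = Q.1

/-- The sizes of the union and of the intersection of a family of finite sets. -/
def unionInterCard {m : ℕ} (P : Finset (Finset (Fin m))) : ℕ × ℕ :=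
  ((Finset.univ.filter fun x => ∃ A ∈ P, x ∈ A).card,
    (Finset.univ.filter fun x => ∀ A ∈ P, x ∈ A).card)

theorem unionInterCard_smul {m : ℕ} (g : Equiv.Perm (Fin m)) (P : Finset (Finset (Fin m))) :
    unionInterCard (g • P) = unionInterCard P := by
  have h (x : Fin m) (A : Finset (Fin m)) : x ∈ g • A ↔ g⁻¹ x ∈ A := by
    rw [← Finset.inv_smul_mem_iff, Equiv.Perm.smul_def]
  have hP (B : Finset (Fin m)) : B ∈ g • P ↔ ∃ A ∈ P, g • A = B := Finset.mem_smul_finset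
  refine Prod.ext ?_ ?_ <;> dsimp only [unionInterCard]
  · refine Finset.card_equiv (g⁻¹ : Equiv.Perm (Fin m)) fun x => ?_
    simp only [Finset.mem_filter_univ, hP, exists_exists_and_eq_and, h]
  · refine Finset.card_equiv (g⁻¹ : Equiv.Perm (Fin m)) fun x => ?_
    simp only [Finset.mem_filter_univ, hP, forall_exists_index, and_imp,
      forall_apply_eq_imp_iff₂, h]

/-- The sizes of the union and of the intersection, as an invariant of orbits. -/
def orbitUnionInterCard (m k j : ℕ) : Quot (subsetTupleRel m k j) → ℕ × ℕ :=
  Quot.lift (fun P => unionInterCard P.1) fun P Q ⟨g, hg⟩ => by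
    rw [← hg, unionInterCard_smul]

/-- Triples of `k`-subsets with prescribed sizes of the regions of their Venn diagram. -/
theorem exists_orbitUnionInterCard_eq {m k : ℕ} (a b c ab ac bc abc : ℕ)
    (ha : a + ab + ac + abc = k) (hb : b + ab + bc + abc = k) (hc : c + ac + bc + abc = k)
    (hm : a + b + c + ab + ac + bc + abc ≤ m)
    (hab : ab + abc < k) (hac : ac + abc < k) (hbc : bc + abc < k) :
    ∃ q, orbitUnionInterCard m k 3 q = (a + b + c + ab + ac + bc + abc, abc) := by
  let n : Fin 7 → ℕ := ![a, b, c, ab, ac, bc, abc]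
  obtain ⟨e⟩ : Nonempty ((Σ i, Fin (n i)) ↪ Fin m) := by
    apply Function.Embedding.nonempty_of_card_le
    simp [Fin.sum_univ_succ, n]
    omega
  let R : Finset (Fin 7) → Finset (Fin m) := fun S => (S.sigma fun _ => Finset.univ).map e
  have hR (S) : (R S).card = ∑ i ∈ S, n i := by simp [R]
  have hmem (S) (x) : x ∈ R S ↔ ∃ y, y.1 ∈ S ∧ e y = x := by simp [R]
  have hinter (S T) : R S ∩ R T = R (S ∩ T) := by
    ext x
    simp only [Finset.mem_inter, hmem]
    constructor
    · rintro ⟨⟨y, hy, rfl⟩, z, hz, h⟩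
      obtain rfl := e.injective h
      exact ⟨z, ⟨hy, hz⟩, rfl⟩
    · rintro ⟨y, hy, rfl⟩
      exact ⟨⟨y, hy.1, rfl⟩, y, hy.2, rfl⟩
  have hunion (S T) : R S ∪ R T = R (S ∪ T) := by
    ext x
    simp only [Finset.mem_union, hmem]
    aesop
  have hne (S T) (h : ∑ i ∈ S ∩ T, n i < ∑ i ∈ S, n i) : R S ≠ R T := by
    intro hST
    have := hinter S T
    rw [← hST, Finset.inter_self] at this
    rw [← hR, ← hR, this] at h
    exact h.false
  let SA : Finset (Fin 7) := {0, 3, 4, 6}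
  let SB : Finset (Fin 7) := {1, 3, 5, 6}
  let SC : Finset (Fin 7) := {2, 4, 5, 6}
  have sA : ∑ i ∈ SA, n i = k := by simp [SA, n]; omega
  have sB : ∑ i ∈ SB, n i = k := by simp [SB, n]; omega
  have sC : ∑ i ∈ SC, n i = k := by simp [SC, n]; omega
  have hAB : R SA ≠ R SB := by
    apply hne
    rw [sA, show SA ∩ SB = {3, 6} by decide]
    simpa [n] using hab
  have hAC : R SA ≠ R SC := by
    apply hne
    rw [sA, show SA ∩ SC = {4, 6} by decide]
    simpa [n] using hac
  have hBC : R SB ≠ R SC := by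
    apply hne
    rw [sB, show SB ∩ SC = {5, 6} by decide]
    simpa [n] using hbc
  refine ⟨Quot.mk _ ⟨{R SA, R SB, R SC}, Finset.card_eq_three.2
    ⟨_, _, _, hAB, hAC, hBC, rfl⟩, ?_⟩, ?_⟩
  · simp [hR, sA, sB, sC]
  · have hU : (Finset.univ.filter fun x => ∃ A ∈ ({R SA, R SB, R SC} : Finset _), x ∈ A)
        = R Finset.univ := by
      rw [show (Finset.univ : Finset (Fin 7)) = SA ∪ (SB ∪ SC) by decide, ← hunion, ← hunion]
      ext x
      simp
    have hI : (Finset.univ.filter fun x => ∀ A ∈ ({R SA, R SB, R SC} : Finset _), x ∈ A)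
        = R {6} := by
      rw [show ({6} : Finset (Fin 7)) = SA ∩ (SB ∩ SC) by decide, ← hinter, ← hinter]
      ext x
      simp
    change unionInterCard _ = _
    rw [unionInterCard, hU, hI, hR, hR]
    refine Prod.ext ?_ ?_
    · simp [Fin.sum_univ_succ, n]
      omega
    · simp [n]

instance finite_quot_subsetTupleRel (m k j : ℕ) : Finite (Quot (subsetTupleRel m k j)) :=
  Quot.finite _

theorem le_card_orbits_three {m k : ℕ} (hm : 6 ≤ m) (hk : 2 ≤ k) (hkm : 2 * k < m) :
    2 * k + 1 ≤ Nat.card (Quot (subsetTupleRel m k 3)) := by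
  let v : Fin k ⊕ Fin (k - 1) ⊕ Bool → ℕ × ℕ :=
    Sum.elim (fun j => (2 * k + 1 - j, j))
      (Sum.elim (fun j => (2 * k - j, j)) fun t => (if t then k + 4 else k + 1, k - 2))
  have hv : Function.Injective v := by
    rintro (i | i | i) (j | j | j) h <;>
      simp only [v, Sum.elim_inl, Sum.elim_inr, Prod.mk.injEq] at h
    all_goals first
      | (exfalso; split_ifs at h <;> omega)
      | (exfalso; omega)
      | (congr 2; ext; omega)
      | (cases i <;> cases j <;> simp at h ⊢)
  have hex (x) : ∃ q, orbitUnionInterCard m k 3 q = v x := by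
    rcases x with j | j | t
    · obtain ⟨q, hq⟩ := exists_orbitUnionInterCard_eq (m := m) (k := k)
        1 (k - j) 1 0 (k - j - 1) 0 j
        (by omega) (by omega) (by omega) (by omega) (by omega) (by omega) (by omega)
      refine ⟨q, hq.trans (Prod.ext ?_ rfl)⟩
      simp only [v, Sum.elim_inl]
      omega
    · obtain ⟨q, hq⟩ := exists_orbitUnionInterCard_eq (m := m) (k := k)
        (k - j - 1) 1 0 0 1 (k - j - 1) j
        (by omega) (by omega) (by omega) (by omega) (by omega) (by omega) (by omega)
      refine ⟨q, hq.trans (Prod.ext ?_ rfl)⟩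
      simp only [v, Sum.elim_inl, Sum.elim_inr]
      omega
    · cases t
      · obtain ⟨q, hq⟩ := exists_orbitUnionInterCard_eq (m := m) (k := k)
          0 0 0 1 1 1 (k - 2)
          (by omega) (by omega) (by omega) (by omega) (by omega) (by omega) (by omega)
        refine ⟨q, hq.trans (Prod.ext ?_ rfl)⟩
        simp [v]
        omega
      · obtain ⟨q, hq⟩ := exists_orbitUnionInterCard_eq (m := m) (k := k)
          2 2 2 0 0 0 (k - 2)
          (by omega) (by omega) (by omega) (by omega) (by omega) (by omega) (by omega)
        refine ⟨q, hq.trans (Prod.ext ?_ rfl)⟩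
        simp [v]
        omega
  choose q hq using hex
  have hinj : Function.Injective q := fun x y h => hv (by rw [← hq, ← hq, h])
  have := Nat.card_le_card_of_injective q hinj
  simp only [Nat.card_sum, Nat.card_fin, Nat.card_eq_fintype_card (α := Bool),
    Fintype.card_bool] at this
  omega

/-- Two colourings of a finite type with equally large colour classes, one of which has at least
two elements, differ by an even permutation. -/
theorem exists_alternatingGroup_comp_eq {α γ : Type*} [Fintype α] [DecidableEq α] [Fintype γ]
    [DecidableEq γ] (f g : α → γ) (hcard : Fintype.card γ < Fintype.card α)
    (h : ∀ c, Fintype.card {a // f a = c} = Fintype.card {a // g a = c}) :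
    ∃ σ : alternatingGroup α, ∀ a, g ((σ : Equiv.Perm α) a) = f a := by
  let σ : Equiv.Perm α := Equiv.ofFiberEquiv fun c => Fintype.equivOfCardEq (h c)
  have hσ (a) : g (σ a) = f a := Equiv.ofFiberEquiv_map _ a
  obtain ⟨x, y, hxy, hf⟩ := Fintype.exists_ne_map_eq_of_card_lt f hcard
  rcases Int.units_eq_one_or σ.sign with hs | hs
  · exact ⟨⟨σ, hs⟩, hσ⟩
  · refine ⟨⟨σ * Equiv.swap x y, ?_⟩, fun a => ?_⟩
    · simp [Equiv.Perm.mem_alternatingGroup, hs, Equiv.Perm.sign_swap hxy]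
    · simp only [Equiv.Perm.mul_apply, hσ, Equiv.swap_apply_def]
      split_ifs <;> simp_all

theorem exists_alternatingGroup_smul_pair_eq {m : ℕ} (hm : 4 < m) {A B A' B' : Finset (Fin m)}
    (hA : A.card = A'.card) (hB : B.card = B'.card) (hU : (A ∪ B).card = (A' ∪ B').card) :
    ∃ g : alternatingGroup (Fin m), (g : Equiv.Perm (Fin m)) • A = A' ∧
      (g : Equiv.Perm (Fin m)) • B = B' := by
  have key (A B : Finset (Fin m)) (c : Bool × Bool) :
      (Fintype.card {a // (decide (a ∈ A), decide (a ∈ B)) = c} : ℤ) =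
        match c with
        | (true, true) => (A.card + B.card - (A ∪ B).card : ℤ)
        | (true, false) => (A ∪ B).card - B.card
        | (false, true) => (A ∪ B).card - A.card
        | (false, false) => m - (A ∪ B).card := by
    have h1 := Finset.card_union_add_card_inter A B
    have h2 := Finset.card_sdiff_add_card A B
    have h3 := Finset.card_sdiff_add_card B A
    have h4 := Finset.card_compl_add_card (A ∪ B)
    rw [Finset.union_comm B A] at h3
    rw [Fintype.card_fin] at h4
    rw [Fintype.card_subtype]
    rcases c with ⟨_ | _, _ | _⟩
    · rw [show (Finset.univ.filter fun a => (decide (a ∈ A), decide (a ∈ B)) = (false, false))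
        = (A ∪ B)ᶜ by ext; simp]
      simp only
      omega
    · rw [show (Finset.univ.filter fun a => (decide (a ∈ A), decide (a ∈ B)) = (false, true))
        = B \ A by ext; simp [and_comm]]
      simp only
      omega
    · rw [show (Finset.univ.filter fun a => (decide (a ∈ A), decide (a ∈ B)) = (true, false))
        = A \ B by ext; simp]
      simp only
      omega
    · rw [show (Finset.univ.filter fun a => (decide (a ∈ A), decide (a ∈ B)) = (true, true))
        = A ∩ B by ext; simp]
      simp only
      omega
  obtain ⟨g, hg⟩ := exists_alternatingGroup_comp_eq
    (fun a => (decide (a ∈ A), decide (a ∈ B))) (fun a => (decide (a ∈ A'), decide (a ∈ B')))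
    (by simpa using hm) fun c => by
      have := key A B c
      rw [hA, hB, hU, ← key A' B' c] at this
      exact_mod_cast this
  simp only [Prod.mk.injEq, decide_eq_decide] at hg
  refine ⟨g, ?_, ?_⟩
  · ext x
    rw [← Finset.inv_smul_mem_iff, Equiv.Perm.smul_def, ← (hg _).1, Equiv.Perm.inv_def,
      Equiv.apply_symm_apply]
  · ext x
    rw [← Finset.inv_smul_mem_iff, Equiv.Perm.smul_def, ← (hg _).2, Equiv.Perm.inv_def,
      Equiv.apply_symm_apply]

theorem unionInterCard_pair {m : ℕ} (A B : Finset (Fin m)) :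
    (unionInterCard {A, B}).1 = (A ∪ B).card := by
  dsimp only [unionInterCard]
  congr 1
  ext
  simp

theorem card_orbits_two_le {m : ℕ} (k : ℕ) (hm : 4 < m) :
    Nat.card (Quot (subsetTupleRel m k 2)) ≤ k := by
  have hpair (P : {P : Finset (Finset (Fin m)) // IsSubsetTuple m k 2 P}) :
      ∃ A B, P.1 = {A, B} ∧ A ≠ B ∧ A.card = k ∧ B.card = k := by
    obtain ⟨P, hP, hk⟩ := P
    obtain ⟨A, B, hAB, rfl⟩ := Finset.card_eq_two.1 hP
    exact ⟨A, B, rfl, hAB, hk _ (by simp), hk _ (by simp)⟩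
  have hmaps (q : Quot (subsetTupleRel m k 2)) :
      (orbitUnionInterCard m k 2 q).1 ∈ Finset.Ioc k (2 * k) := by
    induction q using Quot.ind with | mk P => ?_
    obtain ⟨A, B, hP, hAB, hA, hB⟩ := hpair P
    change (unionInterCard P.1).1 ∈ _
    rw [hP, unionInterCard_pair, Finset.mem_Ioc]
    refine ⟨?_, (Finset.card_union_le A B).trans (by omega)⟩
    rw [← hA]
    refine Finset.card_lt_card (Finset.ssubset_iff_subset_ne.2
      ⟨Finset.subset_union_left, fun h => hAB ?_⟩)
    exact (Finset.eq_of_subset_of_card_le (Finset.union_eq_left.1 h.symm) (by omega)).symm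
  have hinj : Function.Injective fun q => (⟨_, hmaps q⟩ : Finset.Ioc k (2 * k)) := by
    intro p q h
    induction p using Quot.ind with | mk P => ?_
    induction q using Quot.ind with | mk Q => ?_
    replace h : (unionInterCard P.1).1 = (unionInterCard Q.1).1 := congrArg Subtype.val h
    obtain ⟨A, B, hP, -, hA, hB⟩ := hpair P
    obtain ⟨A', B', hQ, -, hA', hB'⟩ := hpair Q
    rw [hP, hQ, unionInterCard_pair, unionInterCard_pair] at h
    obtain ⟨g, hgA, hgB⟩ := exists_alternatingGroup_smul_pair_eq hm
      (hA.trans hA'.symm) (hB.trans hB'.symm) h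
    refine Quot.sound ⟨g, ?_⟩
    rw [hP, hQ, ← hgA, ← hgB, Finset.smul_finset_insert, Finset.smul_finset_singleton]
  refine (Nat.card_le_card_of_injective _ hinj).trans ?_
  rw [Nat.card_eq_fintype_card, Fintype.card_coe, Nat.card_Ioc]
  omega

/-- let `m ≥ 6`, `2 ≤ k < m/2`, and let `X = A_m` act naturally on the set
`Ω` of `k`-element subsets of `{1, ..., m}`. Let `f₂` and `f₃` be the numbers of
`X`-orbits on 2-element and 3-element subsets of `Ω`, and `e₃ := f₃ - f₂`. Then either
`e₃ ≥ 4`, or `k = 2` and `e₃ = 3`. -/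
theorem stmt13 (m k : ℕ) (hm : 6 ≤ m) (hk : 2 ≤ k) (hkm : 2 * k < m) :
    4 + Nat.card (Quot (subsetTupleRel m k 2)) ≤ Nat.card (Quot (subsetTupleRel m k 3)) ∨
    (k = 2 ∧
      Nat.card (Quot (subsetTupleRel m k 3)) = Nat.card (Quot (subsetTupleRel m k 2)) + 3) := by
  have h3 := le_card_orbits_three hm hk hkm
  have h2 := card_orbits_two_le k (show 4 < m by omega)
  omega
end
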